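/- lim_{ε→0} [ln( dist(A_ε, ∂Ω) / diam(A_ε) )] / ln(1/ε) = 1. In particular, for any α ∈ (0,1) there exist constants C₁, C₂ > 0 such that C₁ ε ≤ diam(A_ε) ≤ C₂ ε^α for all sufficiently small ε. -/

import Mathlib

open MeasureTheory Real Filter Topology Set

noncomputable section

/-- The bilinear form `(K_H(x) a | b)` associated with the matrix
`K_H(x) = (k²+|x|²)⁻¹ [[k²+x₂², -x₁x₂],[-x₁x₂, k²+x₁²]]`. -/
def KHform (k : ℝ) (x a b : ℝ × ℝ) : ℝ :=
  (k ^ 2 + x.1 ^ 2 + x.2 ^ 2)⁻¹ *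
    ((k ^ 2 + x.2 ^ 2) * a.1 * b.1 - x.1 * x.2 * a.1 * b.2
      - x.1 * x.2 * a.2 * b.1 + (k ^ 2 + x.1 ^ 2) * a.2 * b.2)

/-- `K_H(x)` applied to a vector `a`. -/
def KHvec (k : ℝ) (x a : ℝ × ℝ) : ℝ × ℝ :=
  ((k ^ 2 + x.1 ^ 2 + x.2 ^ 2)⁻¹ * ((k ^ 2 + x.2 ^ 2) * a.1 - x.1 * x.2 * a.2),
   (k ^ 2 + x.1 ^ 2 + x.2 ^ 2)⁻¹ * (-(x.1 * x.2) * a.1 + (k ^ 2 + x.1 ^ 2) * a.2))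

/-- `det K_H(x) = k²/(k²+|x|²)`. -/
def detKH (k : ℝ) (x : ℝ × ℝ) : ℝ := k ^ 2 / (k ^ 2 + x.1 ^ 2 + x.2 ^ 2)

/-- Gradient of a scalar function on `ℝ²`. -/
def grad (u : ℝ × ℝ → ℝ) (x : ℝ × ℝ) : ℝ × ℝ :=
  (fderiv ℝ u x (1, 0), fderiv ℝ u x (0, 1))

/-- Divergence of a vector field on `ℝ²`. -/
def div2 (F : ℝ × ℝ → ℝ × ℝ) (x : ℝ × ℝ) : ℝ :=
  fderiv ℝ (fun y => (F y).1) x (1, 0) + fderiv ℝ (fun y => (F y).2) x (0, 1)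

/-- The operator `L_H u = -div (K_H(x) ∇u)`. -/
def LH (k : ℝ) (u : ℝ × ℝ → ℝ) (x : ℝ × ℝ) : ℝ :=
  - div2 (fun y => KHvec k y (grad u y)) x

/-- Positive part `t₊ = max (t, 0)`. -/
def pPart (t : ℝ) : ℝ := max t 0

/-- Clockwise rotation through `π/2`: `a^⊥`. -/
def perp2 (a : ℝ × ℝ) : ℝ × ℝ := (a.2, -a.1)

/-- Euclidean distance in the plane. -/
def dE (a b : ℝ × ℝ) : ℝ := Real.sqrt ((a.1 - b.1) ^ 2 + (a.2 - b.2) ^ 2)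

/-- Euclidean diameter of a planar set. -/
def diamE (S : Set (ℝ × ℝ)) : ℝ := sSup {d | ∃ a ∈ S, ∃ b ∈ S, d = dE a b}

/-- Euclidean distance between two planar sets. -/
def distE (A B : Set (ℝ × ℝ)) : ℝ := sInf {d | ∃ a ∈ A, ∃ b ∈ B, d = dE a b}

/-- The function `q² √(det K_H)`. -/
def Qfun (k : ℝ) (q : ℝ × ℝ → ℝ) (x : ℝ × ℝ) : ℝ := q x ^ 2 * Real.sqrt (detKH k x)

/-- Surrogate for membership in `H(Ω) = H¹₀(Ω)` (with equivalent norm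
`‖u‖² = ∫_Ω (K_H ∇u|∇u)`). -/
def MemH (k : ℝ) (Ω : Set (ℝ × ℝ)) (u : ℝ × ℝ → ℝ) : Prop :=
  ContinuousOn u (closure Ω) ∧ ContDiffOn ℝ 1 u Ω ∧ (∀ x ∈ frontier Ω, u x = 0) ∧
    IntegrableOn (fun x => KHform k x (grad u x) (grad u x)) Ω

/-- The energy functional `I_ε`. -/
def Ieps (k p ε : ℝ) (q : ℝ × ℝ → ℝ) (Ω : Set (ℝ × ℝ)) (u : ℝ × ℝ → ℝ) : ℝ :=
  (1 / 2) * (∫ x in Ω, KHform k x (grad u x) (grad u x))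
    - (1 / ((p + 1) * ε ^ 2)) * ∫ x in Ω, pPart (u x - q x * Real.log (1 / ε)) ^ (p + 1)

/-- The mountain pass value `c_ε = inf_{γ ∈ P_ε} max_{t ∈ [0,1]} I_ε(γ(t))`, where
`P_ε` is the collection of paths in `H(Ω)` (continuous for the `H`-norm) joining `0`
to a point with negative energy. -/
def ceps (k p : ℝ) (q : ℝ × ℝ → ℝ) (Ω : Set (ℝ × ℝ)) (ε : ℝ) : ℝ :=
  sInf {c | ∃ γ : ℝ → ℝ × ℝ → ℝ,
    (∀ t ∈ Icc (0:ℝ) 1, MemH k Ω (γ t)) ∧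
    (∀ t ∈ Icc (0:ℝ) 1, ∀ δ > 0, ∃ η > 0, ∀ s ∈ Icc (0:ℝ) 1, |s - t| < η →
      (∫ x in Ω, KHform k x (grad (fun y => γ s y - γ t y) x)
        (grad (fun y => γ s y - γ t y) x)) < δ) ∧
    γ 0 = (fun _ => 0) ∧ Ieps k p ε q Ω (γ 1) < 0 ∧
    c = sSup ((fun t => Ieps k p ε q Ω (γ t)) '' Icc (0:ℝ) 1)}

/-- The Nehari manifold `N_ε`. -/
def Nehari (k p ε : ℝ) (q : ℝ × ℝ → ℝ) (Ω : Set (ℝ × ℝ)) : Set (ℝ × ℝ → ℝ) :=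
  {u | MemH k Ω u ∧ ¬ Set.EqOn u 0 Ω ∧
    (∫ x in Ω, KHform k x (grad u x) (grad u x))
      = (1 / ε ^ 2) * ∫ x in Ω, pPart (u x - q x * Real.log (1 / ε)) ^ p * u x}

/-- `u` is a (classical) solution of `L_H u = ε⁻²(u - q ln(1/ε))₊ᵖ` in `Ω`, `u = 0` on `∂Ω`. -/
def IsSolution (k p ε : ℝ) (q : ℝ × ℝ → ℝ) (Ω : Set (ℝ × ℝ)) (u : ℝ × ℝ → ℝ) : Prop :=
  ContinuousOn u (closure Ω) ∧ ContDiffOn ℝ 2 u Ω ∧ (∀ x ∈ frontier Ω, u x = 0) ∧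
    ∀ x ∈ Ω, LH k u x = (1 / ε ^ 2) * pPart (u x - q x * Real.log (1 / ε)) ^ p

/-- `u` is a mountain pass solution: a solution at the mountain pass level `c_ε`. -/
def IsMPSolution (k p ε : ℝ) (q : ℝ × ℝ → ℝ) (Ω : Set (ℝ × ℝ)) (u : ℝ × ℝ → ℝ) : Prop :=
  IsSolution k p ε q Ω u ∧ MemH k Ω u ∧ Ieps k p ε q Ω u = ceps k p q Ω ε

/-- The vortex core `A_ε = {x ∈ Ω : u(x) > q(x) ln(1/ε)}`. -/
def vcore (q : ℝ × ℝ → ℝ) (Ω : Set (ℝ × ℝ)) (ε : ℝ) (u : ℝ × ℝ → ℝ) : Set (ℝ × ℝ) :=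
  {x ∈ Ω | q x * Real.log (1 / ε) < u x}

section

lemma hasDerivAt_ppow {a : ℝ} (ha : 1 < a) (s : ℝ) :
    HasDerivAt (fun s : ℝ => max s 0 ^ a) (a * max s 0 ^ (a - 1)) s := by
  rcases lt_trichotomy s 0 with h | h | h
  · have : (fun s : ℝ => max s 0 ^ a) =ᶠ[𝓝 s] fun _ => 0 := by
      filter_upwards [gt_mem_nhds h] with y hy
      rw [max_eq_right hy.le, Real.zero_rpow (by linarith)]
    rw [max_eq_right h.le, Real.zero_rpow (by linarith), mul_zero]
    exact (hasDerivAt_const s (0:ℝ)).congr_of_eventuallyEq this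
  · subst h
    simp only [max_self]
    rw [Real.zero_rpow (by linarith), mul_zero]
    rw [hasDerivAt_iff_isLittleO]
    simp only [max_self, smul_zero, sub_zero]
    rw [Real.zero_rpow (by linarith)]
    simp only [sub_zero]
    rw [Asymptotics.isLittleO_iff]
    intro c hc
    have h1 : Tendsto (fun x : ℝ => |x| ^ (a - 1)) (𝓝 0) (𝓝 0) := by
      have : ContinuousAt (fun x : ℝ => |x| ^ (a - 1)) 0 :=
        continuousAt_id.abs.rpow_const (Or.inr (by linarith))
      have h2 := this.tendsto
      simp only [abs_zero] at h2
      rwa [Real.zero_rpow (by linarith)] at h2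
    filter_upwards [h1.eventually (gt_mem_nhds hc)] with x hx
    rw [Real.norm_eq_abs, Real.norm_eq_abs]
    rw [abs_of_nonneg (by positivity)]
    have h3 : max x 0 ^ a ≤ |x| ^ a :=
      Real.rpow_le_rpow (le_max_right _ _) (max_le (le_abs_self x) (abs_nonneg x)) (by linarith)
    rcases eq_or_ne x 0 with h0 | h0
    · subst h0
      simp [Real.zero_rpow (show a ≠ 0 by linarith)]
    · have h4 : |x| ^ a = |x| ^ (a - 1) * |x| := by
        rw [Real.rpow_sub_one (abs_pos.2 h0).ne', div_mul_cancel₀ _ (abs_pos.2 h0).ne']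
      rw [h4] at h3
      exact h3.trans (mul_le_mul_of_nonneg_right hx.le (abs_nonneg x))
  · have : (fun s : ℝ => max s 0 ^ a) =ᶠ[𝓝 s] fun s => s ^ a := by
      filter_upwards [lt_mem_nhds h] with y hy
      rw [max_eq_left hy.le]
    rw [max_eq_left h.le]
    exact (Real.hasDerivAt_rpow_const (Or.inl h.ne')).congr_of_eventuallyEq this

lemma contDiff_ppow {a : ℝ} (ha : 1 < a) : ContDiff ℝ 1 (fun s : ℝ => max s 0 ^ a) := by
  rw [contDiff_one_iff_deriv]
  refine ⟨fun s => (hasDerivAt_ppow ha s).differentiableAt, ?_⟩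
  have : deriv (fun s : ℝ => max s 0 ^ a) = fun s => a * max s 0 ^ (a - 1) :=
    funext fun s => (hasDerivAt_ppow ha s).deriv
  rw [this]
  exact continuous_const.mul ((continuous_id.max continuous_const).rpow_const
    fun _ => Or.inr (by linarith))

/-- smooth truncation -/
def phi (δ t : ℝ) : ℝ := Real.sqrt (max (t - δ) 0 ^ (2:ℝ) + δ ^ 2) - δ

def dphi (δ t : ℝ) : ℝ := max (t - δ) 0 / Real.sqrt (max (t - δ) 0 ^ (2:ℝ) + δ ^ 2)

lemma phi_aux {δ : ℝ} (hδ : 0 < δ) (t : ℝ) : 0 < max (t - δ) 0 ^ (2:ℝ) + δ ^ 2 := by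
  positivity

lemma phi_hasDerivAt {δ : ℝ} (hδ : 0 < δ) (t : ℝ) : HasDerivAt (phi δ) (dphi δ t) t := by
  have h1 := (hasDerivAt_ppow (a := 2) (by norm_num) (t - δ)).comp t ((hasDerivAt_id t).sub_const δ)
  have h2 := ((h1.add_const (δ ^ 2)).sqrt (phi_aux hδ t).ne').sub_const δ
  unfold phi
  refine h2.congr_deriv ?_
  unfold dphi
  norm_num
  ring

lemma phi_contDiff {δ : ℝ} (hδ : 0 < δ) : ContDiff ℝ 1 (phi δ) := by
  rw [contDiff_one_iff_deriv]
  refine ⟨fun s => (phi_hasDerivAt hδ s).differentiableAt, ?_⟩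
  have : deriv (phi δ) = dphi δ := funext fun s => (phi_hasDerivAt hδ s).deriv
  rw [this]
  unfold dphi
  refine Continuous.div (by fun_prop) (Continuous.sqrt (Continuous.add ?_ continuous_const)) ?_
  · exact Continuous.rpow_const (by fun_prop) fun _ => Or.inr (by norm_num)
  · intro t
    exact (Real.sqrt_pos.2 (phi_aux hδ t)).ne'

lemma phi_eq_zero {δ t : ℝ} (hδ : 0 < δ) (h : t ≤ δ) : phi δ t = 0 := by
  unfold phi
  rw [max_eq_right (by linarith)]
  norm_num
  rw [Real.sqrt_sq hδ.le]; ring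

lemma phi_nonneg {δ : ℝ} (hδ : 0 < δ) (t : ℝ) : 0 ≤ phi δ t := by
  unfold phi
  have : δ ≤ Real.sqrt (max (t - δ) 0 ^ (2:ℝ) + δ ^ 2) := by
    apply Real.le_sqrt_of_sq_le
    have : 0 ≤ max (t - δ) 0 ^ (2:ℝ) := by positivity
    linarith
  linarith

lemma phi_le {δ : ℝ} (hδ : 0 < δ) (t : ℝ) : phi δ t ≤ max t 0 := by
  unfold phi
  have h0 : 0 ≤ max (t - δ) 0 := le_max_right _ _
  have : Real.sqrt (max (t - δ) 0 ^ (2:ℝ) + δ ^ 2) ≤ max (t - δ) 0 + δ := by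
    apply Real.sqrt_le_iff.2
    refine ⟨by linarith, ?_⟩
    rw [Real.rpow_two]; nlinarith
  have h2 : max (t - δ) 0 ≤ max t 0 := max_le_max (by linarith) le_rfl
  linarith

lemma le_phi {δ : ℝ} (hδ : 0 < δ) (t : ℝ) : max t 0 - 2 * δ ≤ phi δ t := by
  unfold phi
  have h0 : 0 ≤ max (t - δ) 0 := le_max_right _ _
  have : max (t - δ) 0 ≤ Real.sqrt (max (t - δ) 0 ^ (2:ℝ) + δ ^ 2) := by
    apply Real.le_sqrt_of_sq_le
    rw [Real.rpow_two]; nlinarith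
  have h2 : max t 0 ≤ max (t - δ) 0 + δ := max_le (by linarith [le_max_left (t - δ) 0]) (by linarith)
  linarith

lemma dphi_nonneg {δ : ℝ} (t : ℝ) : 0 ≤ dphi δ t := by
  unfold dphi; positivity

lemma dphi_le {δ : ℝ} (hδ : 0 < δ) (t : ℝ) : dphi δ t ≤ 1 := by
  unfold dphi
  rw [div_le_one (Real.sqrt_pos.2 (phi_aux hδ t))]
  apply Real.le_sqrt_of_sq_le
  rw [Real.rpow_two]; nlinarith

lemma dphi_pos {δ t : ℝ} (hδ : 0 < δ) (h : δ < t) : 0 < dphi δ t := by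
  unfold dphi
  exact div_pos (lt_max_of_lt_left (by linarith)) (Real.sqrt_pos.2 (phi_aux hδ t))

/-! The quadratic form -/

lemma KHform_self (k : ℝ) (x a : ℝ × ℝ) : KHform k x a a =
    (k ^ 2 * (a.1 ^ 2 + a.2 ^ 2) + (x.2 * a.1 - x.1 * a.2) ^ 2) / (k ^ 2 + x.1 ^ 2 + x.2 ^ 2) := by
  unfold KHform
  rw [div_eq_inv_mul]; ring

lemma den_pos {k : ℝ} (hk : 0 < k) (x : ℝ × ℝ) : 0 < k ^ 2 + x.1 ^ 2 + x.2 ^ 2 := by positivity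

lemma KHform_nonneg (k : ℝ) (x a : ℝ × ℝ) : 0 ≤ KHform k x a a := by
  rw [KHform_self]; positivity

lemma KHform_le {k : ℝ} (hk : 0 < k) (x a : ℝ × ℝ) : KHform k x a a ≤ a.1 ^ 2 + a.2 ^ 2 := by
  rw [KHform_self, div_le_iff₀ (den_pos hk x)]
  nlinarith [sq_nonneg (x.1 * a.1 + x.2 * a.2)]

lemma le_KHform {k : ℝ} (hk : 0 < k) (x a : ℝ × ℝ) :
    detKH k x * (a.1 ^ 2 + a.2 ^ 2) ≤ KHform k x a a := by
  rw [KHform_self, detKH, div_mul_eq_mul_div]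
  gcongr
  · nlinarith [sq_nonneg (x.2 * a.1 - x.1 * a.2)]

lemma KHform_comm (k : ℝ) (x a b : ℝ × ℝ) : KHform k x a b = KHform k x b a := by
  unfold KHform; ring

lemma KHform_lin (k : ℝ) (x a b : ℝ × ℝ) (s t : ℝ) :
    KHform k x (s • a + t • b) (s • a + t • b) =
      s ^ 2 * KHform k x a a + 2 * s * t * KHform k x a b + t ^ 2 * KHform k x b b := by
  unfold KHform; simp; ring

lemma KHform_abs_le (k : ℝ) (x a b : ℝ × ℝ) :
    |KHform k x a b| ≤ KHform k x a a + KHform k x b b := by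
  have h1 := KHform_nonneg k x ((1:ℝ) • a + (1:ℝ) • b)
  have h2 := KHform_nonneg k x ((1:ℝ) • a + (-1:ℝ) • b)
  rw [KHform_lin] at h1 h2
  have h3 := KHform_nonneg k x a
  have h4 := KHform_nonneg k x b
  rw [abs_le]; constructor <;> linarith

lemma grad_lin {U W : ℝ × ℝ → ℝ} {x : ℝ × ℝ} (hU : DifferentiableAt ℝ U x)
    (hW : DifferentiableAt ℝ W x) (s t : ℝ) :
    grad (fun y => s * U y + t * W y) x = s • grad U x + t • grad W x := by
  unfold grad
  have : fderiv ℝ (fun y => s * U y + t * W y) x = s • fderiv ℝ U x + t • fderiv ℝ W x :=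
    ((hU.hasFDerivAt.const_mul s).add (hW.hasFDerivAt.const_mul t)).fderiv
  rw [this]; simp

lemma grad_comp {g : ℝ → ℝ} {g' : ℝ} {U : ℝ × ℝ → ℝ} {x : ℝ × ℝ} (hU : DifferentiableAt ℝ U x)
    (hg : HasDerivAt g g' (U x)) : grad (fun y => g (U y)) x = g' • grad U x := by
  unfold grad
  have : fderiv ℝ (fun y => g (U y)) x = g' • fderiv ℝ U x := by
    exact (hg.comp_hasFDerivAt x hU.hasFDerivAt).fderiv
  rw [this]; simp

lemma grad_continuousOn {U : ℝ × ℝ → ℝ} {Ω : Set (ℝ × ℝ)} (hΩ : IsOpen Ω)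
    (hU : ContDiffOn ℝ 1 U Ω) : ContinuousOn (grad U) Ω := by
  have := hU.continuousOn_fderiv_of_isOpen hΩ le_rfl
  unfold grad
  exact (this.clm_apply continuousOn_const).prodMk (this.clm_apply continuousOn_const)

lemma KHform_continuousOn {k : ℝ} (hk : 0 < k) {a b : ℝ × ℝ → ℝ × ℝ} {Ω : Set (ℝ × ℝ)}
    (ha : ContinuousOn a Ω) (hb : ContinuousOn b Ω) :
    ContinuousOn (fun x => KHform k x (a x) (b x)) Ω := by
  unfold KHform
  refine ContinuousOn.mul (ContinuousOn.inv₀ (by fun_prop) fun x _ => (den_pos hk x).ne') ?_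
  fun_prop

lemma diffAt_of {U : ℝ × ℝ → ℝ} {Ω : Set (ℝ × ℝ)} (hΩ : IsOpen Ω) {n : WithTop ℕ∞}
    (hn : n ≠ 0) (hU : ContDiffOn ℝ n U Ω) {x : ℝ × ℝ} (hx : x ∈ Ω) : DifferentiableAt ℝ U x :=
  (hU.differentiableOn hn).differentiableAt (hΩ.mem_nhds hx)

/-- energy -/
def En (k : ℝ) (Ω : Set (ℝ × ℝ)) (U W : ℝ × ℝ → ℝ) : ℝ :=
  ∫ x in Ω, KHform k x (grad U x) (grad W x)

lemma En_nonneg (k : ℝ) (Ω : Set (ℝ × ℝ)) (U : ℝ × ℝ → ℝ) : 0 ≤ En k Ω U U :=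
  integral_nonneg fun _ => KHform_nonneg _ _ _

section
variable {k : ℝ} (hk : 0 < k) {Ω : Set (ℝ × ℝ)} (hΩ : IsOpen Ω) {U W : ℝ × ℝ → ℝ}

lemma MemH.integrable_cross (hk : 0 < k) (hΩ : IsOpen Ω) (hU : MemH k Ω U) (hW : MemH k Ω W) :
    IntegrableOn (fun x => KHform k x (grad U x) (grad W x)) Ω := by
  refine (hU.2.2.2.add hW.2.2.2).mono' ?_ ?_
  · exact (KHform_continuousOn hk (grad_continuousOn hΩ hU.2.1)
      (grad_continuousOn hΩ hW.2.1)).aestronglyMeasurable hΩ.measurableSet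
  · exact Eventually.of_forall fun x => KHform_abs_le _ _ _ _

lemma MemH.lin (hk : 0 < k) (hΩ : IsOpen Ω) (hU : MemH k Ω U) (hW : MemH k Ω W) (s t : ℝ) :
    MemH k Ω (fun y => s * U y + t * W y) ∧
    En k Ω (fun y => s * U y + t * W y) (fun y => s * U y + t * W y) =
      s ^ 2 * En k Ω U U + 2 * s * t * En k Ω U W + t ^ 2 * En k Ω W W := by
  have e : EqOn (fun x => KHform k x (grad (fun y => s * U y + t * W y) x)
      (grad (fun y => s * U y + t * W y) x))
      (fun x => (s ^ 2 * KHform k x (grad U x) (grad U x)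
        + 2 * s * t * KHform k x (grad U x) (grad W x))
        + t ^ 2 * KHform k x (grad W x) (grad W x)) Ω := by
    intro x hx
    simp only
    rw [grad_lin (diffAt_of hΩ one_ne_zero hU.2.1 hx) (diffAt_of hΩ one_ne_zero hW.2.1 hx),
      KHform_lin]
  have i1 := hU.2.2.2.const_mul (s ^ 2)
  have i2 := (MemH.integrable_cross hk hΩ hU hW).const_mul (2 * s * t)
  have i3 := hW.2.2.2.const_mul (t ^ 2)
  have c1 := hU.1
  have c2 := hW.1
  have c3 := hU.2.1
  have c4 := hW.2.1
  refine ⟨⟨by fun_prop, by fun_prop, ?_, ?_⟩, ?_⟩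
  · intro x hx
    simp [hU.2.2.1 x hx, hW.2.2.1 x hx]
  · exact (integrableOn_congr_fun e hΩ.measurableSet).2 ((i1.add i2).add i3)
  · unfold En
    rw [setIntegral_congr_fun hΩ.measurableSet e]
    have i12 : Integrable (fun x => s ^ 2 * KHform k x (grad U x) (grad U x)
        + 2 * s * t * KHform k x (grad U x) (grad W x)) (volume.restrict Ω) := i1.add i2
    rw [integral_add i12 i3, integral_add i1 i2,
      integral_const_mul, integral_const_mul, integral_const_mul]

lemma MemH.zero : MemH k Ω (fun _ => 0) := by
  refine ⟨continuousOn_const, contDiffOn_const, fun _ _ => rfl, ?_⟩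
  have : (fun x => KHform k x (grad (fun _ => (0:ℝ)) x) (grad (fun _ => (0:ℝ)) x)) = fun _ => 0 := by
    funext x; simp [grad, KHform]
  rw [this]; exact integrableOn_zero

end
end

section

lemma Ieps_eq (k p ε : ℝ) (q : ℝ × ℝ → ℝ) (Ω : Set (ℝ × ℝ)) (u : ℝ × ℝ → ℝ) :
    Ieps k p ε q Ω u = (1 / 2) * En k Ω u u
    - (1 / ((p + 1) * ε ^ 2)) * ∫ x in Ω, pPart (u x - q x * Real.log (1 / ε)) ^ (p + 1) := rfl

lemma log_inv_pos {ε : ℝ} (h0 : 0 < ε) (h1 : ε < 1) : 0 < Real.log (1 / ε) :=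
  Real.log_pos (by rw [lt_div_iff₀ h0]; linarith)

lemma Ieps_zero {k p ε : ℝ} {q : ℝ × ℝ → ℝ} {Ω : Set (ℝ × ℝ)} (hΩ : IsOpen Ω) (hp : 1 < p)
    (h0 : 0 < ε) (h1 : ε < 1) (hq : ∀ x ∈ Ω, 0 < q x) : Ieps k p ε q Ω (fun _ => 0) = 0 := by
  rw [Ieps_eq]
  have e1 : En k Ω (fun _ => 0) (fun _ => 0) = 0 := by
    unfold En
    have : (fun x => KHform k x (grad (fun _ => (0:ℝ)) x) (grad (fun _ => (0:ℝ)) x)) = fun _ => 0 := by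
      funext x; simp [grad, KHform]
    rw [this]; simp
  have e2 : ∫ x in Ω, pPart (0 - q x * Real.log (1 / ε)) ^ (p + 1) = 0 := by
    apply setIntegral_eq_zero_of_forall_eq_zero
    intro x hx
    have := mul_pos (hq x hx) (log_inv_pos h0 h1)
    unfold pPart
    rw [max_eq_right (by linarith), Real.zero_rpow (by linarith)]
  rw [e1, e2]; ring

def PathSet (k p : ℝ) (q : ℝ × ℝ → ℝ) (Ω : Set (ℝ × ℝ)) (ε : ℝ) : Set ℝ :=
  {c | ∃ γ : ℝ → ℝ × ℝ → ℝ,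
    (∀ t ∈ Icc (0:ℝ) 1, MemH k Ω (γ t)) ∧
    (∀ t ∈ Icc (0:ℝ) 1, ∀ δ > 0, ∃ η > 0, ∀ s ∈ Icc (0:ℝ) 1, |s - t| < η →
      (∫ x in Ω, KHform k x (grad (fun y => γ s y - γ t y) x)
        (grad (fun y => γ s y - γ t y) x)) < δ) ∧
    γ 0 = (fun _ => 0) ∧ Ieps k p ε q Ω (γ 1) < 0 ∧
    c = sSup ((fun t => Ieps k p ε q Ω (γ t)) '' Icc (0:ℝ) 1)}

lemma PathSet_bdd {k p ε : ℝ} {q : ℝ × ℝ → ℝ} {Ω : Set (ℝ × ℝ)} (hΩ : IsOpen Ω)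
    (hp : 1 < p) (h0 : 0 < ε) (h1 : ε < 1) (hq : ∀ x ∈ Ω, 0 < q x) :
    BddBelow (PathSet k p q Ω ε) := by
  refine ⟨0, ?_⟩
  rintro c ⟨γ, -, -, g0, -, rfl⟩
  by_cases hb : BddAbove ((fun t => Ieps k p ε q Ω (γ t)) '' Icc (0:ℝ) 1)
  · have := le_csSup hb (mem_image_of_mem _ (left_mem_Icc.2 zero_le_one))
    simp only [g0] at this
    rwa [Ieps_zero hΩ hp h0 h1 hq] at this
  · rw [Real.sSup_of_not_bddAbove hb]

lemma exists_path {k p ε : ℝ} {q : ℝ × ℝ → ℝ} {Ω : Set (ℝ × ℝ)} (hk : 0 < k) (hΩ : IsOpen Ω)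
    {W1 W2 : ℝ × ℝ → ℝ}
    (hW1 : MemH k Ω W1) (hW2 : MemH k Ω W2) {S B : ℝ} (hS : 0 ≤ S)
    (hB1 : ∀ a ∈ Icc (0:ℝ) 1, Ieps k p ε q Ω (fun y => a * W1 y + 0 * W2 y) ≤ B)
    (hB2 : ∀ b ∈ Icc (0:ℝ) S, Ieps k p ε q Ω (fun y => 1 * W1 y + b * W2 y) ≤ B)
    (hB3 : Ieps k p ε q Ω (fun y => 1 * W1 y + S * W2 y) < 0) : ∃ c ∈ PathSet k p q Ω ε, c ≤ B := by
  have key : ∀ t ∈ Icc (0:ℝ) 1, Ieps k p ε q Ω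
      (fun y => min (2 * t) 1 * W1 y + S * max (2 * t - 1) 0 * W2 y) ≤ B := by
    intro t ht
    rcases le_total (2 * t) 1 with h | h
    · rw [min_eq_left h, max_eq_right (by linarith), mul_zero]
      exact hB1 _ ⟨by linarith [ht.1], h⟩
    · rw [min_eq_right h, max_eq_left (by linarith)]
      exact hB2 _ ⟨mul_nonneg hS (by linarith), by nlinarith [ht.2]⟩
  refine ⟨_, ⟨fun t y => min (2 * t) 1 * W1 y + S * max (2 * t - 1) 0 * W2 y,
    ?_, ?_, ?_, ?_, rfl⟩, (csSup_le ⟨_, mem_image_of_mem _ (left_mem_Icc.2 zero_le_one)⟩ ?_)⟩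
  · intro t _
    exact (MemH.lin hk hΩ hW1 hW2 _ _).1
  · intro t _ δ hδ
    set F : ℝ → ℝ := fun s => (min (2 * s) 1 - min (2 * t) 1) ^ 2 * En k Ω W1 W1
      + 2 * (min (2 * s) 1 - min (2 * t) 1) * (S * max (2 * s - 1) 0 - S * max (2 * t - 1) 0) * En k Ω W1 W2
      + (S * max (2 * s - 1) 0 - S * max (2 * t - 1) 0) ^ 2 * En k Ω W2 W2 with hF
    have hFc : Continuous F := by rw [hF]; fun_prop
    have hFt : F t = 0 := by simp [hF]
    have := hFc.continuousAt.eventually (gt_mem_nhds (show F t < δ by rw [hFt]; exact hδ))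
    rw [Metric.eventually_nhds_iff] at this
    obtain ⟨η, hη, H⟩ := this
    refine ⟨η, hη, fun s _ hs => ?_⟩
    have e := (MemH.lin hk hΩ hW1 hW2 (min (2 * s) 1 - min (2 * t) 1)
      (S * max (2 * s - 1) 0 - S * max (2 * t - 1) 0)).2
    have e2 : (fun y => min (2 * s) 1 * W1 y + S * max (2 * s - 1) 0 * W2 y -
        (min (2 * t) 1 * W1 y + S * max (2 * t - 1) 0 * W2 y)) =
        (fun y => (min (2 * s) 1 - min (2 * t) 1) * W1 y +
      (S * max (2 * s - 1) 0 - S * max (2 * t - 1) 0) * W2 y) := by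
      funext y; ring
    rw [e2]
    exact lt_of_eq_of_lt e (H (by rw [Real.dist_eq]; exact hs))
  · funext y; simp
  · have : (fun y => min (2 * (1:ℝ)) 1 * W1 y + S * max (2 * (1:ℝ) - 1) 0 * W2 y) =
      fun y => 1 * W1 y + S * W2 y := by
      funext y; norm_num
    exact lt_of_eq_of_lt (congrArg _ this) hB3
  · rintro _ ⟨t, ht, rfl⟩
    exact key t ht

/-- test functions -/
def TF (Ω : Set (ℝ × ℝ)) (ψ : ℝ × ℝ → ℝ) : Prop :=
  ContDiff ℝ 1 ψ ∧ HasCompactSupport ψ ∧ tsupport ψ ⊆ Ω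

lemma TF.mk' {Ω C : Set (ℝ × ℝ)} (hΩ : IsOpen Ω) {h : ℝ × ℝ → ℝ} (hh : ContDiffOn ℝ 1 h Ω)
    (hC : IsCompact C) (hCΩ : C ⊆ Ω) (h0 : ∀ x ∈ Ω, x ∉ C → h x = 0) : TF Ω (Ω.indicator h) := by
  have hs : Function.support (Ω.indicator h) ⊆ C := by
    intro x hx
    by_contra hxC
    apply hx
    by_cases hxΩ : x ∈ Ω
    · rw [indicator_of_mem hxΩ, h0 x hxΩ hxC]
    · rw [indicator_of_notMem hxΩ]
  have hts : tsupport (Ω.indicator h) ⊆ C := closure_minimal hs hC.isClosed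
  refine ⟨?_, HasCompactSupport.of_support_subset_isCompact hC hs, hts.trans hCΩ⟩
  rw [contDiff_iff_contDiffAt]
  intro x
  by_cases hx : x ∈ Ω
  · refine (hh.contDiffAt (hΩ.mem_nhds hx)).congr_of_eventuallyEq ?_
    filter_upwards [hΩ.mem_nhds hx] with y hy
    rw [indicator_of_mem hy]
  · have : Ω.indicator h =ᶠ[𝓝 x] fun _ => 0 := by
      have hxC : x ∉ C := fun hc => hx (hCΩ hc)
      filter_upwards [hC.isClosed.isOpen_compl.mem_nhds hxC] with y hy
      by_contra hne
      exact hy (hs hne)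
    exact contDiffAt_const.congr_of_eventuallyEq this

lemma TF.memH {Ω : Set (ℝ × ℝ)} {k : ℝ} (hk : 0 < k) (hΩ : IsOpen Ω) {ψ : ℝ × ℝ → ℝ}
    (h : TF Ω ψ) : MemH k Ω ψ := by
  refine ⟨h.1.continuous.continuousOn, h.1.contDiffOn, ?_, ?_⟩
  · intro x hx
    apply image_eq_zero_of_notMem_tsupport
    intro hx'
    have := h.2.2 hx'
    rw [hΩ.frontier_eq] at hx
    exact hx.2 this
  · have hg : Continuous (grad ψ) := by
      rw [← continuousOn_univ]
      exact grad_continuousOn isOpen_univ h.1.contDiffOn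
    have hc : Continuous (fun x => KHform k x (grad ψ x) (grad ψ x)) := by
      rw [← continuousOn_univ]
      exact KHform_continuousOn hk hg.continuousOn hg.continuousOn
    refine (hc.integrable_of_hasCompactSupport ?_).integrableOn
    have h2 : HasCompactSupport (fderiv ℝ ψ) := h.2.1.fderiv ℝ
    refine h2.mono ?_
    intro x hx hx0
    apply hx
    simp [grad, KHform, hx0]

lemma fderiv_zero_of_TF {Ω : Set (ℝ × ℝ)} {ψ : ℝ × ℝ → ℝ} (h : TF Ω ψ) {x : ℝ × ℝ} (hx : x ∉ Ω) :
    fderiv ℝ ψ x = 0 := by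
  have : x ∉ tsupport (fderiv ℝ ψ) := fun hh => hx (h.2.2 (tsupport_fderiv_subset ℝ hh))
  exact image_eq_zero_of_notMem_tsupport this

/-- weak formulation -/
lemma weak_form {Ω : Set (ℝ × ℝ)} {k : ℝ} (hk : 0 < k) (hΩ : IsOpen Ω) {U ψ : ℝ × ℝ → ℝ}
    (hU : ContDiffOn ℝ 2 U Ω) (h : TF Ω ψ) :
    En k Ω U ψ = ∫ x in Ω, LH k U x * ψ x := by
  -- the vector field
  set F : ℝ × ℝ → ℝ × ℝ := fun y => KHvec k y (grad U y) with hF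
  have hgU : ContDiffOn ℝ 1 (grad U) Ω := by
    have h1 : ContDiffOn ℝ 1 (fderiv ℝ U) Ω := hU.fderiv_of_isOpen hΩ (by norm_num)
    unfold grad
    exact (h1.clm_apply contDiffOn_const).prodMk (h1.clm_apply contDiffOn_const)
  have hd : ContDiffOn ℝ 1 (fun y : ℝ × ℝ => (k ^ 2 + y.1 ^ 2 + y.2 ^ 2)⁻¹) Ω :=
    ContDiffOn.inv (by fun_prop) fun x _ => (den_pos hk x).ne'
  have g1 : ContDiffOn ℝ 1 (fun y => (grad U y).1) Ω := hgU.fst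
  have g2 : ContDiffOn ℝ 1 (fun y => (grad U y).2) Ω := hgU.snd
  have hF1 : ContDiffOn ℝ 1 (fun y => (F y).1) Ω := by
    simp only [hF, KHvec]
    refine hd.mul (ContDiffOn.sub (ContDiffOn.mul (by fun_prop) g1) (ContDiffOn.mul (by fun_prop) g2))
  have hF2 : ContDiffOn ℝ 1 (fun y => (F y).2) Ω := by
    simp only [hF, KHvec]
    refine hd.mul (ContDiffOn.add (ContDiffOn.mul (by fun_prop) g1) (ContDiffOn.mul (by fun_prop) g2))
  have cF1 := hF1.continuousOn_fderiv_of_isOpen hΩ le_rfl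
  have cF2 := hF2.continuousOn_fderiv_of_isOpen hΩ le_rfl
  have hψc : IsCompact (tsupport ψ) := h.2.1
  -- integrability helper
  have hIntg : ∀ G : ℝ × ℝ → ℝ, ContinuousOn G Ω → (∀ x, x ∉ tsupport ψ → G x = 0) → Integrable G := by
    intro G hG h0
    have : IntegrableOn G (tsupport ψ) := (hG.mono h.2.2).integrableOn_compact hψc
    rwa [integrableOn_iff_integrable_of_support_subset] at this
    intro x hx; by_contra hh; exact hx (h0 x hh)
  have cψ := h.1.continuous.continuousOn (s := Ω)
  have cdψ : ContinuousOn (fderiv ℝ ψ) Ω := (h.1.continuous_fderiv one_ne_zero).continuousOn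
  have z1 : ∀ x, x ∉ tsupport ψ → ψ x = 0 := fun x hx => image_eq_zero_of_notMem_tsupport hx
  have z2 : ∀ x, x ∉ tsupport ψ → fderiv ℝ ψ x = 0 := fun x hx =>
    image_eq_zero_of_notMem_tsupport fun hh => hx (tsupport_fderiv_subset ℝ hh)
  have dψ : Differentiable ℝ ψ := h.1.differentiable one_ne_zero
  have ibp : ∀ (g : ℝ × ℝ → ℝ) (v : ℝ × ℝ), ContDiffOn ℝ 1 g Ω →
      Integrable (fun x => fderiv ℝ ψ x v * g x) ∧ Integrable (fun x => ψ x * fderiv ℝ g x v) ∧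
      ∫ x, ψ x * fderiv ℝ g x v = - ∫ x, fderiv ℝ ψ x v * g x := by
    intro g v hg
    have cg := hg.continuousOn
    have cdg := hg.continuousOn_fderiv_of_isOpen hΩ le_rfl
    have i1 : Integrable (fun x => fderiv ℝ ψ x v * g x) :=
      hIntg _ ((cdψ.clm_apply continuousOn_const).mul cg) fun x hx => by simp [z2 x hx]
    have i2 : Integrable (fun x => ψ x * fderiv ℝ g x v) :=
      hIntg _ (cψ.mul (cdg.clm_apply continuousOn_const)) fun x hx => by simp [z1 x hx]
    have i3 : Integrable (fun x => ψ x * g x) := hIntg _ (cψ.mul cg) fun x hx => by simp [z1 x hx]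
    exact ⟨i1, i2, integral_mul_fderiv_eq_neg_fderiv_mul_of_integrable i1 i2 i3
      (fun x _ => dψ x) fun x hx => diffAt_of hΩ one_ne_zero hg (h.2.2 hx)⟩
  obtain ⟨a1, b1, c1⟩ := ibp _ (1, 0) hF1
  obtain ⟨a2, b2, c2⟩ := ibp _ (0, 1) hF2
  have eL : En k Ω U ψ = ∫ x, (fderiv ℝ ψ x (1, 0) * (F x).1 + fderiv ℝ ψ x (0, 1) * (F x).2) := by
    unfold En
    refine Eq.trans ?_ (setIntegral_eq_integral_of_forall_compl_eq_zero (s := Ω) ?_)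
    · congr 1; funext x
      simp only [hF, KHform, KHvec, grad]; ring
    · intro x hx
      simp [fderiv_zero_of_TF h hx]
  have eR : ∫ x in Ω, LH k U x * ψ x =
      ∫ x, -(ψ x * fderiv ℝ (fun y => (F y).1) x (1, 0) + ψ x * fderiv ℝ (fun y => (F y).2) x (0, 1)) := by
    refine Eq.trans ?_ (setIntegral_eq_integral_of_forall_compl_eq_zero (s := Ω) ?_)
    · congr 1; funext x
      simp only [hF, LH, div2]; ring
    · intro x hx
      simp [z1 x fun hh => hx (h.2.2 hh)]
  rw [eL, eR, integral_neg, integral_add b1 b2, integral_add a1 a2, c1, c2]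
  ring
end

section

lemma cs_int {α : Type*} [MeasurableSpace α] {μ : Measure α} {f g : α → ℝ}
    (hf : Integrable (fun x => f x ^ 2) μ) (hg : Integrable (fun x => g x ^ 2) μ)
    (hfg : Integrable (fun x => f x * g x) μ) :
    (∫ x, f x * g x ∂μ) ^ 2 ≤ (∫ x, f x ^ 2 ∂μ) * ∫ x, g x ^ 2 ∂μ := by
  have h : ∀ t : ℝ, 0 ≤ (∫ x, f x ^ 2 ∂μ) * (t * t) + (2 * ∫ x, f x * g x ∂μ) * t + ∫ x, g x ^ 2 ∂μ := by
    intro t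
    have e : ∫ x, (t * f x + g x) ^ 2 ∂μ =
        (∫ x, f x ^ 2 ∂μ) * (t * t) + (2 * ∫ x, f x * g x ∂μ) * t + ∫ x, g x ^ 2 ∂μ := by
      have : (fun x => (t * f x + g x) ^ 2) =
          fun x => (t * t * f x ^ 2 + 2 * t * (f x * g x)) + g x ^ 2 := by
        funext x; ring
      have i12 : Integrable (fun x => t * t * f x ^ 2 + 2 * t * (f x * g x)) μ :=
        (hf.const_mul _).add (hfg.const_mul _)
      rw [this, integral_add i12 hg, integral_add (hf.const_mul _) (hfg.const_mul _),
        integral_const_mul, integral_const_mul]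
      ring
    rw [← e]
    exact integral_nonneg fun x => sq_nonneg _
  have := discrim_le_zero h
  unfold discrim at this
  nlinarith

lemma exists_lam {k : ℝ} (hk : 0 < k) {Ω : Set (ℝ × ℝ)} (hb : Bornology.IsBounded Ω) :
    ∃ lam > 0, ∀ x ∈ closure Ω, lam ≤ detKH k x := by
  obtain ⟨R, hR⟩ := hb.closure.subset_closedBall 0
  refine ⟨k ^ 2 / (k ^ 2 + R ^ 2 + R ^ 2), by positivity, fun x hx => ?_⟩
  have := hR hx
  rw [mem_closedBall_zero_iff, Prod.norm_def, max_le_iff] at this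
  unfold detKH
  have h1 : x.1 ^ 2 ≤ R ^ 2 := by
    rw [← sq_abs x.1]; exact pow_le_pow_left₀ (abs_nonneg _) this.1 2
  have h2 : x.2 ^ 2 ≤ R ^ 2 := by
    rw [← sq_abs x.2]; exact pow_le_pow_left₀ (abs_nonneg _) this.2 2
  gcongr

lemma norm_fderiv_le (f : ℝ × ℝ → ℝ) (x : ℝ × ℝ) :
    ‖fderiv ℝ f x‖ ≤ |(grad f x).1| + |(grad f x).2| := by
  apply ContinuousLinearMap.opNorm_le_bound _ (by positivity)
  intro y
  have : y = y.1 • ((1:ℝ), (0:ℝ)) + y.2 • ((0:ℝ), (1:ℝ)) := by ext <;> simp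
  have e : fderiv ℝ f x y = y.1 * (grad f x).1 + y.2 * (grad f x).2 := by
    conv_lhs => rw [this]
    rw [map_add, map_smul, map_smul]; rfl
  rw [e, Real.norm_eq_abs]
  have h1 : |y.1| ≤ ‖y‖ := norm_fst_le y
  have h2 : |y.2| ≤ ‖y‖ := norm_snd_le y
  calc |y.1 * (grad f x).1 + y.2 * (grad f x).2| ≤ |y.1| * |(grad f x).1| + |y.2| * |(grad f x).2| := by
        rw [← abs_mul, ← abs_mul]; exact abs_add_le _ _
    _ ≤ ‖y‖ * |(grad f x).1| + ‖y‖ * |(grad f x).2| := by gcongr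
    _ = _ := by ring

lemma gns : ∃ C > 0, ∀ f : ℝ × ℝ → ℝ, ContDiff ℝ 1 f → HasCompactSupport f →
    ∫ x, f x ^ 2 ≤ C * (∫ x, ‖fderiv ℝ f x‖) ^ 2 := by
  have hd : Module.finrank ℝ (ℝ × ℝ) = 2 := by simp
  have hp : Real.HolderConjugate ((Module.finrank ℝ (ℝ × ℝ) : ℕ) : ℝ) 2 := by
    rw [hd]; rw [Real.holderConjugate_iff]; norm_num
  refine ⟨(lintegralPowLePowLIntegralFDerivConst (volume : Measure (ℝ × ℝ)) 2 : ℝ) + 1, by positivity,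
    fun f hf hc => ?_⟩
  have H := lintegral_pow_le_pow_lintegral_fderiv (volume : Measure (ℝ × ℝ)) hf hc hp
  have i1 : Integrable (fun x => f x ^ 2) := by
    refine (hf.continuous.pow 2).integrable_of_hasCompactSupport ?_
    refine hc.mono ?_
    intro x hx h0; apply hx; show f x ^ 2 = 0; rw [show f x = 0 from h0]; norm_num
  have i2 : Integrable (fun x => ‖fderiv ℝ f x‖) :=
    ((hf.continuous_fderiv one_ne_zero).integrable_of_hasCompactSupport (hc.fderiv ℝ)).norm
  have e1 : ∫⁻ x, ‖f x‖ₑ ^ (2:ℝ) = ENNReal.ofReal (∫ x, f x ^ 2) := by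
    rw [ofReal_integral_eq_lintegral_ofReal i1 (Eventually.of_forall fun x => sq_nonneg _)]
    congr 1; funext x
    rw [ENNReal.rpow_two, Real.enorm_eq_ofReal_abs, ← ENNReal.ofReal_pow (abs_nonneg _), sq_abs]
  have e2 : ∫⁻ x, ‖fderiv ℝ f x‖ₑ = ENNReal.ofReal (∫ x, ‖fderiv ℝ f x‖) := by
    rw [ofReal_integral_eq_lintegral_ofReal i2 (Eventually.of_forall fun x => norm_nonneg _)]
    congr 1; funext x
    rw [ofReal_norm]
  have n2 : 0 ≤ ∫ x, ‖fderiv ℝ f x‖ := integral_nonneg fun _ => norm_nonneg _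
  rw [e1, e2, ENNReal.rpow_two, ← ENNReal.ofReal_pow n2, ← ENNReal.ofReal_coe_nnreal,
    ← ENNReal.ofReal_mul (by positivity), ENNReal.ofReal_le_ofReal_iff (by positivity)] at H
  refine H.trans ?_
  gcongr
  linarith

lemma cont_int {Ω : Set (ℝ × ℝ)} (hΩ : IsOpen Ω) (hb : Bornology.IsBounded Ω) {f : ℝ × ℝ → ℝ}
    (hf : ContinuousOn f (closure Ω)) : IntegrableOn f Ω :=
  (hf.integrableOn_compact hb.isCompact_closure).mono_set subset_closure

lemma sobolev {k p : ℝ} (hk : 0 < k) (hp : 1 < p) {Ω : Set (ℝ × ℝ)} (hΩ : IsOpen Ω)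
    (hb : Bornology.IsBounded Ω) : ∃ C > 0, ∀ (w : ℝ × ℝ → ℝ) (D : Set (ℝ × ℝ)),
      ContinuousOn w (closure Ω) → ContDiffOn ℝ 1 w Ω → IsCompact D → D ⊆ Ω →
      (∀ x ∈ Ω, x ∉ D → w x ≤ 0) →
      IntegrableOn (fun x => KHform k x (grad w x) (grad w x)) Ω →
      ∫ x in Ω, pPart (w x) ^ (p + 1) ≤
        C * En k Ω w w * ∫ x in Ω, pPart (w x) ^ (p - 1) := by
  obtain ⟨lam, hlam, hl⟩ := exists_lam hk hb
  obtain ⟨C, hC, gn⟩ := gns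
  refine ⟨C * ((p + 1) / 2 * Real.sqrt (2 / lam)) ^ 2, by positivity, ?_⟩
  intro w D hwc hw hD hDΩ hw0 hwi
  set a := (p + 1) / 2 with ha
  have ha1 : 1 < a := by rw [ha]; linarith
  have hft : TF Ω (Ω.indicator fun x => max (w x) 0 ^ a) := by
    refine TF.mk' hΩ ((contDiff_ppow ha1).comp_contDiffOn hw) hD hDΩ ?_
    intro x hx hxD
    simp only [max_eq_right (hw0 x hx hxD)]
    exact Real.zero_rpow (by linarith)
  set f := Ω.indicator fun x => max (w x) 0 ^ a with hf
  have h1 := gn f hft.1 hft.2.1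
  have e1 : ∫ x, f x ^ 2 = ∫ x in Ω, pPart (w x) ^ (p + 1) := by
    rw [← setIntegral_eq_integral_of_forall_compl_eq_zero (s := Ω)]
    · apply setIntegral_congr_fun hΩ.measurableSet
      intro x hx
      simp only [hf, indicator_of_mem hx, pPart]
      rw [← Real.rpow_two, ← Real.rpow_mul (le_max_right _ _)]
      congr 1; rw [ha]; ring
    · intro x hx; simp [hf, hx]
  have e2 : ∫ x, ‖fderiv ℝ f x‖ = ∫ x in Ω, ‖fderiv ℝ f x‖ := by
    rw [← setIntegral_eq_integral_of_forall_compl_eq_zero (s := Ω)]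
    intro x hx; rw [fderiv_zero_of_TF hft hx, norm_zero]
  set g1 : ℝ × ℝ → ℝ := fun x => pPart (w x) ^ ((p - 1) / 2) with hg1
  set g2 : ℝ × ℝ → ℝ := fun x => Real.sqrt (KHform k x (grad w x) (grad w x)) with hg2
  have g1sq : ∀ x, g1 x ^ 2 = pPart (w x) ^ (p - 1) := by
    intro x
    simp only [hg1, pPart]
    rw [← Real.rpow_two, ← Real.rpow_mul (le_max_right _ _)]
    congr 1; ring
  have g2sq : ∀ x, g2 x ^ 2 = KHform k x (grad w x) (grad w x) := fun x =>
    Real.sq_sqrt (KHform_nonneg _ _ _)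
  have cg1 : ContinuousOn g1 (closure Ω) := by
    have : ContinuousOn (fun x => pPart (w x)) (closure Ω) := hwc.sup continuousOn_const
    exact this.rpow_const fun _ _ => Or.inr (by linarith)
  have cg2 : ContinuousOn g2 Ω :=
    (KHform_continuousOn hk (grad_continuousOn hΩ hw) (grad_continuousOn hΩ hw)).sqrt
  have i1 : IntegrableOn (fun x => g1 x ^ 2) Ω := cont_int hΩ hb (cg1.pow 2)
  have i2 : IntegrableOn (fun x => g2 x ^ 2) Ω := by simpa only [g2sq] using hwi
  have i3 : IntegrableOn (fun x => g1 x * g2 x) Ω := by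
    refine (i1.add i2).mono' (((cg1.mono subset_closure).mul cg2).aestronglyMeasurable hΩ.measurableSet) ?_
    refine Eventually.of_forall fun x => ?_
    simp only [Pi.add_apply, Real.norm_eq_abs]
    rw [abs_le]; constructor <;> nlinarith [sq_nonneg (g1 x + g2 x), sq_nonneg (g1 x - g2 x), sq_nonneg (g1 x), sq_nonneg (g2 x)]
  have h2 := cs_int i1 i2 i3
  simp only [g1sq, g2sq] at h2
  have pw : ∀ x ∈ Ω, ‖fderiv ℝ f x‖ ≤ a * Real.sqrt (2 / lam) * (g1 x * g2 x) := by
    intro x hx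
    have eqf : f =ᶠ[𝓝 x] fun x => max (w x) 0 ^ a := by
      filter_upwards [hΩ.mem_nhds hx] with y hy
      simp [hf, indicator_of_mem hy]
    have gf : grad f x = (a * max (w x) 0 ^ (a - 1)) • grad w x := by
      rw [← grad_comp (diffAt_of hΩ one_ne_zero hw hx) (hasDerivAt_ppow ha1 (w x))]
      unfold grad; rw [eqf.fderiv_eq]
    refine (norm_fderiv_le f x).trans ?_
    rw [gf]
    have ea : a - 1 = (p - 1) / 2 := by rw [ha]; ring
    simp only [Prod.smul_fst, Prod.smul_snd, smul_eq_mul, abs_mul]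
    rw [abs_of_pos (show (0:ℝ) < a by linarith), abs_of_nonneg (show 0 ≤ max (w x) 0 ^ (a - 1) by positivity), ea]
    have hG : |(grad w x).1| + |(grad w x).2| ≤ Real.sqrt (2 / lam) * g2 x := by
      simp only [hg2]
      rw [← Real.sqrt_mul (by positivity)]
      apply Real.le_sqrt_of_sq_le
      have := le_KHform hk x (grad w x)
      have hl' := hl x (subset_closure hx)
      have s1 := sq_abs (grad w x).1
      have s2 := sq_abs (grad w x).2
      have h4 : lam * ((grad w x).1 ^ 2 + (grad w x).2 ^ 2) ≤ KHform k x (grad w x) (grad w x) :=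
        le_trans (by gcongr) this
      rw [div_mul_eq_mul_div, le_div_iff₀ hlam]
      nlinarith [sq_nonneg (|(grad w x).1| - |(grad w x).2|)]
    have hn : 0 ≤ a * g1 x := by
      have : 0 ≤ g1 x := by simp only [hg1, pPart]; positivity
      have : 0 < a := by linarith
      positivity
    calc _ = a * g1 x * (|(grad w x).1| + |(grad w x).2|) := by simp only [hg1, pPart]; ring
      _ ≤ a * g1 x * (Real.sqrt (2 / lam) * g2 x) := by gcongr
      _ = _ := by ring
  have h3 : ∫ x in Ω, ‖fderiv ℝ f x‖ ≤ a * Real.sqrt (2 / lam) * ∫ x in Ω, g1 x * g2 x := by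
    rw [← integral_const_mul]
    refine setIntegral_mono_on ?_ (i3.const_mul _) hΩ.measurableSet pw
    exact ((hft.1.continuous_fderiv one_ne_zero).integrable_of_hasCompactSupport
      (hft.2.1.fderiv ℝ)).norm.integrableOn
  rw [e1, e2] at h1
  have n0 : 0 ≤ ∫ x in Ω, ‖fderiv ℝ f x‖ := integral_nonneg fun _ => norm_nonneg _
  calc _ ≤ C * (∫ x in Ω, ‖fderiv ℝ f x‖) ^ 2 := h1
    _ ≤ C * (a * Real.sqrt (2 / lam) * ∫ x in Ω, g1 x * g2 x) ^ 2 := by gcongr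
    _ = C * (a * Real.sqrt (2 / lam)) ^ 2 * (∫ x in Ω, g1 x * g2 x) ^ 2 := by ring
    _ ≤ C * (a * Real.sqrt (2 / lam)) ^ 2 * ((∫ x in Ω, pPart (w x) ^ (p - 1)) * En k Ω w w) := by
      gcongr; exact h2
    _ = _ := by ring
end

section

lemma En_cs {k : ℝ} (hk : 0 < k) {Ω : Set (ℝ × ℝ)} (hΩ : IsOpen Ω) {U W : ℝ × ℝ → ℝ}
    (hU : MemH k Ω U) (hW : MemH k Ω W) {θ : ℝ} (hθ : 0 < θ) :
    2 * |En k Ω U W| ≤ θ * En k Ω U U + En k Ω W W / θ := by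
  have h1 := (MemH.lin hk hΩ hU hW 1 (1 / θ)).2
  have h2 := (MemH.lin hk hΩ hU hW 1 (-(1 / θ))).2
  have n1 := En_nonneg k Ω (fun y => 1 * U y + (1 / θ) * W y)
  have n2 := En_nonneg k Ω (fun y => 1 * U y + (-(1 / θ)) * W y)
  rw [h1] at n1
  rw [h2] at n2
  have m1 := mul_nonneg hθ.le n1
  have m2 := mul_nonneg hθ.le n2
  have e1 : θ * (1 ^ 2 * En k Ω U U + 2 * 1 * (1 / θ) * En k Ω U W + (1 / θ) ^ 2 * En k Ω W W) =
    θ * En k Ω U U + 2 * En k Ω U W + En k Ω W W / θ := by field_simp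
  have e2 : θ * (1 ^ 2 * En k Ω U U + 2 * 1 * (-(1 / θ)) * En k Ω U W + (-(1 / θ)) ^ 2 * En k Ω W W) =
    θ * En k Ω U U - 2 * En k Ω U W + En k Ω W W / θ := by field_simp; ring
  rw [e1] at m1
  rw [e2] at m2
  rcases abs_cases (En k Ω U W) with h | h <;> rw [h.1] <;> linarith

lemma exists_qmin {Ω : Set (ℝ × ℝ)} (hb : Bornology.IsBounded Ω) {q : ℝ × ℝ → ℝ}
    (hqc : ContinuousOn q (closure Ω)) (hq : ∀ x ∈ closure Ω, 0 < q x) :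
    ∃ m > 0, ∀ x ∈ closure Ω, m ≤ q x := by
  rcases (closure Ω).eq_empty_or_nonempty with h | h
  · exact ⟨1, one_pos, by simp [h]⟩
  · obtain ⟨x, hx, H⟩ := hb.isCompact_closure.exists_isMinOn h hqc
    exact ⟨q x, hq x hx, fun y hy => H hy⟩

lemma superlevel_compact {Ω : Set (ℝ × ℝ)} (hΩ : IsOpen Ω) (hb : Bornology.IsBounded Ω)
    {h : ℝ × ℝ → ℝ} (hc : ContinuousOn h (closure Ω)) {c : ℝ} (hf : ∀ x ∈ frontier Ω, h x < c) :
    IsCompact {x ∈ closure Ω | c ≤ h x} ∧ {x ∈ closure Ω | c ≤ h x} ⊆ Ω := by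
  constructor
  · have : IsClosed (closure Ω ∩ h ⁻¹' Ici c) := hc.preimage_isClosed_of_isClosed isClosed_closure isClosed_Ici
    exact hb.isCompact_closure.of_isClosed_subset this inter_subset_left
  · rintro x ⟨hx, hx2⟩
    by_contra hxΩ
    have : x ∈ frontier Ω := by rw [hΩ.frontier_eq]; exact ⟨hx, hxΩ⟩
    exact absurd (hf x this) (not_lt.2 hx2)

lemma pPart_nonneg (t : ℝ) : 0 ≤ pPart t := le_max_right _ _

lemma pPart_cont {s : Set (ℝ × ℝ)} {f : ℝ × ℝ → ℝ} (hf : ContinuousOn f s) {a : ℝ} (ha : 0 ≤ a) :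
    ContinuousOn (fun x => pPart (f x) ^ a) s := by
  have : ContinuousOn (fun x => pPart (f x)) s := hf.sup continuousOn_const
  exact this.rpow_const fun _ _ => Or.inr ha

lemma young2 {p z s : ℝ} (hp : 1 < p) (hz : 0 ≤ z) (hs : 0 < s) :
    z ^ (p - 1) ≤ (s ^ 2)⁻¹ * z ^ (p + 1) + s ^ (p - 1) := by
  rcases le_total z s with h | h
  · have := Real.rpow_le_rpow hz h (show 0 ≤ p - 1 by linarith)
    have : 0 ≤ (s ^ 2)⁻¹ * z ^ (p + 1) := by positivity
    linarith
  · have hz' : 0 < z := by linarith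
    have e : z ^ (p + 1) = z ^ (p - 1) * z ^ 2 := by
      rw [← Real.rpow_natCast, ← Real.rpow_add hz']; congr 1; push_cast; ring
    have h1 : s ^ 2 ≤ z ^ 2 := by gcongr
    have h2 : z ^ (p - 1) ≤ (s ^ 2)⁻¹ * z ^ (p + 1) := by
      rw [e, inv_mul_eq_div, le_div_iff₀ (by positivity)]; gcongr
    have : 0 ≤ s ^ (p - 1) := by positivity
    linarith

lemma young1 {p z s : ℝ} (hp : 1 < p) (hz : 0 ≤ z) (hs : 0 < s) :
    z ^ (p - 1) ≤ s⁻¹ * z ^ p + s ^ (p - 1) := by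
  rcases le_total z s with h | h
  · have := Real.rpow_le_rpow hz h (show 0 ≤ p - 1 by linarith)
    have : 0 ≤ s⁻¹ * z ^ p := by positivity
    linarith
  · have hz' : 0 < z := by linarith
    have e : z ^ p = z ^ (p - 1) * z := by
      rw [Real.rpow_sub_one hz'.ne']; field_simp
    have h2 : z ^ (p - 1) ≤ s⁻¹ * z ^ p := by
      rw [e, inv_mul_eq_div, le_div_iff₀ (by positivity)]; gcongr
    have : 0 ≤ s ^ (p - 1) := by positivity
    linarith

lemma sobolev2 {k p : ℝ} (hk : 0 < k) (hp : 1 < p) {Ω : Set (ℝ × ℝ)} (hΩ : IsOpen Ω)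
    (hb : Bornology.IsBounded Ω) : ∃ B > 0, ∃ D > 0, ∀ (w h : ℝ × ℝ → ℝ) (m : ℝ),
      0 < m → (∀ x ∈ Ω, m ≤ h x) → ContinuousOn h (closure Ω) → MemH k Ω w →
      ∫ x in Ω, pPart (w x - h x) ^ (p + 1) ≤
        D * En k Ω w w * (B * En k Ω w w) ^ ((p - 1) / 2) := by
  obtain ⟨C, hC, H⟩ := sobolev hk hp hΩ hb
  refine ⟨2 * C, by positivity, 2 * C * (volume.real Ω + 1), by positivity, ?_⟩
  intro w h m hm hmh hh hw
  have hcw : ContinuousOn (fun x => w x - m) (closure Ω) := hw.1.sub continuousOn_const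
  have hgr : ∀ x ∈ Ω, grad (fun x => w x - m) x = grad w x := by
    intro x hx; unfold grad; rw [fderiv_sub_const]
  obtain ⟨D1, D2⟩ := superlevel_compact hΩ hb hw.1 (c := m)
    (fun x hx => by rw [hw.2.2.1 x hx]; exact hm)
  have eqs : EqOn (fun x => KHform k x (grad (fun x => w x - m) x) (grad (fun x => w x - m) x))
      (fun x => KHform k x (grad w x) (grad w x)) Ω := by
    intro x hx; simp only [hgr x hx]
  have H1 := H (fun x => w x - m) _ hcw (hw.2.1.sub contDiffOn_const) D1 D2
    (fun x hx hxD => by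
      by_contra hh2
      exact hxD ⟨subset_closure hx, by linarith⟩)
    ((integrableOn_congr_fun eqs hΩ.measurableSet).2 hw.2.2.2)
  have eE : En k Ω (fun x => w x - m) (fun x => w x - m) = En k Ω w w :=
    setIntegral_congr_fun hΩ.measurableSet eqs
  rw [eE] at H1
  set E := En k Ω w w with hE
  have hE0 : 0 ≤ E := En_nonneg _ _ _
  have ip1 : IntegrableOn (fun x => pPart (w x - m) ^ (p + 1)) Ω :=
    cont_int hΩ hb (pPart_cont hcw (by linarith))
  have im1 : IntegrableOn (fun x => pPart (w x - m) ^ (p - 1)) Ω :=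
    cont_int hΩ hb (pPart_cont hcw (by linarith))
  have hvol : volume Ω < ⊤ := hb.measure_lt_top
  have h0 : ∫ x in Ω, pPart (w x - h x) ^ (p + 1) ≤ ∫ x in Ω, pPart (w x - m) ^ (p + 1) := by
    refine setIntegral_mono_on (cont_int hΩ hb (pPart_cont (hw.1.sub hh) (by linarith))) ip1
      hΩ.measurableSet ?_
    intro x hx
    refine Real.rpow_le_rpow (pPart_nonneg _) (max_le_max ?_ le_rfl) (by linarith)
    linarith [hmh x hx]
  refine h0.trans ?_
  set X := ∫ x in Ω, pPart (w x - m) ^ (p + 1) with hX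
  rcases eq_or_lt_of_le hE0 with h00 | h00
  · rw [← h00] at H1 ⊢
    simpa using H1
  · set s := Real.sqrt (2 * C * E) with hs
    have hs0 : 0 < s := Real.sqrt_pos.2 (by positivity)
    have hs2 : s ^ 2 = 2 * C * E := Real.sq_sqrt (by positivity)
    have h2 : ∫ x in Ω, pPart (w x - m) ^ (p - 1) ≤ (s ^ 2)⁻¹ * X + s ^ (p - 1) * volume.real Ω := by
      have ic : IntegrableOn (fun _ : ℝ × ℝ => s ^ (p - 1)) Ω := integrableOn_const hvol.ne
      have : (s ^ 2)⁻¹ * X + s ^ (p - 1) * volume.real Ω =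
          ∫ x in Ω, ((s ^ 2)⁻¹ * pPart (w x - m) ^ (p + 1) + s ^ (p - 1)) := by
        rw [integral_add (ip1.const_mul _) ic, integral_const_mul, setIntegral_const, smul_eq_mul,
          mul_comm (s ^ (p - 1))]
      rw [this]
      exact setIntegral_mono_on im1 ((ip1.const_mul _).add ic) hΩ.measurableSet
        fun x _ => young2 hp (pPart_nonneg _) hs0
    have h3 : X ≤ C * E * ((s ^ 2)⁻¹ * X + s ^ (p - 1) * volume.real Ω) :=
      H1.trans (by gcongr)
    have e3 : C * E * ((s ^ 2)⁻¹ * X) = X / 2 := by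
      rw [hs2]; field_simp
    have e4 : s ^ (p - 1) = (2 * C * E) ^ ((p - 1) / 2) := by
      rw [hs, Real.sqrt_eq_rpow, ← Real.rpow_mul (by positivity)]; congr 1; ring
    rw [mul_add, e3, e4] at h3
    have : 0 ≤ C * E * (2 * C * E) ^ ((p - 1) / 2) := by positivity
    have h5 : X ≤ 2 * (C * E * ((2 * C * E) ^ ((p - 1) / 2) * volume.real Ω)) := by linarith
    refine h5.trans ?_
    nlinarith

lemma path_lower {k p ε : ℝ} (hk : 0 < k) (hp : 1 < p) {Ω : Set (ℝ × ℝ)} (hΩ : IsOpen Ω)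
    (hb : Bornology.IsBounded Ω) {q : ℝ × ℝ → ℝ}
    (hqc : ContinuousOn q (closure Ω)) (hq : ∀ x ∈ closure Ω, 0 < q x)
    (h0 : 0 < ε) (h1 : ε < 1) : ∃ β > 0, ∀ c ∈ PathSet k p q Ω ε, β ≤ c := by
  obtain ⟨B, hB, D, hD, H⟩ := sobolev2 hk hp hΩ hb
  obtain ⟨m, hm, hmq⟩ := exists_qmin hb hqc hq
  have hL := log_inv_pos h0 h1
  set Cc := 1 / ((p + 1) * ε ^ 2) with hCc
  have hCc0 : 0 < Cc := by rw [hCc]; positivity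
  -- lower bound
  have Hw : ∀ w, MemH k Ω w → (1 / 2) * En k Ω w w -
      Cc * (D * En k Ω w w * (B * En k Ω w w) ^ ((p - 1) / 2)) ≤ Ieps k p ε q Ω w := by
    intro w hw
    rw [Ieps_eq]
    have := H w (fun x => q x * Real.log (1 / ε)) (m * Real.log (1 / ε)) (by positivity)
      (fun x hx => by have := hmq x (subset_closure hx); gcongr) (hqc.mul continuousOn_const) hw
    gcongr
  have hI2 : ∀ w, Ieps k p ε q Ω w ≤ (1 / 2) * En k Ω w w := by
    intro w
    rw [Ieps_eq]
    have : 0 ≤ ∫ x in Ω, pPart (w x - q x * Real.log (1 / ε)) ^ (p + 1) :=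
      integral_nonneg fun x => Real.rpow_nonneg (pPart_nonneg _) _
    have : 0 ≤ Cc * ∫ x in Ω, pPart (w x - q x * Real.log (1 / ε)) ^ (p + 1) := by positivity
    linarith
  obtain ⟨Es, hEs, hEs2⟩ : ∃ Es > 0, Cc * D * (B * Es) ^ ((p - 1) / 2) < 1 / 4 := by
    have hc : ContinuousAt (fun E : ℝ => Cc * D * (B * E) ^ ((p - 1) / 2)) 0 :=
      continuousAt_const.mul ((continuousAt_const.mul continuousAt_id).rpow_const (Or.inr (by linarith)))
    have h00 : (fun E : ℝ => Cc * D * (B * E) ^ ((p - 1) / 2)) 0 < 1 / 4 := by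
      simp only [mul_zero]
      rw [Real.zero_rpow (by linarith)]; norm_num
    have := hc.eventually (gt_mem_nhds h00)
    rw [Metric.eventually_nhds_iff] at this
    obtain ⟨r, hr, h⟩ := this
    refine ⟨r / 2, by positivity, h ?_⟩
    rw [Real.dist_eq, sub_zero, abs_of_pos (by positivity)]; linarith
  have Hs : ∀ w, MemH k Ω w → En k Ω w w ≤ Es → En k Ω w w / 4 ≤ Ieps k p ε q Ω w := by
    intro w hw hE
    refine le_trans ?_ (Hw w hw)
    have n := En_nonneg k Ω w
    have : (B * En k Ω w w) ^ ((p - 1) / 2) ≤ (B * Es) ^ ((p - 1) / 2) :=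
      Real.rpow_le_rpow (by positivity) (by gcongr) (by linarith)
    have h6 : Cc * D * (B * En k Ω w w) ^ ((p - 1) / 2) ≤ 1 / 4 :=
      le_trans (by gcongr) hEs2.le
    nlinarith
  refine ⟨Es / 4, by positivity, ?_⟩
  rintro c ⟨γ, g1, g2, g3, g4, rfl⟩
  set e : ℝ → ℝ := fun t => En k Ω (γ t) (γ t) with he
  have hsub : ∀ s ∈ Icc (0:ℝ) 1, ∀ t ∈ Icc (0:ℝ) 1, MemH k Ω (fun y => γ s y - γ t y) := by
    intro s hs t ht
    have := (MemH.lin hk hΩ (g1 s hs) (g1 t ht) 1 (-1)).1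
    have e : (fun y => 1 * γ s y + (-1) * γ t y) = fun y => γ s y - γ t y := by funext y; ring
    rwa [e] at this
  have ec : ContinuousOn e (Icc 0 1) := by
    rw [Metric.continuousOn_iff]
    intro t ht η hη
    have n := En_nonneg k Ω (γ t)
    set θ := η / (4 * (e t + 1)) with hθ
    have het : 0 ≤ e t := n
    have hθ0 : 0 < θ := by positivity
    obtain ⟨r, hr, hr2⟩ := g2 t ht (min (η / 4) (θ * (η / 4))) (by positivity)
    refine ⟨r, hr, fun s hs hst => ?_⟩
    have hd := hr2 s hs (by rwa [Real.dist_eq] at hst)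
    set d := fun y => γ s y - γ t y with hdd
    have hdm : MemH k Ω d := hsub s hs t ht
    have l := (MemH.lin hk hΩ (g1 t ht) hdm 1 1).2
    have e2 : (fun y => 1 * γ t y + 1 * d y) = γ s := by funext y; simp [hdd]
    rw [e2] at l
    have c1 := En_cs hk hΩ (g1 t ht) hdm hθ0
    have hd' : En k Ω d d < min (η / 4) (θ * (η / 4)) := hd
    have d1 := hd'.trans_le (min_le_left _ _)
    have d2 := hd'.trans_le (min_le_right _ _)
    have nd := En_nonneg k Ω d
    have d3 : En k Ω d d / θ < η / 4 := by rw [div_lt_iff₀ hθ0]; linarith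
    have d4 : θ * e t ≤ η / 4 := by
      rw [hθ, div_mul_eq_mul_div, div_le_div_iff₀ (by positivity) (by positivity)]
      nlinarith
    rw [Real.dist_eq]
    have : e s - e t = 2 * En k Ω (γ t) d + En k Ω d d := by
      simp only [he]; rw [l]; ring
    rw [this]
    have a1 := abs_le.1 (le_refl |En k Ω (γ t) d|)
    have d4' : θ * En k Ω (γ t) (γ t) ≤ η / 4 := d4
    rw [abs_lt]; constructor <;> linarith [a1.1, a1.2]
  have e0 : e 0 = 0 := by
    simp only [he, g3]
    unfold En
    have : (fun x => KHform k x (grad (fun _ => (0:ℝ)) x) (grad (fun _ => (0:ℝ)) x)) = fun _ => 0 := by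
      funext x; simp [grad, KHform]
    rw [this]; simp
  have e1 : Es < e 1 := by
    by_contra hh
    have := Hs (γ 1) (g1 1 (right_mem_Icc.2 zero_le_one)) (not_lt.1 hh)
    have n := En_nonneg k Ω (γ 1)
    linarith
  obtain ⟨t, ht, hte⟩ := intermediate_value_Icc zero_le_one ec ⟨by rw [e0]; exact hEs.le, e1.le⟩
  have hI := Hs (γ t) (g1 t ht) hte.le
  have hte' : En k Ω (γ t) (γ t) = Es := hte
  rw [hte'] at hI
  refine hI.trans (le_csSup ?_ (mem_image_of_mem _ ht))
  obtain ⟨M, hM⟩ := (isCompact_Icc.image_of_continuousOn ec).bddAbove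
  refine ⟨(1 / 2) * M, ?_⟩
  rintro _ ⟨s, hs, rfl⟩
  refine (hI2 _).trans ?_
  have := hM (mem_image_of_mem _ hs)
  have : En k Ω (γ s) (γ s) ≤ M := this
  linarith
end

section

/-- truncation of `h` localised to `O` -/
def tr (Ω O : Set (ℝ × ℝ)) (δ : ℝ) (h : ℝ × ℝ → ℝ) : ℝ × ℝ → ℝ :=
  (Ω ∩ O).indicator (fun x => phi δ (h x))

lemma tr_nonneg {Ω O : Set (ℝ × ℝ)} {δ : ℝ} (hδ : 0 < δ) (h : ℝ × ℝ → ℝ) (x : ℝ × ℝ) :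
    0 ≤ tr Ω O δ h x := indicator_nonneg (fun x _ => phi_nonneg hδ _) x

lemma tr_TF {Ω O O' : Set (ℝ × ℝ)} (hΩ : IsOpen Ω) (hb : Bornology.IsBounded Ω)
    (hO : IsOpen O) (hO' : IsOpen O') (hd : Disjoint O O') {δ : ℝ} (hδ : 0 < δ)
    {h : ℝ × ℝ → ℝ} (hc : ContinuousOn h (closure Ω)) (h1 : ContDiffOn ℝ 1 h Ω)
    (hf : ∀ x ∈ frontier Ω, h x < δ) (hcov : ∀ x ∈ Ω, 0 < h x → x ∈ O ∪ O') :
    TF Ω (tr Ω O δ h) := by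
  obtain ⟨K1, K2⟩ := superlevel_compact hΩ hb hc hf
  have hcomp : IsCompact ({x ∈ closure Ω | δ ≤ h x} \ O') := K1.diff hO'
  have hsub : ({x ∈ closure Ω | δ ≤ h x} \ O') ⊆ Ω ∩ O := by
    rintro x ⟨hx, hx'⟩
    have hxΩ := K2 hx
    refine ⟨hxΩ, ?_⟩
    rcases hcov x hxΩ (by linarith [hx.2]) with h | h
    · exact h
    · exact absurd h hx'
  have := TF.mk' (hΩ.inter hO) (h := fun x => phi δ (h x))
    ((phi_contDiff hδ).comp_contDiffOn (h1.mono inter_subset_left)) hcomp hsub (by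
      intro x hx hxC
      apply phi_eq_zero hδ
      by_contra hlt
      push Not at hlt
      exact hxC ⟨⟨subset_closure hx.1, hlt.le⟩, fun hx' => (Set.disjoint_left.1 hd) hx.2 hx'⟩)
  exact ⟨this.1, this.2.1, this.2.2.trans inter_subset_left⟩

lemma tr_grad {Ω O : Set (ℝ × ℝ)} (hΩ : IsOpen Ω) (hO : IsOpen O) {δ : ℝ} (hδ : 0 < δ)
    {h : ℝ × ℝ → ℝ} (h1 : ContDiffOn ℝ 1 h Ω) {x : ℝ × ℝ} (hx : x ∈ Ω) (hxO : x ∈ O) :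
    grad (tr Ω O δ h) x = dphi δ (h x) • grad h x := by
  have e : tr Ω O δ h =ᶠ[𝓝 x] fun y => phi δ (h y) := by
    filter_upwards [(hΩ.inter hO).mem_nhds ⟨hx, hxO⟩] with y hy
    exact indicator_of_mem hy _
  have : grad (tr Ω O δ h) x = grad (fun y => phi δ (h y)) x := by
    unfold grad; rw [e.fderiv_eq]
  rw [this]
  exact grad_comp (diffAt_of hΩ one_ne_zero h1 hx) (phi_hasDerivAt hδ _)

lemma tr_grad0 {Ω O O' : Set (ℝ × ℝ)} (hΩ : IsOpen Ω) (hO' : IsOpen O') (hd : Disjoint O O')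
    {δ : ℝ} (hδ : 0 < δ)
    {h : ℝ × ℝ → ℝ} (h1 : ContDiffOn ℝ 1 h Ω) (hcov : ∀ x ∈ Ω, 0 < h x → x ∈ O ∪ O')
    {x : ℝ × ℝ} (hx : x ∈ Ω) (hxO : x ∉ O) :
    grad (tr Ω O δ h) x = 0 := by
  have e : tr Ω O δ h =ᶠ[𝓝 x] fun y => 0 := by
    by_cases hx' : x ∈ O'
    · filter_upwards [hO'.mem_nhds hx'] with y hy
      exact indicator_of_notMem (fun hh => (Set.disjoint_left.1 hd) hh.2 hy) _
    · have hle : h x ≤ 0 := by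
        by_contra hlt
        push Not at hlt
        rcases hcov x hx hlt with h | h
        · exact hxO h
        · exact hx' h
      have : ∀ᶠ y in 𝓝 x, h y < δ :=
        ((h1.continuousOn).continuousAt (hΩ.mem_nhds hx)).eventually_lt_const (by linarith)
      filter_upwards [this] with y hy
      unfold tr indicator
      split_ifs
      · exact phi_eq_zero hδ hy.le
      · rfl
  unfold grad; rw [e.fderiv_eq]; simp

lemma TF.int_cross {Ω : Set (ℝ × ℝ)} {k : ℝ} (hk : 0 < k) (hΩ : IsOpen Ω) {U ψ : ℝ × ℝ → ℝ}
    (hU : ContDiffOn ℝ 1 U Ω) (h : TF Ω ψ) :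
    IntegrableOn (fun x => KHform k x (grad U x) (grad ψ x)) Ω := by
  have hc : ContinuousOn (fun x => KHform k x (grad U x) (grad ψ x)) Ω :=
    KHform_continuousOn hk (grad_continuousOn hΩ hU) (grad_continuousOn hΩ h.1.contDiffOn)
  have hi : IntegrableOn (fun x => KHform k x (grad U x) (grad ψ x)) (tsupport ψ) :=
    (hc.mono h.2.2).integrableOn_compact h.2.1
  refine hi.of_forall_diff_eq_zero hΩ.measurableSet ?_
  rintro x ⟨-, hx⟩
  have : fderiv ℝ ψ x = 0 :=
    image_eq_zero_of_notMem_tsupport (fun hh => hx (tsupport_fderiv_subset ℝ hh))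
  simp [grad, this, KHform]

lemma En_lin_left {Ω : Set (ℝ × ℝ)} {k : ℝ} (hk : 0 < k) (hΩ : IsOpen Ω) {U V ψ : ℝ × ℝ → ℝ}
    (hU : ContDiffOn ℝ 1 U Ω) (hV : ContDiffOn ℝ 1 V Ω) (h : TF Ω ψ) (L : ℝ) :
    En k Ω (fun x => U x - V x * L) ψ = En k Ω U ψ - L * En k Ω V ψ := by
  unfold En
  rw [← integral_const_mul, ← integral_sub (h.int_cross hk hΩ hU)
    ((h.int_cross hk hΩ hV).const_mul L)]
  apply setIntegral_congr_fun hΩ.measurableSet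
  intro x hx
  have := grad_lin (diffAt_of hΩ one_ne_zero hU hx) (diffAt_of hΩ one_ne_zero hV hx) 1 (-L)
  have e : (fun x => U x - V x * L) = fun y => 1 * U y + -L * V y := by
    funext y; ring
  simp only [e, this]
  simp [KHform]; ring

/-- testing the equation with a localised truncation -/
lemma test_core {Ω O O' : Set (ℝ × ℝ)} {k p ε δ : ℝ} {q u : ℝ × ℝ → ℝ} (hk : 0 < k)
    (hΩ : IsOpen Ω) (hb : Bornology.IsBounded Ω)
    (hO : IsOpen O) (hO' : IsOpen O') (hd : Disjoint O O') (hδ : 0 < δ)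
    (h0 : 0 < ε) (h1 : ε < 1)
    (hq1 : ContDiffOn ℝ 2 q Ω) (hqc : ContinuousOn q (closure Ω))
    (hq3 : ∀ x ∈ closure Ω, 0 < q x) (hq4 : ∀ x ∈ Ω, LH k q x = 0)
    (hu : IsSolution k p ε q Ω u)
    (hcov : ∀ x ∈ Ω, 0 < u x - q x * log (1 / ε) → x ∈ O ∪ O') :
    TF Ω (tr Ω O δ (fun x => u x - q x * log (1 / ε))) ∧
    En k Ω u (tr Ω O δ (fun x => u x - q x * log (1 / ε))) = (1 / ε ^ 2) *
      ∫ x in Ω, pPart (u x - q x * log (1 / ε)) ^ p * tr Ω O δ (fun x => u x - q x * log (1 / ε)) x ∧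
    En k Ω (tr Ω O δ (fun x => u x - q x * log (1 / ε))) (tr Ω O δ (fun x => u x - q x * log (1 / ε)))
      ≤ (1 / ε ^ 2) *
      ∫ x in Ω, pPart (u x - q x * log (1 / ε)) ^ p * tr Ω O δ (fun x => u x - q x * log (1 / ε)) x := by
  have hL := log_inv_pos h0 h1
  set L := log (1 / ε)
  set v := (fun x => u x - q x * L) with hv
  set ψ := tr Ω O δ v with hψ
  obtain ⟨uc, u2, uf, ueq⟩ := hu
  have u1 : ContDiffOn ℝ 1 u Ω := u2.of_le (by norm_num)
  have q1 : ContDiffOn ℝ 1 q Ω := hq1.of_le (by norm_num)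
  have v1 : ContDiffOn ℝ 1 v Ω := u1.sub (q1.mul contDiffOn_const)
  have vc : ContinuousOn v (closure Ω) := uc.sub (hqc.mul continuousOn_const)
  have hTF : TF Ω ψ := tr_TF hΩ hb hO hO' hd hδ vc v1 (by
    intro x hx
    have := mul_pos (hq3 x (frontier_subset_closure hx)) hL
    simp only [hv, uf x hx]; linarith) hcov
  have e1 : En k Ω u ψ = (1 / ε ^ 2) * ∫ x in Ω, pPart (v x) ^ p * ψ x := by
    rw [weak_form hk hΩ u2 hTF, ← integral_const_mul]
    apply setIntegral_congr_fun hΩ.measurableSet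
    intro x hx
    simp only [ueq x hx]; rw [mul_assoc]
  have e2 : En k Ω q ψ = 0 := by
    rw [weak_form hk hΩ hq1 hTF]
    apply setIntegral_eq_zero_of_forall_eq_zero
    intro x hx
    rw [hq4 x hx, zero_mul]
  refine ⟨hTF, e1, ?_⟩
  have e3 : En k Ω v ψ = En k Ω u ψ := by
    rw [hv, En_lin_left hk hΩ u1 q1 hTF, e2]; ring
  rw [← e1, ← e3]
  unfold En
  apply setIntegral_mono_on (hTF.int_cross hk hΩ hTF.1.contDiffOn) (hTF.int_cross hk hΩ v1)
    hΩ.measurableSet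
  intro x hx
  by_cases hxO : x ∈ O
  · rw [tr_grad hΩ hO hδ v1 hx hxO]
    have n := KHform_nonneg k x (grad v x)
    have d0 := dphi_nonneg (δ := δ) (v x)
    have d1 := dphi_le hδ (v x)
    have a1 : KHform k x (dphi δ (v x) • grad v x) (dphi δ (v x) • grad v x)
        = dphi δ (v x) * (dphi δ (v x) * KHform k x (grad v x) (grad v x)) := by
      simp [KHform]; ring
    have a2 : KHform k x (grad v x) (dphi δ (v x) • grad v x)
        = dphi δ (v x) * KHform k x (grad v x) (grad v x) := by
      simp [KHform]; ring
    rw [a1, a2]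
    have : dphi δ (v x) * KHform k x (grad v x) (grad v x) ≤ 1 * KHform k x (grad v x) (grad v x) :=
      mul_le_mul_of_nonneg_right d1 n
    nlinarith [mul_nonneg d0 n]
  · rw [tr_grad0 hΩ hO' hd hδ v1 hcov hx hxO]
    simp [KHform]
end

section

/-- standing assumptions -/
structure Ctx (k p : ℝ) (Ω : Set (ℝ × ℝ)) (q : ℝ × ℝ → ℝ) : Prop where
  hk : 0 < k
  hp : 1 < p
  ho : IsOpen Ω
  hcn : IsConnected Ω
  hb : Bornology.IsBounded Ω
  hq1 : ContDiffOn ℝ 2 q Ω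
  hqc : ContinuousOn q (closure Ω)
  hq3 : ∀ x ∈ closure Ω, 0 < q x
  hq4 : ∀ x ∈ Ω, LH k q x = 0

/-- `u - q log (1/ε)` -/
abbrev vv (q : ℝ × ℝ → ℝ) (ε : ℝ) (u : ℝ × ℝ → ℝ) : ℝ × ℝ → ℝ := fun x => u x - q x * log (1 / ε)

def JJ (p : ℝ) (Ω : Set (ℝ × ℝ)) (q : ℝ × ℝ → ℝ) (ε : ℝ) (u : ℝ × ℝ → ℝ) (O : Set (ℝ × ℝ)) (δ : ℝ) : ℝ :=
  (1 / ε ^ 2) * ∫ x in Ω, pPart (vv q ε u x) ^ p * tr Ω O δ (vv q ε u) x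

def aO (p : ℝ) (Ω : Set (ℝ × ℝ)) (q : ℝ × ℝ → ℝ) (ε : ℝ) (u : ℝ × ℝ → ℝ) (O : Set (ℝ × ℝ)) : ℝ :=
  (1 / ε ^ 2) * ∫ x in Ω, O.indicator (fun x => pPart (vv q ε u x) ^ (p + 1)) x

def bb (p : ℝ) (Ω : Set (ℝ × ℝ)) (q : ℝ × ℝ → ℝ) (ε : ℝ) (u : ℝ × ℝ → ℝ) : ℝ :=
  (1 / ε ^ 2) * ∫ x in Ω, pPart (vv q ε u x) ^ p

lemma rpow_tangent {p a b : ℝ} (hp : 0 < p) (ha : 0 ≤ a) (hb : 0 ≤ b) :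
    a ^ (p + 1) + (p + 1) * a ^ p * (b - a) ≤ b ^ (p + 1) := by
  rcases eq_or_lt_of_le ha with h | h
  · subst h
    rw [Real.zero_rpow (by linarith), Real.zero_rpow hp.ne']
    have := Real.rpow_nonneg hb (p + 1)
    nlinarith
  · have := one_add_mul_self_le_rpow_one_add (s := b / a - 1) (by have := div_nonneg hb ha; linarith)
      (p := p + 1) (by linarith)
    have e : (1 + (b / a - 1)) ^ (p + 1) = b ^ (p + 1) / a ^ (p + 1) := by
      rw [← Real.div_rpow hb ha]; congr 1; ring
    rw [e, le_div_iff₀ (by positivity)] at this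
    refine le_trans (le_of_eq ?_) this
    have e2 : a ^ (p + 1) = a ^ p * a := by rw [Real.rpow_add_one h.ne']
    rw [e2]; field_simp

section
variable {k p ε : ℝ} {Ω : Set (ℝ × ℝ)} {q u : ℝ × ℝ → ℝ}

lemma Ctx.vcont (C : Ctx k p Ω q) (hu : ContinuousOn u (closure Ω)) :
    ContinuousOn (vv q ε u) (closure Ω) := hu.sub (C.hqc.mul continuousOn_const)

lemma Ctx.int_pow (C : Ctx k p Ω q) (hu : ContinuousOn u (closure Ω)) {a : ℝ} (ha : 0 ≤ a) :
    IntegrableOn (fun x => pPart (vv q ε u x) ^ a) Ω :=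
  cont_int C.ho C.hb (pPart_cont (C.vcont hu) ha)

lemma bb_nonneg (p : ℝ) (Ω : Set (ℝ × ℝ)) (q : ℝ × ℝ → ℝ) (ε : ℝ) (u : ℝ × ℝ → ℝ) :
    0 ≤ bb p Ω q ε u := by
  unfold bb
  apply mul_nonneg (by positivity)
  exact integral_nonneg fun x => Real.rpow_nonneg (pPart_nonneg _) _

lemma tr_le {O : Set (ℝ × ℝ)} {δ : ℝ} (hδ : 0 < δ) (h : ℝ × ℝ → ℝ) (x : ℝ × ℝ) :
    tr Ω O δ h x ≤ pPart (h x) := by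
  unfold tr indicator
  split_ifs
  · exact phi_le hδ _
  · exact pPart_nonneg _

lemma J_bounds (C : Ctx k p Ω q) (hu : ContinuousOn u (closure Ω)) {O : Set (ℝ × ℝ)}
    (hO : IsOpen O) {δ : ℝ} (hδ : 0 < δ) (hT : TF Ω (tr Ω O δ (vv q ε u))) :
    JJ p Ω q ε u O δ ≤ aO p Ω q ε u O ∧
    aO p Ω q ε u O - 2 * δ * bb p Ω q ε u ≤ JJ p Ω q ε u O δ ∧
    aO p Ω q ε u O - 2 * (p + 1) * δ * bb p Ω q ε u ≤
      (1 / ε ^ 2) * ∫ x in Ω, tr Ω O δ (vv q ε u) x ^ (p + 1) := by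
  have hp := C.hp
  have i1 : IntegrableOn (fun x => pPart (vv q ε u x) ^ p) Ω := C.int_pow hu (by linarith)
  have i2 : IntegrableOn (fun x => O.indicator (fun x => pPart (vv q ε u x) ^ (p + 1)) x) Ω :=
    (C.int_pow hu (by linarith)).indicator hO.measurableSet
  have i3 : IntegrableOn (fun x => pPart (vv q ε u x) ^ p * tr Ω O δ (vv q ε u) x) Ω :=
    cont_int C.ho C.hb ((pPart_cont (C.vcont hu) (by linarith)).mul hT.1.continuous.continuousOn)
  have i4 : IntegrableOn (fun x => tr Ω O δ (vv q ε u) x ^ (p + 1)) Ω :=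
    cont_int C.ho C.hb (hT.1.continuous.continuousOn.rpow_const fun _ _ => Or.inr (by linarith))
  have hpow : ∀ x, pPart (vv q ε u x) ^ (p + 1) = pPart (vv q ε u x) ^ p * pPart (vv q ε u x) := by
    intro x
    rcases eq_or_lt_of_le (pPart_nonneg (vv q ε u x)) with h | h
    · rw [← h, mul_zero, Real.zero_rpow (by linarith)]
    · rw [Real.rpow_add_one h.ne']
  have hpn : ∀ x, 0 ≤ pPart (vv q ε u x) ^ p := fun x => Real.rpow_nonneg (pPart_nonneg _) _
  have hin : ∀ x ∈ Ω, x ∈ O → pPart (vv q ε u x) - 2 * δ ≤ tr Ω O δ (vv q ε u) x := by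
    intro x hx hxO
    unfold tr
    rw [indicator_of_mem (show x ∈ Ω ∩ O from ⟨hx, hxO⟩)]
    exact le_phi hδ _
  refine ⟨?_, ?_, ?_⟩
  · unfold JJ aO
    apply mul_le_mul_of_nonneg_left _ (by positivity)
    apply setIntegral_mono_on i3 i2 C.ho.measurableSet
    intro x hx
    by_cases hxO : x ∈ O
    · rw [indicator_of_mem hxO, hpow]
      exact mul_le_mul_of_nonneg_left (tr_le hδ _ _) (hpn x)
    · rw [indicator_of_notMem hxO, tr, indicator_of_notMem (fun h => hxO h.2), mul_zero]
  · unfold JJ aO bb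
    rw [show 2 * δ * (1 / ε ^ 2 * ∫ x in Ω, pPart (vv q ε u x) ^ p) =
      1 / ε ^ 2 * ∫ x in Ω, 2 * δ * pPart (vv q ε u x) ^ p by rw [integral_const_mul]; ring,
      ← mul_sub, ← integral_sub i2 (i1.const_mul _)]
    apply mul_le_mul_of_nonneg_left _ (by positivity)
    apply setIntegral_mono_on (i2.sub (i1.const_mul _)) i3 C.ho.measurableSet
    intro x hx
    rw [Pi.sub_apply]
    have := hpn x
    by_cases hxO : x ∈ O
    · rw [indicator_of_mem hxO, hpow]
      nlinarith [hin x hx hxO]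
    · rw [indicator_of_notMem hxO, tr, indicator_of_notMem (fun h => hxO h.2), mul_zero]
      nlinarith
  · unfold aO bb
    rw [show 2 * (p + 1) * δ * (1 / ε ^ 2 * ∫ x in Ω, pPart (vv q ε u x) ^ p) =
      1 / ε ^ 2 * ∫ x in Ω, 2 * (p + 1) * δ * pPart (vv q ε u x) ^ p by rw [integral_const_mul]; ring,
      ← mul_sub, ← integral_sub i2 (i1.const_mul _)]
    apply mul_le_mul_of_nonneg_left _ (by positivity)
    apply setIntegral_mono_on (i2.sub (i1.const_mul _)) i4 C.ho.measurableSet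
    intro x hx
    rw [Pi.sub_apply]
    have := hpn x
    by_cases hxO : x ∈ O
    · rw [indicator_of_mem hxO]
      have t := rpow_tangent (p := p) (by linarith) (pPart_nonneg (vv q ε u x))
        (tr_nonneg (Ω := Ω) (O := O) hδ (vv q ε u) x)
      have h2 := hin x hx hxO
      have : 0 ≤ (p + 1) * pPart (vv q ε u x) ^ p := by positivity
      nlinarith
    · rw [indicator_of_notMem hxO, tr, indicator_of_notMem (fun h => hxO h.2),
        Real.zero_rpow (by linarith)]
      have : 0 ≤ 2 * (p + 1) * δ * pPart (vv q ε u x) ^ p := by positivity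
      linarith

lemma aO_pos (C : Ctx k p Ω q) (h0 : 0 < ε) (hu : ContinuousOn u (closure Ω)) {O : Set (ℝ × ℝ)}
    (hO : IsOpen O) (hne : ∃ x ∈ Ω, x ∈ O ∧ 0 < vv q ε u x) : 0 < aO p Ω q ε u O := by
  have hp := C.hp
  unfold aO
  apply mul_pos (by positivity)
  rw [integral_indicator hO.measurableSet, Measure.restrict_restrict hO.measurableSet]
  rw [setIntegral_pos_iff_support_of_nonneg_ae (Eventually.of_forall fun x =>
    Real.rpow_nonneg (pPart_nonneg _) _)
    ((C.int_pow hu (by linarith)).mono_set inter_subset_right)]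
  obtain ⟨x, hx, hxO, hv⟩ := hne
  have hop : IsOpen ((O ∩ Ω) ∩ vv q ε u ⁻¹' Ioi 0) :=
    ((C.vcont hu).mono (inter_subset_right.trans subset_closure)).isOpen_inter_preimage
      (hO.inter C.ho) isOpen_Ioi
  refine lt_of_lt_of_le (hop.measure_pos volume ⟨x, ⟨hxO, hx⟩, hv⟩) (measure_mono ?_)
  rintro y ⟨hy, hy2⟩
  refine ⟨?_, hy⟩
  have : 0 < pPart (vv q ε u y) := lt_max_of_lt_left hy2
  exact (Real.rpow_pos_of_pos this _).ne'

lemma ceps_pos (C : Ctx k p Ω q) (h0 : 0 < ε) (h1 : ε < 1) (hne : (PathSet k p q Ω ε).Nonempty) :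
    0 < ceps k p q Ω ε := by
  obtain ⟨β, hβ, H⟩ := path_lower C.hk C.hp C.ho C.hb C.hqc C.hq3 h0 h1
  exact lt_of_lt_of_le hβ (le_csInf hne H)

lemma ceps_le (C : Ctx k p Ω q) (h0 : 0 < ε) (h1 : ε < 1) {c B : ℝ} (hc : c ∈ PathSet k p q Ω ε)
    (hB : c ≤ B) : ceps k p q Ω ε ≤ B :=
  (csInf_le (PathSet_bdd C.ho C.hp h0 h1 fun x hx => C.hq3 x (subset_closure hx)) hc).trans hB

lemma tr_univ_grad (C : Ctx k p Ω q) {h : ℝ × ℝ → ℝ} {δ : ℝ} (hδ : 0 < δ)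
    (h1 : ContDiffOn ℝ 1 h Ω) {x : ℝ × ℝ} (hx : x ∈ Ω) :
    grad (tr Ω univ δ h) x = dphi δ (h x) • grad h x := tr_grad C.ho isOpen_univ hδ h1 hx (mem_univ x)

lemma tr_univ_TF (C : Ctx k p Ω q) {h : ℝ × ℝ → ℝ} {δ : ℝ} (hδ : 0 < δ)
    (hc : ContinuousOn h (closure Ω)) (h1 : ContDiffOn ℝ 1 h Ω)
    (hf : ∀ x ∈ frontier Ω, h x < δ) : TF Ω (tr Ω univ δ h) :=
  tr_TF C.ho C.hb isOpen_univ isOpen_empty (by simp) hδ hc h1 hf (by simp)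

/-- if `u` is `L_H`-harmonic where it is positive-tested, its gradient vanishes on `{u > 0}` -/
lemma harm_grad (C : Ctx k p Ω q) (uc : ContinuousOn u (closure Ω)) (u2 : ContDiffOn ℝ 2 u Ω)
    (uf : ∀ x ∈ frontier Ω, u x = 0) (hL : ∀ x ∈ Ω, LH k u x = 0) {x : ℝ × ℝ} (hx : x ∈ Ω)
    (hux : 0 < u x) : grad u x = 0 := by
  have u1 : ContDiffOn ℝ 1 u Ω := u2.of_le (by norm_num)
  set δ := u x / 2 with hδd
  have hδ : 0 < δ := by positivity
  have hT : TF Ω (tr Ω univ δ u) := tr_univ_TF C hδ uc u1 (fun y hy => by rw [uf y hy]; exact hδ)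
  have hz : En k Ω u (tr Ω univ δ u) = 0 := by
    rw [weak_form C.hk C.ho u2 hT]
    apply setIntegral_eq_zero_of_forall_eq_zero
    intro y hy
    rw [hL y hy, zero_mul]
  have e : ∀ y ∈ Ω, KHform k y (grad u y) (grad (tr Ω univ δ u) y)
      = dphi δ (u y) * KHform k y (grad u y) (grad u y) := by
    intro y hy
    rw [tr_univ_grad C hδ u1 hy]; simp [KHform]; ring
  have hn : ∀ y ∈ Ω, 0 ≤ KHform k y (grad u y) (grad (tr Ω univ δ u) y) := by
    intro y hy
    rw [e y hy]; exact mul_nonneg (dphi_nonneg _) (KHform_nonneg _ _ _)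
  by_contra hg
  have hpos : 0 < KHform k x (grad u x) (grad (tr Ω univ δ u) x) := by
    rw [e x hx]
    refine mul_pos (dphi_pos hδ (by linarith)) (lt_of_lt_of_le ?_ (le_KHform C.hk x _))
    have hd : 0 < detKH k x := by
      unfold detKH; have := C.hk; have := den_pos C.hk x; positivity
    refine mul_pos hd ?_
    by_contra hh
    push Not at hh
    apply hg
    have a1 : (grad u x).1 = 0 := by nlinarith [sq_nonneg (grad u x).1, sq_nonneg (grad u x).2]
    have a2 : (grad u x).2 = 0 := by nlinarith [sq_nonneg (grad u x).1, sq_nonneg (grad u x).2]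
    exact Prod.ext a1 a2
  have hc : ContinuousOn (fun x => KHform k x (grad u x) (grad (tr Ω univ δ u) x)) Ω :=
    KHform_continuousOn C.hk (grad_continuousOn C.ho u1) (grad_continuousOn C.ho hT.1.contDiffOn)
  have : 0 < En k Ω u (tr Ω univ δ u) := by
    unfold En
    rw [setIntegral_pos_iff_support_of_nonneg_ae
      ((ae_restrict_iff' C.ho.measurableSet).2 (Eventually.of_forall hn)) (hT.int_cross C.hk C.ho u1)]
    have hop := hc.isOpen_inter_preimage C.ho (isOpen_Ioi (a := (0:ℝ)))
    refine lt_of_lt_of_le (hop.measure_pos volume ⟨x, hx, hpos⟩) (measure_mono ?_)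
    rintro y ⟨hy, hy2⟩
    exact ⟨ne_of_gt (mem_Ioi.1 (mem_preimage.1 hy2)), hy⟩
  linarith

lemma core_nonempty (C : Ctx k p Ω q) (h0 : 0 < ε) (h1 : ε < 1) (hu : IsMPSolution k p ε q Ω u)
    (hne : (PathSet k p q Ω ε).Nonempty) : (vcore q Ω ε u).Nonempty := by
  by_contra hem
  rw [not_nonempty_iff_eq_empty] at hem
  have hle : ∀ x ∈ Ω, u x - q x * log (1 / ε) ≤ 0 := by
    intro x hx
    by_contra hlt
    have : x ∈ vcore q Ω ε u := ⟨hx, by linarith⟩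
    rw [hem] at this; exact this
  obtain ⟨⟨uc, u2, uf, ueq⟩, hm, hI⟩ := hu
  have hp := C.hp
  have hL : ∀ x ∈ Ω, LH k u x = 0 := by
    intro x hx
    rw [ueq x hx, pPart, max_eq_right (hle x hx), Real.zero_rpow (by linarith), mul_zero]
  have u1 : ContDiffOn ℝ 1 u Ω := u2.of_le (by norm_num)
  have gneg : ∀ x, grad (fun y => - u y) x = - grad u x := by
    intro x
    unfold grad
    rw [fderiv_fun_neg]; rfl
  have hLn : ∀ x ∈ Ω, LH k (fun y => - u y) x = 0 := by
    intro x hx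
    have e : (fun y => KHvec k y (grad (fun y => - u y) y)) = fun y => - KHvec k y (grad u y) := by
      funext y; rw [gneg]; unfold KHvec
      ext <;> simp <;> ring
    have := hL x hx
    unfold LH div2 at this ⊢
    rw [e]
    simp only [Prod.fst_neg, Prod.snd_neg, fderiv_fun_neg]
    simp only [neg_apply]
    linarith
  have hg : ∀ x ∈ Ω, u x ≠ 0 → grad u x = 0 := by
    intro x hx hux
    rcases lt_or_gt_of_ne hux with h | h
    · have := harm_grad C (u := fun y => - u y) uc.neg u2.neg (by intro y hy; rw [uf y hy]; simp) hLn hx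
        (by linarith)
      rw [gneg] at this
      exact neg_eq_zero.1 this
    · exact harm_grad C uc u2 uf hL hx h
  have hg' : ∀ x ∈ Ω, grad u x = 0 := by
    intro x hx
    by_contra hgx
    have hcg := (grad_continuousOn C.ho u1).continuousAt (C.ho.mem_nhds hx)
    have ev : ∀ᶠ y in 𝓝 x, u y = 0 := by
      filter_upwards [hcg.eventually_ne hgx, C.ho.mem_nhds hx] with y hy hyΩ
      by_contra hyn
      exact hy (hg y hyΩ hyn)
    apply hgx
    have : fderiv ℝ u x = 0 := by
      rw [Filter.EventuallyEq.fderiv_eq (f₁ := u) (f := fun _ => (0:ℝ)) ev]; simp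
    simp [grad, this]
  have hE : En k Ω u u = 0 := by
    apply setIntegral_eq_zero_of_forall_eq_zero
    intro x hx
    rw [hg' x hx]; simp [KHform]
  have hP : ∫ x in Ω, pPart (u x - q x * log (1 / ε)) ^ (p + 1) = 0 := by
    apply setIntegral_eq_zero_of_forall_eq_zero
    intro x hx
    rw [pPart, max_eq_right (hle x hx), Real.zero_rpow (by linarith)]
  rw [Ieps_eq, hE, hP] at hI
  have := ceps_pos C h0 h1 hne
  linarith
end
end

section

lemma exists_S {p a X : ℝ} (hp : 1 < p) (ha : 0 < a) (hX : 0 ≤ X) :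
    ∃ S : ℝ, 1 ≤ S ∧ (1 / 2) * (X + S ^ 2 * a) < S ^ (p + 1) / (p + 1) * (a / 2) := by
  have ht := tendsto_rpow_atTop (show 0 < p - 1 by linarith)
  obtain ⟨S, hS1, hS2⟩ := ((ht.eventually_ge_atTop ((p + 1) * (X + a) / a + 1)).and
    (eventually_ge_atTop 1)).exists
  refine ⟨S, hS2, ?_⟩
  have hS0 : 0 < S := by linarith
  have e : S ^ (p + 1) = S ^ 2 * S ^ (p - 1) := by
    rw [← Real.rpow_natCast, ← Real.rpow_add hS0]; congr 1; push_cast; ring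
  rw [e]
  have h2 : S ^ 2 * ((p + 1) * (X + a) / a + 1) ≤ S ^ 2 * S ^ (p - 1) :=
    mul_le_mul_of_nonneg_left hS1 (by positivity)
  have h3 : S ^ 2 * ((p + 1) * (X + a) / a + 1) / (p + 1) * (a / 2)
      ≤ S ^ 2 * S ^ (p - 1) / (p + 1) * (a / 2) := by gcongr
  refine lt_of_lt_of_le ?_ h3
  have : S ^ 2 * ((p + 1) * (X + a) / a + 1) / (p + 1) * (a / 2)
    = S ^ 2 * (X + a) / 2 + S ^ 2 * a / (2 * (p + 1)) := by field_simp
  rw [this]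
  have h4 : 0 < S ^ 2 * a / (2 * (p + 1)) := by positivity
  have h5 : X ≤ S ^ 2 * X := le_mul_of_one_le_left hX (one_le_pow₀ hS2)
  nlinarith

lemma sq_rpow_ineq {p s : ℝ} (hp : 1 < p) (hs : 0 ≤ s) :
    s ^ 2 / 2 - s ^ (p + 1) / (p + 1) ≤ 1 / 2 - 1 / (p + 1) := by
  have := one_add_mul_self_le_rpow_one_add (s := s ^ 2 - 1) (by nlinarith [sq_nonneg s])
    (p := (p + 1) / 2) (by linarith)
  have e : (1 + (s ^ 2 - 1)) ^ ((p + 1) / 2) = s ^ (p + 1) := by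
    rw [show 1 + (s ^ 2 - 1) = s ^ (2:ℝ) by norm_num, ← Real.rpow_mul hs]; congr 1; ring
  rw [e] at this
  have h2 : (1 + (p + 1) / 2 * (s ^ 2 - 1)) / (p + 1) ≤ s ^ (p + 1) / (p + 1) := by
    gcongr
  have h3 : (1 + (p + 1) / 2 * (s ^ 2 - 1)) / (p + 1) = 1 / (p + 1) + (s ^ 2 - 1) / 2 := by
    field_simp
  rw [h3] at h2
  linarith

section
variable {k p ε : ℝ} {Ω : Set (ℝ × ℝ)} {q u : ℝ × ℝ → ℝ}

lemma core_open (C : Ctx k p Ω q) (hu : ContinuousOn u (closure Ω)) : IsOpen (vcore q Ω ε u) := by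
  have : vcore q Ω ε u = Ω ∩ vv q ε u ⁻¹' Ioi 0 := by
    ext x; simp only [vcore, vv, mem_ofPred_eq, mem_inter_iff, mem_preimage, mem_Ioi, sub_pos]
  rw [this]
  exact ((C.vcont hu).mono subset_closure).isOpen_inter_preimage C.ho isOpen_Ioi

lemma Ieps_le_half (hp : 1 < p) (W : ℝ × ℝ → ℝ) :
    Ieps k p ε q Ω W ≤ (1 / 2) * En k Ω W W := by
  rw [Ieps_eq]
  have : 0 ≤ (1 / ((p + 1) * ε ^ 2)) * ∫ x in Ω, pPart (W x - q x * Real.log (1 / ε)) ^ (p + 1) := by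
    apply mul_nonneg (by positivity)
    exact integral_nonneg fun x => Real.rpow_nonneg (pPart_nonneg _) _
  linarith

/-- two-bump competitor energies -/
lemma two_bump (C : Ctx k p Ω q) (h0 : 0 < ε) (h1 : ε < 1) (hu : IsSolution k p ε q Ω u)
    (hm : MemH k Ω u) {O O' : Set (ℝ × ℝ)} (hO : IsOpen O) (hO' : IsOpen O') (hd : Disjoint O O')
    (hcov : ∀ x ∈ Ω, 0 < u x - q x * log (1 / ε) → x ∈ O ∪ O') {δ : ℝ} (hδ : 0 < δ) (s : ℝ) :
    MemH k Ω (fun y => 1 * (1 * u y + (-1) * tr Ω O' δ (vv q ε u) y) + s * tr Ω O δ (vv q ε u) y) ∧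
    En k Ω (fun y => 1 * (1 * u y + (-1) * tr Ω O' δ (vv q ε u) y) + s * tr Ω O δ (vv q ε u) y)
      (fun y => 1 * (1 * u y + (-1) * tr Ω O' δ (vv q ε u) y) + s * tr Ω O δ (vv q ε u) y)
    ≤ En k Ω u u - JJ p Ω q ε u O' δ + (2 * s + s ^ 2) * JJ p Ω q ε u O δ := by
  obtain ⟨T1, e1, E1⟩ := test_core C.hk C.ho C.hb hO hO' hd hδ h0 h1 C.hq1 C.hqc C.hq3 C.hq4 hu hcov
  obtain ⟨T2, e2, E2⟩ := test_core C.hk C.ho C.hb hO' hO hd.symm hδ h0 h1 C.hq1 C.hqc C.hq3 C.hq4 hu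
    (by intro x hx h; rw [union_comm]; exact hcov x hx h)
  change En k Ω u (tr Ω O δ (vv q ε u)) = JJ p Ω q ε u O δ at e1
  change En k Ω u (tr Ω O' δ (vv q ε u)) = JJ p Ω q ε u O' δ at e2
  change En k Ω (tr Ω O δ (vv q ε u)) (tr Ω O δ (vv q ε u)) ≤ JJ p Ω q ε u O δ at E1
  change En k Ω (tr Ω O' δ (vv q ε u)) (tr Ω O' δ (vv q ε u)) ≤ JJ p Ω q ε u O' δ at E2
  change TF Ω (tr Ω O δ (vv q ε u)) at T1
  change TF Ω (tr Ω O' δ (vv q ε u)) at T2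
  set φ := tr Ω O δ (vv q ε u)
  set φ' := tr Ω O' δ (vv q ε u)
  obtain ⟨mX, eX⟩ := MemH.lin C.hk C.ho hm (T2.memH C.hk C.ho) 1 (-1)
  obtain ⟨mW, eW⟩ := MemH.lin C.hk C.ho mX (T1.memH C.hk C.ho) 1 s
  refine ⟨mW, ?_⟩
  rw [eW, eX]
  have v1 : ContDiffOn ℝ 1 (vv q ε u) Ω := hm.2.1.sub ((C.hq1.of_le (by norm_num)).mul contDiffOn_const)
  have c0 : En k Ω φ' φ = 0 := by
    apply setIntegral_eq_zero_of_forall_eq_zero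
    intro x hx
    by_cases hxO : x ∈ O
    · have : grad φ' x = 0 := tr_grad0 C.ho hO hd.symm hδ v1
        (by intro x hx h; rw [union_comm]; exact hcov x hx h) hx (fun h => (disjoint_left.1 hd) hxO h)
      rw [this]; simp [KHform]
    · have : grad φ x = 0 := tr_grad0 C.ho hO' hd hδ v1 hcov hx hxO
      rw [this]; simp [KHform]
  have c1 : En k Ω (fun y => 1 * u y + (-1) * φ' y) φ = JJ p Ω q ε u O δ := by
    have e : (fun y => 1 * u y + (-1) * φ' y) = fun y => u y - φ' y * 1 := by funext y; ring
    rw [e, En_lin_left C.hk C.ho hm.2.1 T2.1.contDiffOn T1 1, c0, e1]; ring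
  rw [c1, e2]
  nlinarith [mul_le_mul_of_nonneg_left E1 (sq_nonneg s)]

set_option maxHeartbeats 400000 in
lemma core_preconn (C : Ctx k p Ω q) (h0 : 0 < ε) (h1 : ε < 1) (hu : IsMPSolution k p ε q Ω u) :
    IsPreconnected (vcore q Ω ε u) := by
  have hp := C.hp
  obtain ⟨hs, hm, hI⟩ := hu
  have hAo := core_open (ε := ε) C hm.1
  set A := vcore q Ω ε u with hA
  intro B B' hB hB' hsub hne hne'
  by_contra hemp
  rw [not_nonempty_iff_eq_empty] at hemp
  set O := B ∩ A with hOdef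
  set O' := B' ∩ A with hO'def
  have hO : IsOpen O := hB.inter hAo
  have hO' : IsOpen O' := hB'.inter hAo
  have hd : Disjoint O O' := by
    rw [disjoint_left]
    rintro x ⟨hx1, hx2⟩ ⟨hx3, -⟩
    have : x ∈ A ∩ (B ∩ B') := ⟨hx2, hx1, hx3⟩
    rw [hemp] at this; exact this
  have hcov : ∀ x ∈ Ω, 0 < u x - q x * log (1 / ε) → x ∈ O ∪ O' := by
    intro x hx h
    have hxA : x ∈ A := ⟨hx, by linarith⟩
    rcases hsub hxA with h | h
    · exact Or.inl ⟨h, hxA⟩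
    · exact Or.inr ⟨h, hxA⟩
  have a1pos : 0 < aO p Ω q ε u O := by
    obtain ⟨x, hx, hxB⟩ := hne
    exact aO_pos C h0 hm.1 hO ⟨x, hx.1, ⟨hxB, hx⟩, by have := hx.2; simp only [vv]; linarith⟩
  have a2pos : 0 < aO p Ω q ε u O' := by
    obtain ⟨x, hx, hxB⟩ := hne'
    exact aO_pos C h0 hm.1 hO' ⟨x, hx.1, ⟨hxB, hx⟩, by have := hx.2; simp only [vv]; linarith⟩
  have hIu : Ieps k p ε q Ω u = (1 / 2) * En k Ω u u
      - (1 / (p + 1)) * (aO p Ω q ε u O + aO p Ω q ε u O') := by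
    rw [Ieps_eq]
    have : (1 / ((p + 1) * ε ^ 2)) * ∫ x in Ω, pPart (u x - q x * Real.log (1 / ε)) ^ (p + 1)
      = (1 / (p + 1)) * (aO p Ω q ε u O + aO p Ω q ε u O') := by
      unfold aO
      rw [← mul_add, ← integral_add ((C.int_pow hm.1 (by linarith)).indicator hO.measurableSet)
        ((C.int_pow hm.1 (by linarith)).indicator hO'.measurableSet), ← mul_assoc]
      congr 1
      · field_simp
      · apply setIntegral_congr_fun C.ho.measurableSet
        intro x hx
        rw [← Set.indicator_union_of_disjoint hd]
        by_cases hxx : x ∈ O ∪ O'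
        · simp only [indicator_of_mem hxx]
        · simp only [indicator_of_notMem hxx]
          have : u x - q x * log (1 / ε) ≤ 0 := by
            by_contra h; exact hxx (hcov x hx (by linarith))
          rw [pPart, max_eq_right this, Real.zero_rpow (by linarith)]
    rw [this]
  set a1 := aO p Ω q ε u O
  set a2 := aO p Ω q ε u O'
  set b := bb p Ω q ε u with hbdef
  have hb0 : 0 ≤ b := bb_nonneg _ _ _ _ _
  have hX := En_nonneg k Ω u
  set X := En k Ω u u
  obtain ⟨S, hS1, hS2⟩ := exists_S hp a1pos hX
  have hSp : 0 < S ^ (p + 1) := Real.rpow_pos_of_pos (by linarith) _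
  -- gap
  have hgap : 0 < a2 * (1 / 2 - 1 / (p + 1)) := by
    apply mul_pos a2pos
    rw [sub_pos]
    exact one_div_lt_one_div_of_lt (by norm_num) (by linarith)
  set gap := a2 * (1 / 2 - 1 / (p + 1)) with hgapdef
  -- choice of δ
  obtain ⟨δ, hδ, hδ1, hδ2⟩ : ∃ δ > 0, 2 * (p + 1) * δ * b ≤ a1 / 2 ∧
      2 * δ * b + 2 * (p + 1) * δ * b * S ^ (p + 1) / (p + 1) < gap := by
    have t1 : Tendsto (fun δ : ℝ => 2 * (p + 1) * δ * b) (𝓝 0) (𝓝 0) := by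
      have : Continuous (fun δ : ℝ => 2 * (p + 1) * δ * b) := by fun_prop
      simpa using this.tendsto 0
    have t2 : Tendsto (fun δ : ℝ => 2 * δ * b + 2 * (p + 1) * δ * b * S ^ (p + 1) / (p + 1))
        (𝓝 0) (𝓝 0) := by
      have : Continuous (fun δ : ℝ => 2 * δ * b + 2 * (p + 1) * δ * b * S ^ (p + 1) / (p + 1)) := by
        fun_prop
      simpa using this.tendsto 0
    have ev := (((t1.eventually_le_const (by positivity : 0 < a1 / 2)).and
      (t2.eventually_lt_const hgap)).filter_mono
      (nhdsWithin_le_nhds (s := Ioi (0:ℝ)))).and self_mem_nhdsWithin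
    obtain ⟨δ, ⟨h1, h2⟩, h3⟩ := ev.exists
    exact ⟨δ, h3, h1, h2⟩
  have TB := fun s => two_bump C h0 h1 hs hm hO hO' hd hcov hδ s
  have T1 : TF Ω (tr Ω O δ (vv q ε u)) :=
    (test_core C.hk C.ho C.hb hO hO' hd hδ h0 h1 C.hq1 C.hqc C.hq3 C.hq4 hs hcov).1
  have T2 : TF Ω (tr Ω O' δ (vv q ε u)) := (test_core C.hk C.ho C.hb hO' hO hd.symm hδ h0 h1 C.hq1
    C.hqc C.hq3 C.hq4 hs (by intro x hx h; rw [union_comm]; exact hcov x hx h)).1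
  obtain ⟨J1u, J1l, P1l⟩ := J_bounds (ε := ε) C hm.1 hO hδ T1
  obtain ⟨J2u, J2l, -⟩ := J_bounds (ε := ε) C hm.1 hO' hδ T2
  set φ := tr Ω O δ (vv q ε u) with hφ
  set φ' := tr Ω O' δ (vv q ε u) with hφ'
  set J1 := JJ p Ω q ε u O δ
  set J2 := JJ p Ω q ε u O' δ
  set P1 := (1 / ε ^ 2) * ∫ x in Ω, φ x ^ (p + 1) with hP1
  change J1 ≤ a1 at J1u
  change a1 - 2 * δ * b ≤ J1 at J1l
  change J2 ≤ a2 at J2u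
  change a2 - 2 * δ * b ≤ J2 at J2l
  change a1 - 2 * (p + 1) * δ * b ≤ P1 at P1l
  set W1 := (fun y => 1 * (1 * u y + (-1) * φ' y) + (-1) * φ y) with hW1
  have mW1 : MemH k Ω W1 := (TB (-1)).1
  have eW1 : En k Ω W1 W1 ≤ X - J2 - J1 := by
    have := (TB (-1)).2; linarith
  have mφ := T1.memH C.hk C.ho
  have J1nn : 0 ≤ J1 := by
    apply mul_nonneg (by positivity)
    exact integral_nonneg fun x => mul_nonneg (Real.rpow_nonneg (pPart_nonneg _) _) (tr_nonneg hδ _ _)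
  have J2nn : 0 ≤ J2 := by
    apply mul_nonneg (by positivity)
    exact integral_nonneg fun x => mul_nonneg (Real.rpow_nonneg (pPart_nonneg _) _) (tr_nonneg hδ _ _)
  -- energy of second leg
  have leg2 : ∀ σ, 0 ≤ σ → Ieps k p ε q Ω (fun y => 1 * W1 y + σ * φ y) ≤
      (1 / 2) * (X - J2 + (σ ^ 2 - 1) * J1) - σ ^ (p + 1) / (p + 1) * P1 := by
    intro σ hσ
    have e : (fun y => 1 * W1 y + σ * φ y)
        = fun y => 1 * (1 * u y + (-1) * φ' y) + (σ - 1) * φ y := by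
      funext y; simp only [hW1]; ring
    rw [e, Ieps_eq]
    have h1 := (TB (σ - 1)).2
    change _ ≤ X - J2 + (2 * (σ - 1) + (σ - 1) ^ 2) * J1 at h1
    have m1 := (TB (σ - 1)).1
    have h2 : σ ^ (p + 1) / (p + 1) * P1 ≤ (1 / ((p + 1) * ε ^ 2)) * ∫ x in Ω,
        pPart ((1 * (1 * u x + (-1) * φ' x) + (σ - 1) * φ x) - q x * Real.log (1 / ε)) ^ (p + 1) := by
      have e2 : σ ^ (p + 1) / (p + 1) * P1 = (1 / ((p + 1) * ε ^ 2)) * ∫ x in Ω,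
          (σ * φ x) ^ (p + 1) := by
        have : (fun x => (σ * φ x) ^ (p + 1)) = fun x => σ ^ (p + 1) * φ x ^ (p + 1) := by
          funext x; exact Real.mul_rpow hσ (tr_nonneg hδ _ _)
        rw [this, integral_const_mul, hP1]; field_simp
      rw [e2]
      apply mul_le_mul_of_nonneg_left _ (by positivity)
      have mc := m1.1.sub (C.hqc.mul (continuousOn_const (c := Real.log (1 / ε))))
      apply setIntegral_mono_on
      · exact cont_int C.ho C.hb ((continuousOn_const.mul mφ.1).rpow_const
          fun _ _ => Or.inr (by linarith))
      · exact cont_int C.ho C.hb (pPart_cont mc (by linarith))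
      · exact C.ho.measurableSet
      intro x hx
      apply Real.rpow_le_rpow (mul_nonneg hσ (tr_nonneg hδ _ _)) _ (by linarith)
      by_cases hxO : x ∈ O
      · have z : φ' x = 0 := indicator_of_notMem (fun h => (disjoint_left.1 hd) hxO h.2) _
        refine le_trans ?_ (le_max_left _ _)
        have h3 : φ x ≤ pPart (vv q ε u x) := tr_le hδ _ _
        have h4 : pPart (vv q ε u x) = u x - q x * log (1 / ε) :=
          max_eq_left (by have := hxO.2.2; linarith)
        rw [h4] at h3
        rw [z]; linarith
      · have z : φ x = 0 := indicator_of_notMem (fun h => hxO h.2) _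
        refine le_trans (le_of_eq ?_) (pPart_nonneg _)
        change σ * φ x = 0
        rw [z, mul_zero]
    have h3 : (2 * (σ - 1) + (σ - 1) ^ 2) = σ ^ 2 - 1 := by ring
    rw [h3] at h1
    beta_reduce
    beta_reduce at h1 h2
    linarith
  have hp1 : 0 < p + 1 := by linarith
  have hex : ∃ c ∈ PathSet k p q Ω ε, c ≤ Ieps k p ε q Ω u -
      (gap - (2 * δ * b + 2 * (p + 1) * δ * b * S ^ (p + 1) / (p + 1))) := by
    refine exists_path (S := S) C.hk C.ho mW1 mφ (by linarith) ?_ ?_ ?_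
    · intro a ha
      refine (Ieps_le_half hp _).trans ?_
      rw [(MemH.lin C.hk C.ho mW1 mφ a 0).2]
      have hE1 := En_nonneg k Ω W1
      have ha2 : a ^ 2 ≤ 1 := by nlinarith [ha.1, ha.2]
      have hq : 0 ≤ 2 * (p + 1) * δ * b * S ^ (p + 1) / (p + 1) := by positivity
      have hf : 1 / (p + 1) < 1 / 2 := one_div_lt_one_div_of_lt (by norm_num) (by linarith)
      rw [hIu, hgapdef]
      nlinarith [mul_pos a1pos (sub_pos.2 hf)]
    · intro σ hσ
      refine (leg2 σ hσ.1).trans ?_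
      rw [hIu, hgapdef]
      have y1 := sq_rpow_ineq hp hσ.1
      have hσp : σ ^ (p + 1) ≤ S ^ (p + 1) := Real.rpow_le_rpow hσ.1 hσ.2 (by linarith)
      have hσ0 := Real.rpow_nonneg hσ.1 (p + 1)
      set τ := σ ^ (p + 1) / (p + 1) with hτ
      have hτ0 : 0 ≤ τ := by positivity
      have hτS : τ ≤ S ^ (p + 1) / (p + 1) := by rw [hτ]; gcongr
      set κ := 2 * (p + 1) * δ * b with hκ
      have hκ0 : 0 ≤ κ := by positivity
      have A1 : τ * (a1 - κ) ≤ τ * P1 := mul_le_mul_of_nonneg_left P1l hτ0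
      have A2 : τ * κ ≤ κ * S ^ (p + 1) / (p + 1) := by
        have := mul_le_mul_of_nonneg_right hτS hκ0
        calc τ * κ ≤ S ^ (p + 1) / (p + 1) * κ := this
          _ = _ := by ring
      have A3 : a1 * (σ ^ 2 / 2 - τ) ≤ a1 * (1 / 2 - 1 / (p + 1)) := mul_le_mul_of_nonneg_left y1 a1pos.le
      have A4 : σ ^ 2 * J1 ≤ σ ^ 2 * a1 := mul_le_mul_of_nonneg_left J1u (sq_nonneg _)
      linarith
    · refine lt_of_le_of_lt (leg2 S (by linarith)) ?_
      have A1 : S ^ (p + 1) / (p + 1) * (a1 / 2) ≤ S ^ (p + 1) / (p + 1) * P1 :=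
        mul_le_mul_of_nonneg_left (by linarith) (by positivity)
      have A4 : S ^ 2 * J1 ≤ S ^ 2 * a1 := mul_le_mul_of_nonneg_left J1u (sq_nonneg _)
      linarith
  obtain ⟨c, hc, hcB⟩ := hex
  have := ceps_le C h0 h1 hc hcB
  linarith
end
end

section

lemma dist_le_dE (a b : ℝ × ℝ) : dist a b ≤ dE a b := by
  rw [Prod.dist_eq, Real.dist_eq, Real.dist_eq]
  unfold dE
  apply max_le
  · rw [← Real.sqrt_sq_eq_abs]; apply Real.sqrt_le_sqrt; nlinarith [sq_nonneg (a.2 - b.2)]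
  · rw [← Real.sqrt_sq_eq_abs]; apply Real.sqrt_le_sqrt; nlinarith [sq_nonneg (a.1 - b.1)]

lemma dE_le_dist (a b : ℝ × ℝ) : dE a b ≤ 2 * dist a b := by
  have h1 : |a.1 - b.1| ≤ dist a b := by rw [Prod.dist_eq, ← Real.dist_eq]; exact le_max_left _ _
  have h2 : |a.2 - b.2| ≤ dist a b := by rw [Prod.dist_eq, ← Real.dist_eq (a.2)]; exact le_max_right _ _
  unfold dE
  rw [Real.sqrt_le_left (by positivity)]
  nlinarith [sq_abs (a.1 - b.1), sq_abs (a.2 - b.2), abs_nonneg (a.1 - b.1), abs_nonneg (a.2 - b.2)]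

lemma dE_nonneg (a b : ℝ × ℝ) : 0 ≤ dE a b := Real.sqrt_nonneg _

lemma dE_bdd {A : Set (ℝ × ℝ)} (hb : Bornology.IsBounded A) :
    BddAbove {d | ∃ a ∈ A, ∃ b ∈ A, d = dE a b} := by
  refine ⟨2 * Metric.diam A, ?_⟩
  rintro d ⟨a, ha, b, hb', rfl⟩
  exact (dE_le_dist a b).trans (by have := Metric.dist_le_diam_of_mem hb ha hb'; linarith)

lemma dE_le_diamE {A : Set (ℝ × ℝ)} (hb : Bornology.IsBounded A) {a b : ℝ × ℝ} (ha : a ∈ A)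
    (hb' : b ∈ A) : dE a b ≤ diamE A := le_csSup (dE_bdd hb) ⟨a, ha, b, hb', rfl⟩

lemma diamE_nonneg (A : Set (ℝ × ℝ)) : 0 ≤ diamE A := by
  apply Real.sSup_nonneg
  rintro d ⟨a, _, b, _, rfl⟩
  exact dE_nonneg a b

lemma vol_le_diamE {A : Set (ℝ × ℝ)} (hb : Bornology.IsBounded A) (hne : A.Nonempty) :
    volume.real A ≤ 4 * diamE A ^ 2 := by
  obtain ⟨x, hx⟩ := hne
  set d := diamE A
  have hd : 0 ≤ d := diamE_nonneg A
  have hsub : A ⊆ Icc (x.1 - d) (x.1 + d) ×ˢ Icc (x.2 - d) (x.2 + d) := by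
    intro y hy
    have h := (dist_le_dE y x).trans (dE_le_diamE hb hy hx)
    rw [Prod.dist_eq, max_le_iff, Real.dist_eq, Real.dist_eq, abs_le, abs_le] at h
    refine ⟨⟨?_, ?_⟩, ?_, ?_⟩ <;> linarith [h.1.1, h.1.2, h.2.1, h.2.2]
  have hv : volume (Icc (x.1 - d) (x.1 + d) ×ˢ Icc (x.2 - d) (x.2 + d)) = ENNReal.ofReal (4 * d ^ 2) := by
    rw [Measure.volume_eq_prod, Measure.prod_prod, Real.volume_Icc, Real.volume_Icc,
      ← ENNReal.ofReal_mul (by linarith)]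
    congr 1; ring
  have := measure_mono (μ := volume) hsub
  rw [hv] at this
  have h2 := ENNReal.toReal_mono ENNReal.ofReal_ne_top this
  rwa [ENNReal.toReal_ofReal (by positivity)] at h2

section
variable {k p ε : ℝ} {Ω : Set (ℝ × ℝ)} {q u : ℝ × ℝ → ℝ}

lemma aO_univ (hp : 1 < p) : Ieps k p ε q Ω u = (1 / 2) * En k Ω u u - (1 / (p + 1)) * aO p Ω q ε u univ := by
  rw [Ieps_eq]
  unfold aO
  simp only [indicator_univ]
  have : p + 1 ≠ 0 := by linarith
  field_simp

lemma exists_w (C : Ctx k p Ω q) (h0 : 0 < ε) (h1 : ε < 1) (hu : IsMPSolution k p ε q Ω u)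
    (hne : (vcore q Ω ε u).Nonempty) :
    ∃ w, MemH k Ω w ∧ En k Ω w w ≤ 2 * ceps k p q Ω ε ∧
      ∀ x ∈ vcore q Ω ε u, q x * log (1 / ε) ≤ w x := by
  obtain ⟨hs, hm, hI⟩ := hu
  have hp := C.hp
  have hL := log_inv_pos h0 h1
  have apos : 0 < aO p Ω q ε u univ := by
    obtain ⟨x, hx⟩ := hne
    exact aO_pos C h0 hm.1 isOpen_univ ⟨x, hx.1, mem_univ x, by have := hx.2; simp only [vv]; linarith⟩
  have hb0 := bb_nonneg p Ω q ε u
  rw [aO_univ hp] at hI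
  set a := aO p Ω q ε u univ
  set b := bb p Ω q ε u
  have hf : 1 / (p + 1) < 1 / 2 := one_div_lt_one_div_of_lt (by norm_num) (by linarith)
  obtain ⟨δ, hδ, hδb⟩ : ∃ δ > 0, 2 * δ * b ≤ a * (1 - 2 * (1 / (p + 1))) := by
    have hr : 0 < a * (1 - 2 * (1 / (p + 1))) := mul_pos apos (by linarith)
    refine ⟨a * (1 - 2 * (1 / (p + 1))) / (2 * (b + 1)), by positivity, ?_⟩
    have : 2 * (a * (1 - 2 * (1 / (p + 1))) / (2 * (b + 1))) * b
      = a * (1 - 2 * (1 / (p + 1))) * (b / (b + 1)) := by field_simp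
    rw [this]
    exact mul_le_of_le_one_right hr.le (by rw [div_le_one (by linarith)]; linarith)
  obtain ⟨mw, ew⟩ := two_bump C h0 h1 hs hm isOpen_univ isOpen_empty (by simp) (by simp) hδ (-1)
  have T1 : TF Ω (tr Ω univ δ (vv q ε u)) := (test_core C.hk C.ho C.hb isOpen_univ isOpen_empty
    (by simp) hδ h0 h1 C.hq1 C.hqc C.hq3 C.hq4 hs (by simp)).1
  obtain ⟨-, Jl, -⟩ := J_bounds (ε := ε) C hm.1 isOpen_univ hδ T1
  refine ⟨_, mw, ?_, ?_⟩
  · have J0 : 0 ≤ JJ p Ω q ε u ∅ δ := by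
      apply mul_nonneg (by positivity)
      exact integral_nonneg fun x => mul_nonneg (Real.rpow_nonneg (pPart_nonneg _) _) (tr_nonneg hδ _ _)
    change a - 2 * δ * b ≤ _ at Jl
    linarith
  · intro x hx
    have z : tr Ω ∅ δ (vv q ε u) x = 0 := by simp [tr]
    have h3 : tr Ω univ δ (vv q ε u) x ≤ pPart (vv q ε u x) := tr_le hδ _ _
    have h4 : pPart (vv q ε u x) = u x - q x * log (1 / ε) :=
      max_eq_left (by have := hx.2; linarith)
    rw [h4] at h3
    rw [z]; linarith

lemma bb_bound (C : Ctx k p Ω q) {m : ℝ} (hm0 : 0 < m) (hmq : ∀ x ∈ closure Ω, m ≤ q x)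
    (h0 : 0 < ε) (h1 : ε < 1) (hu : IsMPSolution k p ε q Ω u) :
    log (1 / ε) * m / (2 * (p + 1)) * bb p Ω q ε u ≤ ceps k p q Ω ε := by
  obtain ⟨⟨uc, u2, uf, ueq⟩, hm, hI⟩ := hu
  have hp := C.hp
  have hL := log_inv_pos h0 h1
  have u1 : ContDiffOn ℝ 1 u Ω := hm.2.1
  set L := log (1 / ε) with hLdef
  set δ := L * m / 4 with hδd
  have hδ : 0 < δ := by positivity
  have hT : TF Ω (tr Ω univ δ u) := tr_univ_TF C hδ uc u1 (fun y hy => by rw [uf y hy]; exact hδ)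
  have e1 : En k Ω u (tr Ω univ δ u) = (1 / ε ^ 2) * ∫ x in Ω, pPart (vv q ε u x) ^ p * tr Ω univ δ u x := by
    rw [weak_form C.hk C.ho u2 hT, ← integral_const_mul]
    apply setIntegral_congr_fun C.ho.measurableSet
    intro x hx
    simp only [ueq x hx]; rw [mul_assoc]
  have e2 : En k Ω u (tr Ω univ δ u) ≤ En k Ω u u := by
    apply setIntegral_mono_on (hT.int_cross C.hk C.ho u1) hm.2.2.2 C.ho.measurableSet
    intro x hx
    rw [tr_univ_grad C hδ u1 hx]
    have : KHform k x (grad u x) (dphi δ (u x) • grad u x)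
      = dphi δ (u x) * KHform k x (grad u x) (grad u x) := by simp [KHform]; ring
    rw [this]
    exact mul_le_of_le_one_left (KHform_nonneg _ _ _) (dphi_le hδ _)
  have i1 : IntegrableOn (fun x => pPart (vv q ε u x) ^ p) Ω := C.int_pow hm.1 (by linarith)
  have i2 : IntegrableOn (fun x => pPart (vv q ε u x) ^ (p + 1)) Ω := C.int_pow hm.1 (by linarith)
  have i3 : IntegrableOn (fun x => pPart (vv q ε u x) ^ p * tr Ω univ δ u x) Ω :=
    cont_int C.ho C.hb ((pPart_cont (C.vcont hm.1) (by linarith)).mul hT.1.continuous.continuousOn)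
  have e3 : aO p Ω q ε u univ + L * m / 2 * bb p Ω q ε u ≤ En k Ω u (tr Ω univ δ u) := by
    rw [e1]
    unfold aO bb
    simp only [indicator_univ]
    rw [mul_left_comm, ← mul_add, ← integral_const_mul, ← integral_add i2 (i1.const_mul _)]
    apply mul_le_mul_of_nonneg_left _ (by positivity)
    apply setIntegral_mono_on (i2.add (i1.const_mul _)) i3 C.ho.measurableSet
    intro x hx
    have hq := hmq x (subset_closure hx)
    rw [Pi.add_apply]
    rcases le_or_gt (vv q ε u x) 0 with h | h
    · have : pPart (vv q ε u x) = 0 := max_eq_right h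
      rw [this, Real.zero_rpow (by linarith), Real.zero_rpow (by linarith)]; simp
    · have : pPart (vv q ε u x) = vv q ε u x := max_eq_left h.le
      rw [this, Real.rpow_add_one h.ne']
      have hpp : 0 ≤ vv q ε u x ^ p := Real.rpow_nonneg h.le _
      have t : tr Ω univ δ u x = phi δ (u x) := indicator_of_mem (show x ∈ Ω ∩ univ from ⟨hx, mem_univ x⟩) _
      have t2 := le_phi hδ (u x)
      have t3 := le_max_left (u x) 0
      rw [t]
      have hvd : vv q ε u x = u x - q x * L := rfl
      have : vv q ε u x + L * m / 2 ≤ phi δ (u x) := by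
        rw [hvd]; nlinarith
      nlinarith
  rw [aO_univ hp] at hI
  rw [← hI]
  have hb0 := bb_nonneg p Ω q ε u
  have hf : 1 / (p + 1) < 1 / 2 := one_div_lt_one_div_of_lt (by norm_num) (by linarith)
  have hX := En_nonneg k Ω u
  have e4 : L * m / (2 * (p + 1)) * bb p Ω q ε u = (1 / (p + 1)) * (L * m / 2 * bb p Ω q ε u) := by
    field_simp
  rw [e4]
  have h5 : (1 / (p + 1)) * (aO p Ω q ε u univ + L * m / 2 * bb p Ω q ε u) ≤ (1 / (p + 1)) * En k Ω u u :=
    mul_le_mul_of_nonneg_left (e3.trans e2) (by positivity)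
  nlinarith

lemma core_bdd (C : Ctx k p Ω q) : Bornology.IsBounded (vcore q Ω ε u) :=
  C.hb.subset fun _ hx => hx.1

lemma diam_lower (C : Ctx k p Ω q) {C0 : ℝ} (hC0 : 0 < C0) : ∃ C1 > 0, ∀ ε u, 0 < ε → ε < 1 →
    IsMPSolution k p ε q Ω u → (vcore q Ω ε u).Nonempty → ceps k p q Ω ε ≤ C0 * log (1 / ε) →
    C1 * ε ≤ diamE (vcore q Ω ε u) := by
  obtain ⟨Cs, hCs, HS⟩ := sobolev C.hk C.hp C.ho C.hb
  obtain ⟨m, hm0, hmq⟩ := exists_qmin C.hb C.hqc C.hq3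
  have hp := C.hp
  set C2 := 2 * (p + 1) * C0 / m with hC2
  have hC2p : 0 < C2 := by positivity
  set s := 2 * Cs * C2 with hs
  have hs0 : 0 < s := by positivity
  have hsp : 0 < s ^ (p - 1) := Real.rpow_pos_of_pos hs0 _
  refine ⟨(√(8 * Cs * s ^ (p - 1)))⁻¹, by positivity, ?_⟩
  intro ε u h0 h1 hu hne hce
  have hL := log_inv_pos h0 h1
  have hb := bb_bound C hm0 hmq h0 h1 hu
  have hbb : bb p Ω q ε u ≤ C2 := by
    have := hb.trans hce
    rw [hC2, le_div_iff₀ hm0]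
    have h3 : log (1 / ε) * (m / (2 * (p + 1)) * bb p Ω q ε u) ≤ log (1 / ε) * C0 := by
      calc _ = log (1 / ε) * m / (2 * (p + 1)) * bb p Ω q ε u := by ring
        _ ≤ _ := by linarith
    have h4 := le_of_mul_le_mul_left h3 hL
    have h5 : 2 * (p + 1) * (m / (2 * (p + 1)) * bb p Ω q ε u) = bb p Ω q ε u * m := by field_simp
    rw [← h5]; gcongr
  obtain ⟨hsol, hm, hI⟩ := hu
  have apos : 0 < aO p Ω q ε u univ := by
    obtain ⟨x, hx⟩ := hne
    exact aO_pos C h0 hm.1 isOpen_univ ⟨x, hx.1, mem_univ x, by have := hx.2; simp only [vv]; linarith⟩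
  have hb0 := bb_nonneg p Ω q ε u
  have i1 : IntegrableOn (fun x => pPart (vv q ε u x) ^ p) Ω := C.int_pow hm.1 (by linarith)
  have i0 : IntegrableOn (fun x => pPart (vv q ε u x) ^ (p - 1)) Ω := C.int_pow hm.1 (by linarith)
  set a := aO p Ω q ε u univ
  set V := ∫ x in Ω, pPart (vv q ε u x) ^ (p - 1) with hV
  have key : ∀ δ, 0 < δ → ε ^ 2 * (a - 2 * (p + 1) * δ * bb p Ω q ε u) ≤ Cs * a * V := by
    intro δ hδ
    obtain ⟨T1, -, E1⟩ := test_core C.hk C.ho C.hb isOpen_univ isOpen_empty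
      (by simp) hδ h0 h1 C.hq1 C.hqc C.hq3 C.hq4 hsol (by simp)
    obtain ⟨Ju, -, Pl⟩ := J_bounds (ε := ε) C hm.1 isOpen_univ hδ T1
    change En k Ω (tr Ω univ δ (vv q ε u)) (tr Ω univ δ (vv q ε u)) ≤ JJ p Ω q ε u univ δ at E1
    have S := HS (tr Ω univ δ (vv q ε u)) (tsupport (tr Ω univ δ (vv q ε u)))
      T1.1.continuous.continuousOn T1.1.contDiffOn T1.2.1 T1.2.2
      (fun x _ hx => (image_eq_zero_of_notMem_tsupport hx).le) (T1.memH C.hk C.ho).2.2.2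
    have ep : ∀ x, pPart (tr Ω univ δ (vv q ε u) x) = tr Ω univ δ (vv q ε u) x :=
      fun x => max_eq_left (tr_nonneg hδ _ _)
    simp only [ep] at S
    have hV2 : ∫ x in Ω, tr Ω univ δ (vv q ε u) x ^ (p - 1) ≤ V := by
      apply setIntegral_mono_on _ i0 C.ho.measurableSet
      · intro x _
        exact Real.rpow_le_rpow (tr_nonneg hδ _ _) (tr_le hδ _ _) (by linarith)
      · exact cont_int C.ho C.hb (T1.1.continuous.continuousOn.rpow_const
          fun _ _ => Or.inr (by linarith))
    have hV0 : 0 ≤ ∫ x in Ω, tr Ω univ δ (vv q ε u) x ^ (p - 1) :=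
      integral_nonneg fun x => Real.rpow_nonneg (tr_nonneg hδ _ _) _
    have hEa := E1.trans Ju
    change _ ≤ a at hEa
    have Pl' : ε ^ 2 * (a - 2 * (p + 1) * δ * bb p Ω q ε u) ≤
        ∫ x in Ω, tr Ω univ δ (vv q ε u) x ^ (p + 1) := by
      have := mul_le_mul_of_nonneg_left Pl (sq_nonneg ε)
      rw [← mul_assoc, mul_one_div_cancel (by positivity), one_mul] at this
      exact this
    refine Pl'.trans (S.trans ?_)
    gcongr
  have key0 : ε ^ 2 * a ≤ Cs * a * V := by
    apply le_of_tendsto (f := fun δ => ε ^ 2 * (a - 2 * (p + 1) * δ * bb p Ω q ε u)) (x := 𝓝[>] 0) ?_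
      (by filter_upwards [self_mem_nhdsWithin] with δ hδ using key δ hδ)
    have : Continuous (fun δ : ℝ => ε ^ 2 * (a - 2 * (p + 1) * δ * bb p Ω q ε u)) := by fun_prop
    simpa using (this.tendsto 0).mono_left nhdsWithin_le_nhds
  have key1 : ε ^ 2 ≤ Cs * V := by
    apply le_of_mul_le_mul_right _ apos
    linarith
  have hAo := core_open (ε := ε) C hm.1
  have hfin : volume (vcore q Ω ε u) ≠ ⊤ := (core_bdd C).measure_lt_top.ne
  have hVle : V ≤ s⁻¹ * (ε ^ 2 * bb p Ω q ε u) + s ^ (p - 1) * volume.real (vcore q Ω ε u) := by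
    have iA : IntegrableOn (fun x => (vcore q Ω ε u).indicator (fun _ => s ^ (p - 1)) x) Ω :=
      (integrable_indicator_iff hAo.measurableSet).2 (integrableOn_const hfin) |>.integrableOn
    have e : ε ^ 2 * bb p Ω q ε u = ∫ x in Ω, pPart (vv q ε u x) ^ p := by
      unfold bb
      rw [← mul_assoc, mul_one_div_cancel (by positivity), one_mul]
    have e2 : s ^ (p - 1) * volume.real (vcore q Ω ε u)
        = ∫ x in Ω, (vcore q Ω ε u).indicator (fun _ => s ^ (p - 1)) x := by
      rw [setIntegral_indicator hAo.measurableSet, inter_eq_right.2 (fun x hx => hx.1),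
        setIntegral_const, smul_eq_mul, mul_comm]
    rw [e, e2, ← integral_const_mul, ← integral_add (i1.const_mul _) iA]
    apply setIntegral_mono_on i0 ((i1.const_mul _).add iA) C.ho.measurableSet
    intro x hx
    rw [Pi.add_apply]
    by_cases hxA : x ∈ vcore q Ω ε u
    · rw [indicator_of_mem hxA]
      exact young1 hp (pPart_nonneg _) hs0
    · rw [indicator_of_notMem hxA]
      have : pPart (vv q ε u x) = 0 := max_eq_right (by
        by_contra h; exact hxA ⟨hx, by simp only [vv] at h; linarith⟩)
      rw [this, Real.zero_rpow (by linarith), Real.zero_rpow (by linarith)]; simp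
  have hvol := vol_le_diamE (core_bdd C) hne
  set d := diamE (vcore q Ω ε u)
  have hd : 0 ≤ d := diamE_nonneg _
  have e5 : Cs * (s⁻¹ * (ε ^ 2 * bb p Ω q ε u)) ≤ ε ^ 2 / 2 := by
    calc Cs * (s⁻¹ * (ε ^ 2 * bb p Ω q ε u)) ≤ Cs * (s⁻¹ * (ε ^ 2 * C2)) := by gcongr
      _ = ε ^ 2 / 2 := by rw [hs]; field_simp
  have e6 : ε ^ 2 ≤ 8 * Cs * s ^ (p - 1) * d ^ 2 := by
    have : Cs * V ≤ Cs * (s⁻¹ * (ε ^ 2 * bb p Ω q ε u) + s ^ (p - 1) * (4 * d ^ 2)) := by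
      gcongr; exact hVle.trans (by gcongr)
    nlinarith
  rw [inv_mul_le_iff₀ (by positivity)]
  have := Real.sqrt_le_sqrt e6
  rwa [Real.sqrt_mul (by positivity), Real.sqrt_sq h0.le, Real.sqrt_sq hd] at this
end
end

section

def Ta (k : ℝ) (c : ℝ × ℝ) : ℝ := √((k ^ 2 + c.2 ^ 2) / (k ^ 2 + c.1 ^ 2 + c.2 ^ 2))
def Tg (k : ℝ) (c : ℝ × ℝ) : ℝ := √(detKH k c) / Ta k c
def Tb (k : ℝ) (c : ℝ × ℝ) : ℝ := (-(c.1 * c.2) / (k ^ 2 + c.1 ^ 2 + c.2 ^ 2)) / Ta k c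

/-- affine map normalising `K_H (c)` -/
def TT (k : ℝ) (c y : ℝ × ℝ) : ℝ × ℝ :=
  (c.1 + Ta k c * y.1, c.2 + (Tb k c * y.1 + Tg k c * y.2))
def Ti (k : ℝ) (c x : ℝ × ℝ) : ℝ × ℝ :=
  ((x.1 - c.1) / Ta k c, (x.2 - c.2 - Tb k c * ((x.1 - c.1) / Ta k c)) / Tg k c)
def n2 (y : ℝ × ℝ) : ℝ := y.1 ^ 2 + y.2 ^ 2

lemma detKH_pos {k : ℝ} (hk : 0 < k) (c : ℝ × ℝ) : 0 < detKH k c := by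
  unfold detKH; have := den_pos hk c; positivity

lemma detKH_le {k : ℝ} (hk : 0 < k) (c : ℝ × ℝ) : detKH k c ≤ 1 := by
  unfold detKH; rw [div_le_one (den_pos hk c)]; nlinarith [sq_nonneg c.1, sq_nonneg c.2]

lemma Ta_pos {k : ℝ} (hk : 0 < k) (c : ℝ × ℝ) : 0 < Ta k c := by
  unfold Ta
  apply Real.sqrt_pos.2
  have := den_pos hk c
  positivity

lemma Tg_pos {k : ℝ} (hk : 0 < k) (c : ℝ × ℝ) : 0 < Tg k c := by
  unfold Tg
  exact div_pos (Real.sqrt_pos.2 (detKH_pos hk c)) (Ta_pos hk c)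

lemma Ta_mul_Tg {k : ℝ} (hk : 0 < k) (c : ℝ × ℝ) : Ta k c * Tg k c = √(detKH k c) := by
  unfold Tg
  have := Ta_pos hk c
  field_simp

lemma Ta_sq {k : ℝ} (hk : 0 < k) (c : ℝ × ℝ) :
    Ta k c ^ 2 = (k ^ 2 + c.2 ^ 2) / (k ^ 2 + c.1 ^ 2 + c.2 ^ 2) := by
  unfold Ta
  rw [Real.sq_sqrt]
  have := den_pos hk c
  positivity

lemma Ta_mul_Tb {k : ℝ} (hk : 0 < k) (c : ℝ × ℝ) :
    Ta k c * Tb k c = -(c.1 * c.2) / (k ^ 2 + c.1 ^ 2 + c.2 ^ 2) := by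
  unfold Tb
  have := Ta_pos hk c
  field_simp

lemma Tbg_sq {k : ℝ} (hk : 0 < k) (c : ℝ × ℝ) :
    Tb k c ^ 2 + Tg k c ^ 2 = (k ^ 2 + c.1 ^ 2) / (k ^ 2 + c.1 ^ 2 + c.2 ^ 2) := by
  have h1 := Ta_sq hk c
  have h2 := Ta_mul_Tb hk c
  have h3 : (Ta k c * Tg k c) ^ 2 = detKH k c := by
    rw [Ta_mul_Tg hk, Real.sq_sqrt (detKH_pos hk c).le]
  have hA := Ta_pos hk c
  have hd := den_pos hk c
  have h4 : Ta k c ^ 2 * (Tb k c ^ 2 + Tg k c ^ 2) =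
      Ta k c ^ 2 * ((k ^ 2 + c.1 ^ 2) / (k ^ 2 + c.1 ^ 2 + c.2 ^ 2)) := by
    have : Ta k c ^ 2 * (Tb k c ^ 2 + Tg k c ^ 2) = (Ta k c * Tb k c) ^ 2 + (Ta k c * Tg k c) ^ 2 := by ring
    rw [this, h2, h3, h1]
    unfold detKH
    field_simp
    ring
  exact mul_left_cancel₀ (by positivity) h4

lemma KHform_T {k : ℝ} (hk : 0 < k) (c z : ℝ × ℝ) :
    KHform k c z z = (Ta k c * z.1 + Tb k c * z.2) ^ 2 + (Tg k c * z.2) ^ 2 := by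
  have h1 := Ta_sq hk c
  have h2 := Ta_mul_Tb hk c
  have h3 := Tbg_sq hk c
  have : (Ta k c * z.1 + Tb k c * z.2) ^ 2 + (Tg k c * z.2) ^ 2 =
    Ta k c ^ 2 * z.1 ^ 2 + 2 * (Ta k c * Tb k c) * z.1 * z.2 + (Tb k c ^ 2 + Tg k c ^ 2) * z.2 ^ 2 := by ring
  rw [this, h1, h2, h3]
  unfold KHform
  have hd := den_pos hk c
  field_simp
  ring

lemma TT_Ti {k : ℝ} (hk : 0 < k) (c x : ℝ × ℝ) : TT k c (Ti k c x) = x := by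
  have := Ta_pos hk c
  have := Tg_pos hk c
  unfold TT Ti
  ext
  · simp only; field_simp; ring
  · simp only; field_simp; ring

lemma Ti_TT {k : ℝ} (hk : 0 < k) (c y : ℝ × ℝ) : Ti k c (TT k c y) = y := by
  have := Ta_pos hk c
  have := Tg_pos hk c
  unfold TT Ti
  ext
  · simp only; field_simp; ring
  · simp only; field_simp; ring

lemma TT_dE {k : ℝ} (hk : 0 < k) (c y : ℝ × ℝ) : dE (TT k c y) c ≤ √(n2 y) := by
  have hz := KHform_le hk c (Ta k c * y.1, Tb k c * y.1 + Tg k c * y.2)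
  rw [KHform_T hk] at hz
  unfold dE
  apply Real.sqrt_le_sqrt
  unfold TT n2
  simp only at hz ⊢
  set a := Ta k c
  set b := Tb k c
  set g := Tg k c
  have e : (c.1 + a * y.1 - c.1) ^ 2 + (c.2 + (b * y.1 + g * y.2) - c.2) ^ 2 =
    (a * y.1) ^ 2 + (b * y.1 + g * y.2) ^ 2 := by ring
  rw [e]
  set z1 := a * y.1 with h1
  set z2 := b * y.1 + g * y.2 with h2
  set w1 := a * z1 + b * z2 with h3
  set w2 := g * z2 with h4
  have key : z1 ^ 2 + z2 ^ 2 = w1 * y.1 + w2 * y.2 := by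
    rw [h3, h4, h1, h2]; ring
  nlinarith [sq_nonneg (w1 - y.1), sq_nonneg (w2 - y.2)]

lemma n2_le {k : ℝ} (hk : 0 < k) (c y : ℝ × ℝ) : detKH k c * n2 y ≤ dE (TT k c y) c ^ 2 := by
  have hA := Ta_pos hk c
  have hG := Tg_pos hk c
  have hz := le_KHform hk c ((y.1 - Tb k c * (y.2 / Tg k c)) / Ta k c, y.2 / Tg k c)
  rw [KHform_T hk] at hz
  unfold dE
  rw [Real.sq_sqrt (by positivity)]
  unfold TT n2
  simp only at hz ⊢
  set a := Ta k c
  set b := Tb k c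
  set g := Tg k c
  have e : (c.1 + a * y.1 - c.1) ^ 2 + (c.2 + (b * y.1 + g * y.2) - c.2) ^ 2 =
    (a * y.1) ^ 2 + (b * y.1 + g * y.2) ^ 2 := by ring
  rw [e]
  set w2 := y.2 / g with h4
  set w1 := (y.1 - b * w2) / a with h3
  set z1 := a * y.1 with h1
  set z2 := b * y.1 + g * y.2 with h2
  have e1 : a * w1 + b * w2 = y.1 := by rw [h3]; field_simp; ring
  have e2 : g * w2 = y.2 := by rw [h4]; field_simp
  rw [e1, e2] at hz
  have key : y.1 ^ 2 + y.2 ^ 2 = w1 * z1 + w2 * z2 := by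
    have : w1 * z1 + w2 * z2 = (a * w1 + b * w2) * y.1 + (g * w2) * y.2 := by rw [h1, h2]; ring
    rw [this, e1, e2]; ring
  have hd := detKH_pos hk c
  set D := detKH k c
  nlinarith [sq_nonneg (D * w1 - z1), sq_nonneg (D * w2 - z2)]

/-- linear part of `TT` -/
def TTL (k : ℝ) (c : ℝ × ℝ) : ℝ × ℝ →L[ℝ] ℝ × ℝ :=
  (Matrix.toLin (.finTwoProd ℝ) (.finTwoProd ℝ) !![Ta k c, 0; Tb k c, Tg k c]).toContinuousLinearMap

lemma TTL_apply (k : ℝ) (c y : ℝ × ℝ) : TTL k c y = (Ta k c * y.1, Tb k c * y.1 + Tg k c * y.2) := by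
  unfold TTL
  rw [LinearMap.coe_toContinuousLinearMap', Matrix.toLin_finTwoProd_apply]
  simp

lemma TTL_det (k : ℝ) (c : ℝ × ℝ) : (TTL k c).det = Ta k c * Tg k c := by
  unfold TTL
  rw [LinearMap.det_toContinuousLinearMap, LinearMap.det_toLin, Matrix.det_fin_two_of]
  ring

lemma TT_eq (k : ℝ) (c : ℝ × ℝ) : TT k c = fun y => c + TTL k c y := by
  funext y; rw [TTL_apply]; rfl

lemma TT_hasFDerivAt (k : ℝ) (c y : ℝ × ℝ) : HasFDerivAt (TT k c) (TTL k c) y := by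
  rw [TT_eq]
  exact (TTL k c).hasFDerivAt.const_add c

lemma TT_contDiff (k : ℝ) (c : ℝ × ℝ) {n : WithTop ℕ∞} : ContDiff ℝ n (TT k c) := by
  rw [TT_eq]
  exact contDiff_const.add (TTL k c).contDiff

lemma Ti_contDiff (k : ℝ) (c : ℝ × ℝ) {n : WithTop ℕ∞} : ContDiff ℝ n (Ti k c) := by
  unfold Ti
  simp only [div_eq_mul_inv]
  fun_prop

lemma TT_grad {k : ℝ} (hk : 0 < k) (c y : ℝ × ℝ) {f : ℝ × ℝ → ℝ} (hf : DifferentiableAt ℝ f (TT k c y)) :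
    n2 (grad (fun z => f (TT k c z)) y) = KHform k c (grad f (TT k c y)) (grad f (TT k c y)) := by
  have h := hf.hasFDerivAt.comp y (TT_hasFDerivAt k c y)
  have h' : fderiv ℝ (fun z => f (TT k c z)) y = (fderiv ℝ f (TT k c y)).comp (TTL k c) := h.fderiv
  rw [KHform_T hk]
  unfold grad n2
  rw [h']
  simp only [ContinuousLinearMap.comp_apply, TTL_apply]
  have e1 : ((Ta k c * 1, Tb k c * 1 + Tg k c * 0) : ℝ × ℝ) = Ta k c • ((1, 0) : ℝ × ℝ) + Tb k c • ((0, 1) : ℝ × ℝ) := by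
    ext <;> simp
  have e2 : ((Ta k c * 0, Tb k c * 0 + Tg k c * 1) : ℝ × ℝ) = Tg k c • ((0, 1) : ℝ × ℝ) := by
    ext <;> simp
  rw [e1, e2, map_add, map_smul, map_smul, map_smul]
  simp only [smul_eq_mul]

lemma TT_integral {k : ℝ} (hk : 0 < k) (c : ℝ × ℝ) (F : ℝ × ℝ → ℝ) :
    ∫ x, F x = √(detKH k c) * ∫ y, F (TT k c y) := by
  have himg : TT k c '' univ = univ := by
    rw [image_univ, range_eq_univ]
    exact fun x => ⟨Ti k c x, TT_Ti hk c x⟩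
  have hinj : InjOn (TT k c) univ := by
    intro a _ b _ h
    rw [← Ti_TT hk c a, ← Ti_TT hk c b, h]
  have := integral_image_eq_integral_abs_det_fderiv_smul (μ := (volume : Measure (ℝ × ℝ))) (s := univ) (f := TT k c)
    (f' := fun _ => TTL k c) MeasurableSet.univ (fun x _ => (TT_hasFDerivAt k c x).hasFDerivWithinAt) hinj F
  rw [himg, Measure.restrict_univ] at this
  rw [this]
  simp only [TTL_det, Ta_mul_Tg hk, abs_of_nonneg (Real.sqrt_nonneg _), smul_eq_mul]
  rw [integral_const_mul]

/-- the point with elliptic-polar coordinates `(r, θ)` -/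
def PT (k : ℝ) (c : ℝ × ℝ) (r θ : ℝ) : ℝ × ℝ := TT k c (r * cos θ, r * sin θ)

lemma n2_polar (r θ : ℝ) : n2 (r * cos θ, r * sin θ) = r ^ 2 := by
  unfold n2
  simp only
  have := Real.sin_sq_add_cos_sq θ
  nlinarith

lemma polar_integral (F : ℝ × ℝ → ℝ) :
    ∫ y, F y = ∫ p in Ioi (0:ℝ) ×ˢ Ioo (-π) π, p.1 * F (p.1 * cos p.2, p.1 * sin p.2) := by
  rw [← integral_comp_polarCoord_symm F]
  rfl

lemma exists_qunif {Ω : Set (ℝ × ℝ)} {q : ℝ × ℝ → ℝ} (hb : Bornology.IsBounded Ω)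
    (hqc : ContinuousOn q (closure Ω)) {η : ℝ} (hη : 0 < η) :
    ∃ δ > 0, ∀ x ∈ closure Ω, ∀ y ∈ closure Ω, dist x y < δ → |q x - q y| < η := by
  have hc : IsCompact (closure Ω) := hb.isCompact_closure
  have hu := hc.uniformContinuousOn_of_continuous hqc
  rw [Metric.uniformContinuousOn_iff] at hu
  obtain ⟨δ, hδ, h⟩ := hu η hη
  exact ⟨δ, hδ, fun x hx y hy hd => by have := h x hx y hy hd; rwa [Real.dist_eq] at this⟩

lemma exists_Kunif {Ω : Set (ℝ × ℝ)} {k : ℝ} (hk : 0 < k) (hb : Bornology.IsBounded Ω)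
    {η : ℝ} (hη : 0 < η) :
    ∃ δ > 0, ∀ x ∈ closure Ω, ∀ y ∈ closure Ω, dist x y < δ →
      ∀ a, KHform k x a a ≤ (1 + η) * KHform k y a a := by
  obtain ⟨lam, hl, hlam⟩ := exists_lam hk hb
  have c0 : ∀ x : ℝ × ℝ, k ^ 2 + x.1 ^ 2 + x.2 ^ 2 ≠ 0 := fun x => (den_pos hk x).ne'
  have c1 : Continuous (fun x : ℝ × ℝ => (k ^ 2 + x.1 ^ 2 + x.2 ^ 2)⁻¹ * (k ^ 2 + x.2 ^ 2)) :=
    (Continuous.inv₀ (by fun_prop) c0).mul (by fun_prop)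
  have c2 : Continuous (fun x : ℝ × ℝ => (k ^ 2 + x.1 ^ 2 + x.2 ^ 2)⁻¹ * (x.1 * x.2)) :=
    (Continuous.inv₀ (by fun_prop) c0).mul (by fun_prop)
  have c3 : Continuous (fun x : ℝ × ℝ => (k ^ 2 + x.1 ^ 2 + x.2 ^ 2)⁻¹ * (k ^ 2 + x.1 ^ 2)) :=
    (Continuous.inv₀ (by fun_prop) c0).mul (by fun_prop)
  have hκ : 0 < η * lam / 2 := by positivity
  obtain ⟨d1, hd1, h1⟩ := exists_qunif hb c1.continuousOn hκ
  obtain ⟨d2, hd2, h2⟩ := exists_qunif hb c2.continuousOn hκ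
  obtain ⟨d3, hd3, h3⟩ := exists_qunif hb c3.continuousOn hκ
  refine ⟨min d1 (min d2 d3), by positivity, ?_⟩
  intro x hx y hy hd a
  have e1 := h1 x hx y hy (hd.trans_le (min_le_left _ _))
  have e2 := h2 x hx y hy (hd.trans_le ((min_le_right _ _).trans (min_le_left _ _)))
  have e3 := h3 x hx y hy (hd.trans_le ((min_le_right _ _).trans (min_le_right _ _)))
  have hl2 := le_KHform hk y a
  have hl3 : lam * (a.1 ^ 2 + a.2 ^ 2) ≤ KHform k y a a :=
    (mul_le_mul_of_nonneg_right (hlam y hy) (by positivity)).trans hl2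
  have key : KHform k x a a - KHform k y a a ≤ η * lam * (a.1 ^ 2 + a.2 ^ 2) := by
    have : KHform k x a a - KHform k y a a =
      ((k ^ 2 + x.1 ^ 2 + x.2 ^ 2)⁻¹ * (k ^ 2 + x.2 ^ 2) - (k ^ 2 + y.1 ^ 2 + y.2 ^ 2)⁻¹ * (k ^ 2 + y.2 ^ 2)) * a.1 ^ 2
      - ((k ^ 2 + x.1 ^ 2 + x.2 ^ 2)⁻¹ * (x.1 * x.2) - (k ^ 2 + y.1 ^ 2 + y.2 ^ 2)⁻¹ * (y.1 * y.2)) * (2 * a.1 * a.2)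
      + ((k ^ 2 + x.1 ^ 2 + x.2 ^ 2)⁻¹ * (k ^ 2 + x.1 ^ 2) - (k ^ 2 + y.1 ^ 2 + y.2 ^ 2)⁻¹ * (k ^ 2 + y.1 ^ 2)) * a.2 ^ 2 := by
      unfold KHform; ring
    rw [this]
    set A := _ - (k ^ 2 + y.1 ^ 2 + y.2 ^ 2)⁻¹ * (k ^ 2 + y.2 ^ 2)
    set B := _ - (k ^ 2 + y.1 ^ 2 + y.2 ^ 2)⁻¹ * (y.1 * y.2)
    set D := _ - (k ^ 2 + y.1 ^ 2 + y.2 ^ 2)⁻¹ * (k ^ 2 + y.1 ^ 2)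
    rw [abs_lt] at e1 e2 e3
    have f1 : A * a.1 ^ 2 ≤ η * lam / 2 * a.1 ^ 2 := mul_le_mul_of_nonneg_right e1.2.le (by positivity)
    have f3 : D * a.2 ^ 2 ≤ η * lam / 2 * a.2 ^ 2 := mul_le_mul_of_nonneg_right e3.2.le (by positivity)
    have f2 : - (B * (2 * a.1 * a.2)) ≤ η * lam / 2 * (a.1 ^ 2 + a.2 ^ 2) := by
      nlinarith [mul_nonneg (by linarith [e2.2] : 0 ≤ η * lam / 2 - B) (sq_nonneg (a.1 - a.2)),
        mul_nonneg (by linarith [e2.1] : 0 ≤ η * lam / 2 + B) (sq_nonneg (a.1 + a.2))]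
    linarith
  nlinarith

end

section

/-- radial profile -/
def sfun (R ε : ℝ) (y : ℝ × ℝ) : ℝ := log R - 1 / 2 * log (n2 y + ε ^ 2)
def hfun (R ε : ℝ) (y : ℝ × ℝ) : ℝ := phi 1 (sfun R ε y)

lemma n2_nonneg (y : ℝ × ℝ) : 0 ≤ n2 y := by unfold n2; positivity

lemma n2_contDiff {n : WithTop ℕ∞} : ContDiff ℝ n n2 := by unfold n2; fun_prop

lemma sfun_contDiff {R ε : ℝ} (h0 : 0 < ε) {n : WithTop ℕ∞} : ContDiff ℝ n (sfun R ε) := by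
  unfold sfun
  refine contDiff_const.sub (contDiff_const.mul (ContDiff.log (n2_contDiff.add contDiff_const) ?_))
  intro y
  have := n2_nonneg y
  positivity

lemma hfun_contDiff {R ε : ℝ} (h0 : 0 < ε) : ContDiff ℝ 1 (hfun R ε) :=
  (phi_contDiff one_pos).comp (sfun_contDiff h0)

lemma grad_of {f : ℝ × ℝ → ℝ} {L : ℝ × ℝ →L[ℝ] ℝ} {x : ℝ × ℝ} (h : HasFDerivAt f L x) :
    grad f x = (L (1, 0), L (0, 1)) := by
  unfold grad; rw [h.fderiv]

lemma sfun_grad {R ε : ℝ} (h0 : 0 < ε) (y : ℝ × ℝ) :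
    grad (sfun R ε) y = (-(y.1 / (n2 y + ε ^ 2)), -(y.2 / (n2 y + ε ^ 2))) := by
  have hp : 0 < n2 y + ε ^ 2 := by have := n2_nonneg y; positivity
  have h1 : HasFDerivAt (fun z : ℝ × ℝ => z.1) (ContinuousLinearMap.fst ℝ ℝ ℝ) y := hasFDerivAt_fst
  have h2 : HasFDerivAt (fun z : ℝ × ℝ => z.2) (ContinuousLinearMap.snd ℝ ℝ ℝ) y := hasFDerivAt_snd
  have h3 := (((h1.pow 2).add (h2.pow 2)).add_const (ε ^ 2)).log hp.ne'
  have h4 := (h3.const_mul (1 / 2)).const_sub (log R)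
  have := grad_of h4
  have e : sfun R ε = fun x => log R - 1 / 2 * log ((((fun z : ℝ × ℝ => z.1 ^ 2) + (fun z : ℝ × ℝ => z.2 ^ 2)) x) + ε ^ 2) := by
    funext x; rfl
  rw [e, this]
  have e2 : n2 y = y.1 ^ 2 + y.2 ^ 2 := rfl
  rw [e2] at hp ⊢
  ext
  · simp
    field_simp
    try rfl
  · simp
    field_simp
    try rfl

lemma hfun_zero {R ε : ℝ} (hR : 0 < R) (h0 : 0 < ε) {y : ℝ × ℝ} (hy : R ^ 2 ≤ n2 y) : hfun R ε y = 0 := by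
  apply phi_eq_zero one_pos
  unfold sfun
  have : log (R ^ 2) ≤ log (n2 y + ε ^ 2) := Real.log_le_log (by positivity) (by nlinarith [sq_nonneg ε])
  rw [Real.log_pow] at this
  push_cast at this
  linarith

lemma hfun_grad_le {R ε : ℝ} (hR : 0 < R) (h0 : 0 < ε) (y : ℝ × ℝ) :
    n2 (grad (hfun R ε) y) ≤ {z | n2 z ≤ R ^ 2}.indicator (fun z => 1 / (n2 z + ε ^ 2)) y := by
  have hp : 0 < n2 y + ε ^ 2 := by have := n2_nonneg y; positivity
  by_cases hy : n2 y ≤ R ^ 2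
  · rw [indicator_of_mem (show y ∈ {z | n2 z ≤ R ^ 2} from hy)]
    have := grad_comp (U := sfun R ε) (x := y) ((sfun_contDiff h0 (n := 1)).contDiffAt.differentiableAt one_ne_zero)
      (phi_hasDerivAt one_pos (sfun R ε y))
    change grad (hfun R ε) y = _ at this
    rw [this, sfun_grad h0]
    have d0 := dphi_nonneg (δ := 1) (sfun R ε y)
    have d1 := dphi_le one_pos (sfun R ε y)
    set d := dphi 1 (sfun R ε y)
    have : n2 (d • (-(y.1 / (n2 y + ε ^ 2)), -(y.2 / (n2 y + ε ^ 2)))) = d ^ 2 * (n2 y / (n2 y + ε ^ 2) ^ 2) := by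
      generalize n2 y + ε ^ 2 = w
      unfold n2; simp only [Prod.smul_mk, smul_eq_mul]; ring
    rw [this]
    have h1 : n2 y / (n2 y + ε ^ 2) ^ 2 ≤ 1 / (n2 y + ε ^ 2) := by
      rw [div_le_div_iff₀ (by positivity) hp]
      nlinarith [sq_nonneg ε, n2_nonneg y, mul_nonneg (sq_nonneg ε) hp.le]
    have h2 : 0 ≤ n2 y / (n2 y + ε ^ 2) ^ 2 := by have := n2_nonneg y; positivity
    have h3 : d ^ 2 ≤ 1 := by nlinarith
    nlinarith
  · rw [indicator_of_notMem (show y ∉ {z | n2 z ≤ R ^ 2} from hy)]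
    push Not at hy
    have hev : hfun R ε =ᶠ[𝓝 y] fun _ => 0 := by
      have hop : IsOpen {z : ℝ × ℝ | R ^ 2 < n2 z} := isOpen_lt continuous_const (n2_contDiff (n := 0)).continuous
      filter_upwards [hop.mem_nhds hy] with z hz
      exact hfun_zero hR h0 (le_of_lt hz)
    have : grad (hfun R ε) y = (0, 0) := by
      unfold grad; rw [hev.fderiv_eq]; simp
    rw [this]; unfold n2; simp

lemma radial_integral {R ε : ℝ} (hR : 0 < R) (h0 : 0 < ε) :
    ∫ y, {z | n2 z ≤ R ^ 2}.indicator (fun z => 1 / (n2 z + ε ^ 2)) y = π * log ((R ^ 2 + ε ^ 2) / ε ^ 2) := by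
  rw [polar_integral]
  have e : ∀ p ∈ Ioi (0:ℝ) ×ˢ Ioo (-π) π, p.1 * {z | n2 z ≤ R ^ 2}.indicator (fun z => 1 / (n2 z + ε ^ 2)) (p.1 * cos p.2, p.1 * sin p.2)
      = (Iic R ×ˢ univ).indicator (fun p : ℝ × ℝ => p.1 / (p.1 ^ 2 + ε ^ 2)) p := by
    rintro p ⟨hp, -⟩
    simp only [mem_Ioi] at hp
    simp only [indicator_apply, mem_ofPred_eq, n2_polar, mem_prod, mem_univ, and_true, mem_Iic]
    by_cases h : p.1 ≤ R
    · rw [if_pos h, if_pos (by nlinarith)]; ring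
    · rw [if_neg h, if_neg (by push Not at *; nlinarith)]; ring
  rw [setIntegral_congr_fun (measurableSet_Ioi.prod measurableSet_Ioo) e,
    setIntegral_indicator (measurableSet_Iic.prod MeasurableSet.univ), prod_inter_prod, inter_univ, Ioi_inter_Iic]
  have hcont : Continuous (fun p : ℝ × ℝ => p.1 / (p.1 ^ 2 + ε ^ 2)) := by
    apply Continuous.div (by fun_prop) (by fun_prop)
    intro p; positivity
  rw [Measure.volume_eq_prod, setIntegral_prod]
  · simp only [setIntegral_const, smul_eq_mul]
    rw [integral_const_mul]
    have hi : ∫ x in Ioc 0 R, x / (x ^ 2 + ε ^ 2) = 1 / 2 * log ((R ^ 2 + ε ^ 2) / ε ^ 2) := by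
      rw [← intervalIntegral.integral_of_le hR.le]
      have hd : ∀ x ∈ uIcc 0 R, HasDerivAt (fun x : ℝ => 1 / 2 * log (x ^ 2 + ε ^ 2)) (x / (x ^ 2 + ε ^ 2)) x := by
        intro x _
        have h1 := (((hasDerivAt_id x).pow 2).add_const (ε ^ 2)).log (by simp; positivity)
        have h2 := h1.const_mul (1 / 2)
        have e : x / (x ^ 2 + ε ^ 2) = 1 / 2 * (((2 : ℕ) : ℝ) * x ^ (2 - 1) * 1 / (x ^ 2 + ε ^ 2)) := by
          push_cast; ring
        rw [e]
        exact h2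
      rw [intervalIntegral.integral_eq_sub_of_hasDerivAt hd]
      · rw [Real.log_div (by positivity) (by positivity)]
        simp
        ring
      · apply Continuous.intervalIntegrable
        apply Continuous.div (by fun_prop) (by fun_prop)
        intro p; positivity
    rw [hi, Real.volume_real_Ioo_of_le (by linarith [Real.pi_pos])]
    ring
  · have : IntegrableOn (fun p : ℝ × ℝ => p.1 / (p.1 ^ 2 + ε ^ 2)) (Icc 0 R ×ˢ Icc (-π) π) (volume.prod volume) := by
      rw [← Measure.volume_eq_prod]
      exact hcont.continuousOn.integrableOn_compact (isCompact_Icc.prod isCompact_Icc)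
    exact this.mono_set (prod_mono Ioc_subset_Icc_self Ioo_subset_Icc_self)

section
variable {k p ε : ℝ} {Ω : Set (ℝ × ℝ)} {q u : ℝ × ℝ → ℝ}

lemma ell_compact (hk : 0 < k) (c : ℝ × ℝ) (R : ℝ) : IsCompact {x | n2 (Ti k c x) ≤ R ^ 2} := by
  have : {x | n2 (Ti k c x) ≤ R ^ 2} = TT k c '' {y | n2 y ≤ R ^ 2} := by
    ext x
    constructor
    · intro h; exact ⟨Ti k c x, h, TT_Ti hk c x⟩
    · rintro ⟨y, hy, rfl⟩
      simp only [mem_ofPred_eq, Ti_TT hk]; exact hy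
  rw [this]
  refine IsCompact.image ?_ (TT_contDiff k c (n := 0)).continuous
  apply Metric.isCompact_of_isClosed_isBounded
  · exact isClosed_le (n2_contDiff (n := 0)).continuous continuous_const
  · apply (isCompact_Icc.prod isCompact_Icc : IsCompact (Icc (-|R|) |R| ×ˢ Icc (-|R|) |R|)).isBounded.subset
    intro y hy
    have hy' : y.1 ^ 2 + y.2 ^ 2 ≤ R ^ 2 := hy
    rw [mem_prod, mem_Icc, mem_Icc, ← abs_le, ← abs_le]
    exact ⟨sq_le_sq.1 (by nlinarith [sq_nonneg y.2]), sq_le_sq.1 (by nlinarith [sq_nonneg y.1])⟩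

/-- the test function -/
def Utest (k : ℝ) (c : ℝ × ℝ) (R ε : ℝ) (x : ℝ × ℝ) : ℝ := hfun R ε (Ti k c x)

lemma Utest_TF (hk : 0 < k) {c : ℝ × ℝ} {R : ℝ} (hR : 0 < R) (h0 : 0 < ε)
    (hsub : {x | n2 (Ti k c x) ≤ R ^ 2} ⊆ Ω) : TF Ω (Utest k c R ε) := by
  have hz : ∀ x, x ∉ {x | n2 (Ti k c x) ≤ R ^ 2} → Utest k c R ε x = 0 := by
    intro x hx
    exact hfun_zero hR h0 (le_of_lt (by simpa using hx))
  refine ⟨(hfun_contDiff h0).comp (Ti_contDiff k c), HasCompactSupport.intro (ell_compact hk c R) hz, ?_⟩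
  refine subset_trans ?_ hsub
  apply closure_minimal _ (ell_compact hk c R).isClosed
  intro x hx
  by_contra h
  exact hx (hz x h)

lemma Utest_En (hk : 0 < k) (ho : IsOpen Ω) {c : ℝ × ℝ} {R κ : ℝ} (hR : 0 < R) (h0 : 0 < ε) (hκ : 0 ≤ κ)
    (hK : ∀ x ∈ Ω, n2 (Ti k c x) ≤ R ^ 2 → ∀ a, KHform k x a a ≤ κ * KHform k c a a) :
    En k Ω (Utest k c R ε) (Utest k c R ε) ≤ κ * (√(detKH k c) * (π * log ((R ^ 2 + ε ^ 2) / ε ^ 2))) := by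
  set G : ℝ × ℝ → ℝ := {z | n2 z ≤ R ^ 2}.indicator (fun z => 1 / (n2 z + ε ^ 2)) with hG
  have hG0 : ∀ y, 0 ≤ G y := by
    intro y; apply indicator_nonneg; intro z _
    have := n2_nonneg z; positivity
  have hIntg : Integrable (fun x => κ * G (Ti k c x)) := by
    apply Integrable.const_mul
    have e : (fun x => G (Ti k c x)) = {x | n2 (Ti k c x) ≤ R ^ 2}.indicator (fun x => 1 / (n2 (Ti k c x) + ε ^ 2)) := by
      funext x; simp only [hG, indicator_apply, mem_ofPred_eq]
    rw [e, integrable_indicator_iff (ell_compact hk c R).measurableSet]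
    apply ContinuousOn.integrableOn_compact (ell_compact hk c R)
    apply Continuous.continuousOn
    apply Continuous.div continuous_const
    · exact ((n2_contDiff (n := 0)).continuous.comp (Ti_contDiff k c (n := 0)).continuous).add continuous_const
    · intro x; have := n2_nonneg (Ti k c x); positivity
  have hpt : ∀ x ∈ Ω, KHform k x (grad (Utest k c R ε) x) (grad (Utest k c R ε) x) ≤ κ * G (Ti k c x) := by
    intro x hx
    have hd : DifferentiableAt ℝ (Utest k c R ε) x :=
      ((hfun_contDiff h0).comp (Ti_contDiff k c)).contDiffAt.differentiableAt one_ne_zero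
    have e := TT_grad hk c (Ti k c x) (f := Utest k c R ε) (by rwa [TT_Ti hk])
    have e2 : (fun z => Utest k c R ε (TT k c z)) = hfun R ε := by
      funext z; unfold Utest; rw [Ti_TT hk]
    rw [e2, TT_Ti hk] at e
    have hle := hfun_grad_le hR h0 (Ti k c x)
    rw [e] at hle
    by_cases hc : n2 (Ti k c x) ≤ R ^ 2
    · exact (hK x hx hc _).trans (mul_le_mul_of_nonneg_left hle hκ)
    · rw [indicator_of_notMem (show Ti k c x ∉ {z | n2 z ≤ R ^ 2} from hc)] at hle
      have h1 := le_KHform hk c (grad (Utest k c R ε) x)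
      have h2 := detKH_pos hk c
      have h3 : (grad (Utest k c R ε) x).1 ^ 2 + (grad (Utest k c R ε) x).2 ^ 2 ≤ 0 := by
        by_contra hcon
        push Not at hcon
        nlinarith [mul_pos h2 hcon]
      have h4 := KHform_le hk x (grad (Utest k c R ε) x)
      have := mul_nonneg hκ (hG0 (Ti k c x))
      linarith
  calc En k Ω (Utest k c R ε) (Utest k c R ε) ≤ ∫ x in Ω, κ * G (Ti k c x) := by
        apply integral_mono_of_nonneg
        · exact Eventually.of_forall (fun x => KHform_nonneg k x _)
        · exact hIntg.integrableOn
        · exact (ae_restrict_iff' ho.measurableSet).2 (Eventually.of_forall hpt)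
    _ ≤ ∫ x, κ * G (Ti k c x) := setIntegral_le_integral hIntg
        (Eventually.of_forall (fun x => mul_nonneg hκ (hG0 _)))
    _ = κ * (√(detKH k c) * (π * log ((R ^ 2 + ε ^ 2) / ε ^ 2))) := by
        rw [TT_integral hk c]
        simp only [Ti_TT hk]
        rw [integral_const_mul, radial_integral hR h0]
        ring

lemma Utest_lower {R : ℝ} {c x : ℝ × ℝ} (h0 : 0 < ε) (hx1 : |(Ti k c x).1| ≤ ε / 2) (hx2 : |(Ti k c x).2| ≤ ε / 2) :
    log (1 / ε) + log R - 3 ≤ Utest k c R ε x := by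
  have h1 := le_phi one_pos (sfun R ε (Ti k c x))
  have h2 : n2 (Ti k c x) + ε ^ 2 ≤ 2 * ε ^ 2 := by
    unfold n2
    nlinarith [sq_abs (Ti k c x).1, sq_abs (Ti k c x).2, abs_nonneg (Ti k c x).1, abs_nonneg (Ti k c x).2]
  have h3 : log (n2 (Ti k c x) + ε ^ 2) ≤ log 2 + 2 * log ε := by
    have := Real.log_le_log (by have := n2_nonneg (Ti k c x); positivity) h2
    rw [Real.log_mul (by norm_num) (by positivity), Real.log_pow] at this
    exact_mod_cast this
  have h4 : log (1 / ε) = - log ε := by rw [one_div, Real.log_inv]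
  have h5 : log 2 ≤ 1 := by linarith [Real.log_two_lt_d9]
  have h6 : sfun R ε (Ti k c x) ≤ max (sfun R ε (Ti k c x)) 0 := le_max_left _ _
  unfold Utest hfun
  rw [h4]
  have : sfun R ε (Ti k c x) = log R - 1 / 2 * log (n2 (Ti k c x) + ε ^ 2) := rfl
  linarith

lemma square_integral (hk : 0 < k) (c : ℝ × ℝ) (h0 : 0 < ε) (M : ℝ) :
    ∫ x, {x | Ti k c x ∈ Icc (-(ε/2)) (ε/2) ×ˢ Icc (-(ε/2)) (ε/2)}.indicator (fun _ => M) x = √(detKH k c) * (ε ^ 2 * M) := by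
  rw [TT_integral hk c]
  congr 1
  have : (fun y => {x | Ti k c x ∈ Icc (-(ε/2)) (ε/2) ×ˢ Icc (-(ε/2)) (ε/2)}.indicator (fun _ => M) (TT k c y)) =
      (Icc (-(ε/2)) (ε/2) ×ˢ Icc (-(ε/2)) (ε/2)).indicator (fun _ => M) := by
    funext y
    simp only [indicator_apply, mem_ofPred_eq, Ti_TT hk]
  rw [this, integral_indicator (measurableSet_Icc.prod measurableSet_Icc), setIntegral_const, smul_eq_mul,
    Measure.volume_eq_prod, measureReal_prod_prod, Real.volume_real_Icc_of_le (by linarith)]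
  ring

end
end

section

lemma L_tendsto : Tendsto (fun ε : ℝ => log (1 / ε)) (𝓝[>] 0) atTop := by
  have : (fun ε : ℝ => log (1 / ε)) = fun ε => - log ε := by
    funext ε; rw [one_div, Real.log_inv]
  rw [this]
  exact tendsto_neg_atBot_atTop.comp Real.tendsto_log_nhdsGT_zero

lemma ev_L (M : ℝ) : ∀ᶠ ε : ℝ in 𝓝[>] 0, M < log (1 / ε) := L_tendsto.eventually_gt_atTop M

lemma ev_01 {a : ℝ} (ha : 0 < a) : ∀ᶠ ε : ℝ in 𝓝[>] 0, 0 < ε ∧ ε < a := by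
  filter_upwards [Ioo_mem_nhdsGT ha] with ε h using h

section
variable {k p ε : ℝ} {Ω : Set (ℝ × ℝ)} {q u : ℝ × ℝ → ℝ}

set_option maxHeartbeats 1000000 in
lemma path_upper1 (C : Ctx k p Ω q) {xs : ℝ × ℝ} {R η : ℝ} (hη : 0 < η) (hR : 0 < R) (hR1 : R ≤ 1)
    (hqs : 0 < q xs)
    (hsub : {x | n2 (Ti k xs x) ≤ R ^ 2} ⊆ Ω)
    (hK : ∀ x ∈ Ω, n2 (Ti k xs x) ≤ R ^ 2 → ∀ a, KHform k x a a ≤ (1 + η) * KHform k xs a a)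
    (hq : ∀ x ∈ Ω, n2 (Ti k xs x) ≤ R ^ 2 → q x ≤ (1 + η) * q xs)
    (h0 : 0 < ε) (h1 : ε < R) (hL1 : 1 ≤ log (1 / ε)) (hL2 : 1 ≤ η * log (1 / ε))
    (hL3 : 2 * (1 + η) * (3 - log R) ≤ η * log (1 / ε))
    (hL4 : π * Qfun k q xs * (1 + η) ^ 6 <
      (1 / (p + 1)) * (√(detKH k xs) * (q xs * η / 2) ^ (p + 1)) * log (1 / ε)) :
    ∃ c ∈ PathSet k p q Ω ε, c ≤ π * Qfun k q xs * (1 + η) ^ 6 * log (1 / ε) := by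
  have hk := C.hk
  have hp := C.hp
  set L := log (1 / ε) with hL
  set S := q xs * (1 + η) ^ 2 with hS
  have hSpos : 0 < S := by positivity
  set U := Utest k xs R ε with hU
  have hTF : TF Ω U := Utest_TF hk hR h0 hsub
  have hMU : MemH k Ω U := hTF.memH hk C.ho
  have hE := Utest_En (ε := ε) hk C.ho hR h0 (by linarith : (0:ℝ) ≤ 1 + η) hK
  rw [← hU] at hE
  have hlog : log ((R ^ 2 + ε ^ 2) / ε ^ 2) ≤ 2 * (1 + η) * L := by
    have h2 : (R ^ 2 + ε ^ 2) / ε ^ 2 ≤ 2 * (1 / ε) ^ 2 := by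
      rw [div_pow, one_pow, mul_one_div]
      apply div_le_div_of_nonneg_right _ (by positivity)
      nlinarith
    have h3 := Real.log_le_log (by positivity) h2
    rw [Real.log_mul (by norm_num) (by positivity), Real.log_pow] at h3
    push_cast at h3
    have h5 : log 2 ≤ 1 := by linarith [Real.log_two_lt_d9]
    nlinarith
  have hQ : Qfun k q xs = q xs ^ 2 * √(detKH k xs) := rfl
  set sd := √(detKH k xs) with hsd
  have hsdpos : 0 < sd := Real.sqrt_pos.2 (detKH_pos hk xs)
  have hE2 : 1 / 2 * (S ^ 2 * En k Ω U U) ≤ π * Qfun k q xs * (1 + η) ^ 6 * L := by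
    have : En k Ω U U ≤ (1 + η) * (sd * (π * (2 * (1 + η) * L))) := by
      refine hE.trans ?_
      have := Real.pi_pos
      gcongr
    calc 1 / 2 * (S ^ 2 * En k Ω U U) ≤ 1 / 2 * (S ^ 2 * ((1 + η) * (sd * (π * (2 * (1 + η) * L))))) := by gcongr
      _ = π * Qfun k q xs * (1 + η) ^ 6 * L := by rw [hQ, hS]; ring
  have hZ : MemH k Ω (fun _ : ℝ × ℝ => (0:ℝ)) := MemH.zero
  have hEb : ∀ a b : ℝ, En k Ω (fun y => a * (0:ℝ) + b * U y) (fun y => a * (0:ℝ) + b * U y) = b ^ 2 * En k Ω U U := by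
    intro a b
    have := (MemH.lin hk C.ho hMU hMU b 0).2
    have e : (fun y => a * (0:ℝ) + b * U y) = (fun y => b * U y + 0 * U y) := by funext y; ring
    rw [e, this]; ring
  have hB0 : 0 ≤ π * Qfun k q xs * (1 + η) ^ 6 * L := by
    refine le_trans ?_ hE2
    have := En_nonneg k Ω U
    positivity
  refine exists_path hk C.ho hZ hMU hSpos.le ?_ ?_ ?_
  · intro a _
    refine (Ieps_le_half hp _).trans ?_
    rw [hEb]; simpa using hB0
  · intro b hb
    refine (Ieps_le_half hp _).trans ?_
    rw [hEb]
    refine le_trans ?_ hE2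
    have := En_nonneg k Ω U
    have : b ^ 2 ≤ S ^ 2 := pow_le_pow_left₀ hb.1 hb.2 2
    gcongr
  · rw [Ieps_eq, hEb]
    -- lower bound of the integral
    set V : ℝ × ℝ → ℝ := fun y => 1 * 0 + S * U y with hV
    set M := (q xs * η / 2 * L) ^ (p + 1) with hM
    have hMnn : 0 ≤ M := by positivity
    set Sq : Set (ℝ × ℝ) := {x | Ti k xs x ∈ Icc (-(ε/2)) (ε/2) ×ˢ Icc (-(ε/2)) (ε/2)} with hSq
    have hSqm : ∀ x ∈ Sq, |(Ti k xs x).1| ≤ ε / 2 ∧ |(Ti k xs x).2| ≤ ε / 2 := by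
      intro x hx
      rw [abs_le, abs_le]
      exact ⟨hx.1, hx.2⟩
    have hSqR : ∀ x ∈ Sq, n2 (Ti k xs x) ≤ R ^ 2 := by
      intro x hx
      obtain ⟨a1, a2⟩ := hSqm x hx
      unfold n2
      nlinarith [sq_abs (Ti k xs x).1, sq_abs (Ti k xs x).2, abs_nonneg (Ti k xs x).1, abs_nonneg (Ti k xs x).2]
    have hSqΩ : Sq ⊆ Ω := fun x hx => hsub (hSqR x hx)
    have hSqmeas : MeasurableSet Sq :=
      (Ti_contDiff k xs (n := 0)).continuous.measurable (measurableSet_Icc.prod measurableSet_Icc)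
    have hVc : ContinuousOn V (closure Ω) := by
      apply Continuous.continuousOn
      exact continuous_const.add (continuous_const.mul hTF.1.continuous)
    have hIntg := C.int_pow (ε := ε) hVc (a := p + 1) (by linarith)
    have hlow : sd * (ε ^ 2 * M) ≤ ∫ x in Ω, pPart (V x - q x * log (1 / ε)) ^ (p + 1) := by
      rw [← square_integral hk xs h0 M, ← hSq]
      have e : ∫ x, Sq.indicator (fun _ => M) x = ∫ x in Ω, Sq.indicator (fun _ => M) x := by
        rw [setIntegral_eq_integral_of_forall_compl_eq_zero]
        intro x hx
        exact indicator_of_notMem (fun h => hx (hSqΩ h)) _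
      rw [e]
      apply integral_mono_of_nonneg
      · exact Eventually.of_forall (fun x => indicator_nonneg (fun _ _ => hMnn) x)
      · exact hIntg
      · refine (ae_restrict_iff' C.ho.measurableSet).2 (Eventually.of_forall ?_)
        intro x hx
        by_cases hxS : x ∈ Sq
        · rw [indicator_of_mem hxS]
          obtain ⟨a1, a2⟩ := hSqm x hxS
          have l1 := Utest_lower (k := k) (R := R) h0 a1 a2
          rw [← hU] at l1
          have l2 := hq x hx (hSqR x hxS)
          apply Real.rpow_le_rpow (by positivity) _ (by linarith)
          refine le_trans ?_ (le_max_left _ _)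
          change _ ≤ 1 * 0 + S * U x - q x * L
          have l3 : S * (L + log R - 3) ≤ S * U x := mul_le_mul_of_nonneg_left l1 hSpos.le
          have l4 : q x * L ≤ (1 + η) * q xs * L := mul_le_mul_of_nonneg_right l2 (by linarith)
          have l5 : q xs * (2 * (1 + η) * (3 - log R)) ≤ q xs * (η * L) := mul_le_mul_of_nonneg_left hL3 hqs.le
          have l6 : (1 + η) * (q xs * (2 * (1 + η) * (3 - log R))) ≤ (1 + η) * (q xs * (η * L)) :=
            mul_le_mul_of_nonneg_left l5 (by linarith)
          have l7 : S * (L + log R - 3) = q xs * (1 + η) ^ 2 * L - (1 + η) * (q xs * (2 * (1 + η) * (3 - log R))) / 2 := by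
            rw [hS]; ring
          have l8 : 0 ≤ q xs * η * L * η := by positivity
          nlinarith
        · rw [indicator_of_notMem hxS]
          exact Real.rpow_nonneg (le_max_right _ _) _
    have hpos : (0:ℝ) < p + 1 := by linarith
    have hfin : 1 / (p + 1) * (sd * M) ≤
        1 / ((p + 1) * ε ^ 2) * ∫ x in Ω, pPart (V x - q x * log (1 / ε)) ^ (p + 1) := by
      calc 1 / (p + 1) * (sd * M) = 1 / ((p + 1) * ε ^ 2) * (sd * (ε ^ 2 * M)) := by field_simp
        _ ≤ _ := mul_le_mul_of_nonneg_left hlow (by positivity)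
    have hMlow : (q xs * η / 2) ^ (p + 1) * (L * L) ≤ M := by
      rw [hM, Real.mul_rpow (by positivity) (by linarith)]
      apply mul_le_mul_of_nonneg_left _ (by positivity)
      rw [← sq]
      calc L ^ 2 = L ^ (2:ℝ) := by norm_cast
        _ ≤ L ^ (p + 1) := Real.rpow_le_rpow_of_exponent_le hL1 (by linarith)
    have hcomp : π * Qfun k q xs * (1 + η) ^ 6 * L < 1 / (p + 1) * (sd * M) := by
      calc π * Qfun k q xs * (1 + η) ^ 6 * L < (1 / (p + 1)) * (sd * (q xs * η / 2) ^ (p + 1)) * L * L :=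
            mul_lt_mul_of_pos_right hL4 (by linarith)
        _ = 1 / (p + 1) * (sd * ((q xs * η / 2) ^ (p + 1) * (L * L))) := by ring
        _ ≤ _ := by gcongr
    change 1 / 2 * (S ^ 2 * En k Ω U U) - 1 / ((p + 1) * ε ^ 2) * ∫ x in Ω, pPart (V x - q x * log (1 / ε)) ^ (p + 1) < 0
    linarith

lemma path_upper (C : Ctx k p Ω q) {xs : ℝ × ℝ} (hxs : xs ∈ Ω) {η : ℝ} (hη : 0 < η) :
    ∀ᶠ ε in 𝓝[>] 0, ∃ c ∈ PathSet k p q Ω ε, c ≤ π * Qfun k q xs * (1 + η) ^ 6 * log (1 / ε) := by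
  have hqs : 0 < q xs := C.hq3 xs (subset_closure hxs)
  obtain ⟨d1, hd1, hK⟩ := exists_Kunif C.hk C.hb hη
  obtain ⟨d2, hd2, hq⟩ := exists_qunif C.hb C.hqc (mul_pos hη hqs)
  obtain ⟨d3, hd3, hball⟩ := Metric.isOpen_iff.1 C.ho xs hxs
  obtain ⟨R, hR0, hR⟩ : ∃ R, 0 < R ∧ R < min 1 (min d1 (min d2 d3)) := exists_between (by positivity)
  simp only [lt_min_iff] at hR
  have hdist : ∀ x, n2 (Ti k xs x) ≤ R ^ 2 → dist x xs ≤ R := by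
    intro x hx
    have h1 := TT_dE C.hk xs (Ti k xs x)
    rw [TT_Ti C.hk] at h1
    have h2 : √(n2 (Ti k xs x)) ≤ R := by
      rw [Real.sqrt_le_left hR0.le]; exact hx
    exact (dist_le_dE x xs).trans (h1.trans h2)
  have hconst : 0 < (1 / (p + 1)) * (√(detKH k xs) * (q xs * η / 2) ^ (p + 1)) := by
    have := C.hp
    have := Real.sqrt_pos.2 (detKH_pos C.hk xs)
    have : 0 < (q xs * η / 2) ^ (p + 1) := by positivity
    have : 0 < p + 1 := by linarith
    positivity
  filter_upwards [ev_01 hR0, ev_L 1, ev_L (1 / η), ev_L (2 * (1 + η) * (3 - log R) / η),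
    ev_L (π * Qfun k q xs * (1 + η) ^ 6 / ((1 / (p + 1)) * (√(detKH k xs) * (q xs * η / 2) ^ (p + 1))))]
    with ε h1 h2 h3 h4 h5
  rw [div_lt_iff₀' hη] at h3 h4
  rw [div_lt_iff₀' hconst] at h5
  refine path_upper1 C hη hR0 hR.1.le hqs ?_ ?_ ?_ h1.1 h1.2 h2.le h3.le h4.le h5
  · intro x hx
    exact hball (Metric.mem_ball.2 ((hdist x hx).trans_lt hR.2.2.2))
  · intro x hx hx'
    exact hK x (subset_closure hx) xs (subset_closure hxs) ((hdist x hx').trans_lt hR.2.1)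
  · intro x hx hx'
    have := hq x (subset_closure hx) xs (subset_closure hxs) ((hdist x hx').trans_lt hR.2.2.1)
    rw [abs_lt] at this
    linarith [this.2]

lemma ceps_upper (C : Ctx k p Ω q) {xs : ℝ × ℝ} (hxs : xs ∈ Ω) {η : ℝ} (hη : 0 < η) :
    ∀ᶠ ε in 𝓝[>] 0, (PathSet k p q Ω ε).Nonempty ∧
      ceps k p q Ω ε ≤ π * Qfun k q xs * (1 + η) ^ 6 * log (1 / ε) := by
  filter_upwards [path_upper C hxs hη, ev_01 one_pos] with ε h1 h2
  obtain ⟨c, hc, hB⟩ := h1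
  exact ⟨⟨c, hc⟩, ceps_le C h2.1 h2.2 hc hB⟩

end
end

section

lemma PT_continuous (k : ℝ) (c : ℝ × ℝ) (r : ℝ) : Continuous (PT k c r) := by
  unfold PT
  exact (TT_contDiff k c (n := 0)).continuous.comp (by fun_prop)

lemma circle_topology {k r : ℝ} {Ω : Set (ℝ × ℝ)} (hk : 0 < k) (ho : IsOpen Ω)
    (hsc : SimplyConnectedSpace ↥Ω) {c b : ℝ × ℝ} (hr : 0 < r)
    (hcirc : ∀ θ, PT k c r θ ∈ Ω) (hb : n2 (Ti k c b) < r ^ 2) : b ∈ Ω := by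
  by_contra hbΩ
  set β : ℂ := ⟨(Ti k c b).1, (Ti k c b).2⟩ with hβ
  have hTc := (Ti_contDiff k c (n := 0)).continuous
  let g : ℝ × ℝ → ℂ := fun x => (((Ti k c x).1 : ℝ) : ℂ) + (((Ti k c x).2 : ℝ) : ℂ) * Complex.I - β
  have hgc : Continuous g := by
    have h1 : Continuous (fun x => (Ti k c x).1) := hTc.fst
    have h2 : Continuous (fun x => (Ti k c x).2) := hTc.snd
    exact ((Complex.continuous_ofReal.comp h1).add ((Complex.continuous_ofReal.comp h2).mul continuous_const)).sub continuous_const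
  have hg0 : (0:ℂ) ∉ g '' Ω := by
    rintro ⟨x, hx, h⟩
    apply hbΩ
    have h1 := congrArg Complex.re h
    have h2 := congrArg Complex.im h
    simp [g, hβ] at h1 h2
    have : Ti k c x = Ti k c b := Prod.ext (by linarith) (by linarith)
    rw [← TT_Ti hk c b, ← this, TT_Ti hk]
    exact hx
  obtain ⟨f, hfc, hf⟩ := Complex.exists_continuousOn_eqOn_exp_comp (U := Ω) hsc ho hgc.continuousOn hg0
  have hnb : ‖β‖ < r := by
    have : ‖β‖ ^ 2 < r ^ 2 := by
      rw [Complex.sq_norm, Complex.normSq_apply, hβ]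
      unfold n2 at hb
      nlinarith
    exact lt_of_pow_lt_pow_left₀ 2 hr.le this
  let w : ℝ → ℂ := fun θ => 1 - β / r * Complex.exp (-(θ * Complex.I))
  have hwc : Continuous w := by fun_prop
  have hws : ∀ θ, w θ ∈ Complex.slitPlane := by
    intro θ
    have h1 : ‖β / r * Complex.exp (-(θ * Complex.I))‖ < 1 := by
      have e : -((θ:ℂ) * Complex.I) = ((-θ : ℝ) : ℂ) * Complex.I := by push_cast; ring
      rw [norm_mul, e, Complex.norm_exp_ofReal_mul_I, mul_one, norm_div, Complex.norm_real, Real.norm_of_nonneg hr.le, div_lt_one hr]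
      exact hnb
    have := Complex.mem_slitPlane_of_norm_lt_one (z := -(β / r * Complex.exp (-(θ * Complex.I)))) (by rwa [norm_neg])
    simpa [w, sub_eq_add_neg] using this
  have hgw : ∀ θ : ℝ, g (PT k c r θ) = r * Complex.exp (θ * Complex.I) * w θ := by
    intro θ
    simp only [g, w, PT, Ti_TT hk]
    rw [mul_sub, mul_one]
    have e : (r:ℂ) * Complex.exp (θ * Complex.I) * (β / r * Complex.exp (-(θ * Complex.I))) = β := by
      rw [Complex.exp_neg]
      have h1 := Complex.exp_ne_zero (θ * Complex.I)
      have h2 : (r:ℂ) ≠ 0 := by exact_mod_cast hr.ne'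
      field_simp
    rw [e, Complex.exp_mul_I]
    push_cast
    ring
  let ψ : ℝ → ℂ := fun θ => f (PT k c r θ) - θ * Complex.I - Complex.log (w θ) - Complex.log r
  have hψc : Continuous ψ := by
    have h1 : Continuous fun θ => f (PT k c r θ) := by
      rw [← continuousOn_univ]
      exact hfc.comp (PT_continuous k c r).continuousOn (fun θ _ => hcirc θ)
    exact ((h1.sub (by fun_prop)).sub (hwc.clog hws)).sub continuous_const
  have hψe : ∀ θ, Complex.exp (ψ θ) = 1 := by
    intro θ
    have h0 : Complex.exp (f (PT k c r θ)) = g (PT k c r θ) := hf (hcirc θ)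
    have h2 : (r:ℂ) ≠ 0 := by exact_mod_cast hr.ne'
    have h3 : w θ ≠ 0 := Complex.slitPlane_ne_zero (hws θ)
    have h4 := Complex.exp_ne_zero (θ * Complex.I)
    simp only [ψ]
    rw [Complex.exp_sub, Complex.exp_sub, Complex.exp_sub, h0, hgw, Complex.exp_log h3, Complex.exp_log h2]
    field_simp
  have hIntg : ∀ θ, ∃ n : ℤ, (ψ θ).im = n * (2 * π) := by
    intro θ
    obtain ⟨n, hn⟩ := Complex.exp_eq_one_iff.1 (hψe θ)
    refine ⟨n, ?_⟩
    rw [hn]; simp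
  have hψ2 : ψ (2 * π) = ψ 0 - (2 * π : ℝ) * Complex.I := by
    have e1 : PT k c r (2 * π) = PT k c r 0 := by unfold PT; simp
    have e2 : w (2 * π) = w 0 := by
      simp only [w]
      congr 2
      have : -(((2 * π : ℝ) : ℂ) * Complex.I) = -(2 * π * Complex.I) := by push_cast; ring
      rw [this, Complex.exp_neg, Complex.exp_two_pi_mul_I]; simp
    simp only [ψ, e1, e2]
    push_cast
    ring
  obtain ⟨m, hm⟩ := hIntg 0
  have hm2 : (ψ (2 * π)).im = m * (2 * π) - 2 * π := by
    rw [hψ2, Complex.sub_im, hm]; simp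
  have hpi := Real.pi_pos
  obtain ⟨θ, hθ⟩ := mem_range_of_exists_le_of_exists_ge (f := fun θ => (ψ θ).im) (c := m * (2 * π) - π)
    (Complex.continuous_im.comp hψc) ⟨2 * π, by simp only [hm2]; linarith⟩ ⟨0, by simp only [hm]; linarith⟩
  obtain ⟨n, hn⟩ := hIntg θ
  simp only at hθ
  rw [hn] at hθ
  have : (2 * n : ℝ) = 2 * m - 1 := by
    have : (2 * (n:ℝ) - (2 * m - 1)) * π = 0 := by linarith
    rcases mul_eq_zero.1 this with h | h
    · linarith
    · linarith
  have h' : 2 * n = 2 * m - 1 := by exact_mod_cast this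
  omega

end

section

lemma cs_ii {a b : ℝ} (hab : a ≤ b) {f g : ℝ → ℝ} (hf : ContinuousOn f (Icc a b))
    (hg : ContinuousOn g (Icc a b)) :
    (∫ x in a..b, f x * g x) ^ 2 ≤ (∫ x in a..b, f x ^ 2) * ∫ x in a..b, g x ^ 2 := by
  rw [intervalIntegral.integral_of_le hab, intervalIntegral.integral_of_le hab, intervalIntegral.integral_of_le hab]
  apply cs_int
  · exact ((hf.pow 2).integrableOn_compact isCompact_Icc).mono_set Ioc_subset_Icc_self
  · exact ((hg.pow 2).integrableOn_compact isCompact_Icc).mono_set Ioc_subset_Icc_self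
  · exact ((hf.mul hg).integrableOn_compact isCompact_Icc).mono_set Ioc_subset_Icc_self

/-- polar representation of a function and of its energy density -/
def Gp (g : ℝ × ℝ → ℝ) (r θ : ℝ) : ℝ := g (r * cos θ, r * sin θ)
def Hp (g : ℝ × ℝ → ℝ) (r θ : ℝ) : ℝ := r * n2 (grad g (r * cos θ, r * sin θ))
def Dp (g : ℝ × ℝ → ℝ) (r : ℝ) : ℝ := ∫ θ in (-π)..π, Hp g r θ
def Wp (g : ℝ × ℝ → ℝ) (r : ℝ) : ℝ := ∫ θ in (-π)..π, Gp g r θ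

section
variable {g : ℝ × ℝ → ℝ}

lemma grad_cont (hg : ContDiff ℝ 1 g) : Continuous (grad g) := by
  have h : Continuous (fderiv ℝ g) := hg.continuous_fderiv one_ne_zero
  unfold grad
  exact (h.clm_apply continuous_const).prodMk (h.clm_apply continuous_const)

lemma Hp_cont (hg : ContDiff ℝ 1 g) : Continuous (fun x : ℝ × ℝ => Hp g x.1 x.2) := by
  unfold Hp
  refine continuous_fst.mul ((n2_contDiff (n := 0)).continuous.comp ((grad_cont hg).comp ?_))
  fun_prop

lemma Gp_cont (hg : ContDiff ℝ 1 g) : Continuous (fun x : ℝ × ℝ => Gp g x.1 x.2) := by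
  unfold Gp
  exact hg.continuous.comp (by fun_prop)

lemma Hp_nonneg {r : ℝ} (hr : 0 ≤ r) (θ : ℝ) : 0 ≤ Hp g r θ := mul_nonneg hr (n2_nonneg _)

lemma Dp_cont (hg : ContDiff ℝ 1 g) : Continuous (Dp g) :=
  intervalIntegral.continuous_parametric_intervalIntegral_of_continuous' (f := fun r θ => Hp g r θ) (Hp_cont hg) _ _

lemma Dp_nonneg {r : ℝ} (hr : 0 ≤ r) : 0 ≤ Dp g r :=
  intervalIntegral.integral_nonneg (by linarith [Real.pi_pos]) (fun θ _ => Hp_nonneg hr θ)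

lemma fderiv_eq_grad (x v : ℝ × ℝ) : fderiv ℝ g x v = (grad g x).1 * v.1 + (grad g x).2 * v.2 := by
  have : v = v.1 • ((1, 0) : ℝ × ℝ) + v.2 • ((0, 1) : ℝ × ℝ) := by ext <;> simp
  conv_lhs => rw [this]
  rw [map_add, map_smul, map_smul]
  unfold grad
  simp only [smul_eq_mul]; ring

lemma Gp_dθ (hg : ContDiff ℝ 1 g) (r θ : ℝ) :
    HasDerivAt (fun θ => Gp g r θ) (fderiv ℝ g (r * cos θ, r * sin θ) (r * (-sin θ), r * cos θ)) θ := by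
  have h1 : HasDerivAt (fun θ : ℝ => (r * cos θ, r * sin θ)) (r * (-sin θ), r * cos θ) θ :=
    ((Real.hasDerivAt_cos θ).const_mul r).prodMk ((Real.hasDerivAt_sin θ).const_mul r)
  exact ((hg.differentiable one_ne_zero).differentiableAt.hasFDerivAt).comp_hasDerivAt θ h1

lemma Gp_dr (hg : ContDiff ℝ 1 g) (r θ : ℝ) :
    HasDerivAt (fun r => Gp g r θ) (fderiv ℝ g (r * cos θ, r * sin θ) (cos θ, sin θ)) r := by
  have h1 : HasDerivAt (fun r : ℝ => (r * cos θ, r * sin θ)) (1 * cos θ, 1 * sin θ) r :=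
    ((hasDerivAt_id r).mul_const (cos θ)).prodMk ((hasDerivAt_id r).mul_const (sin θ))
  rw [one_mul, one_mul] at h1
  exact ((hg.differentiable one_ne_zero).differentiableAt.hasFDerivAt).comp_hasDerivAt r h1

lemma dθ_sq (r θ : ℝ) : (fderiv ℝ g (r * cos θ, r * sin θ) (r * (-sin θ), r * cos θ)) ^ 2 ≤ r * Hp g r θ := by
  rw [fderiv_eq_grad]
  unfold Hp n2
  set a := (grad g (r * cos θ, r * sin θ)).1
  set b := (grad g (r * cos θ, r * sin θ)).2
  have e : r * (r * (a ^ 2 + b ^ 2)) = (a * (r * (-sin θ)) + b * (r * cos θ)) ^ 2 + (r * (a * cos θ + b * sin θ)) ^ 2 := by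
    have h := Real.sin_sq_add_cos_sq θ
    linear_combination (-(r ^ 2 * (a ^ 2 + b ^ 2))) * h
  simp only
  nlinarith [sq_nonneg (r * (a * cos θ + b * sin θ))]

lemma dr_sq_le {r : ℝ} (hr : 0 ≤ r) (θ : ℝ) : r * (fderiv ℝ g (r * cos θ, r * sin θ) (cos θ, sin θ)) ^ 2 ≤ Hp g r θ := by
  rw [fderiv_eq_grad]
  unfold Hp n2
  set a := (grad g (r * cos θ, r * sin θ)).1
  set b := (grad g (r * cos θ, r * sin θ)).2
  apply mul_le_mul_of_nonneg_left _ hr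
  have e : (a ^ 2 + b ^ 2) = (a * cos θ + b * sin θ) ^ 2 + (a * sin θ - b * cos θ) ^ 2 := by
    have h := Real.sin_sq_add_cos_sq θ
    linear_combination (-(a ^ 2 + b ^ 2)) * h
  simp only
  nlinarith [sq_nonneg (a * sin θ - b * cos θ)]

lemma fd_cont (hg : ContDiff ℝ 1 g) {P V : ℝ → ℝ × ℝ} (hP : Continuous P) (hV : Continuous V) :
    Continuous (fun t => fderiv ℝ g (P t) (V t)) :=
  ((hg.continuous_fderiv one_ne_zero).comp hP).clm_apply hV

/-- oscillation on a circle -/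
lemma osc (hg : ContDiff ℝ 1 g) {r : ℝ} (hr : 0 ≤ r) {θ1 θ2 : ℝ} (h1 : θ1 ∈ Icc (-π) π) (h2 : θ2 ∈ Icc (-π) π) :
    |Gp g r θ1 - Gp g r θ2| ≤ √(2 * π * (r * Dp g r)) := by
  have key : ∀ a ∈ Icc (-π) π, ∀ b ∈ Icc (-π) π, a ≤ b → |Gp g r b - Gp g r a| ≤ √(2 * π * (r * Dp g r)) := by
    intro a ha b hb hab
    set f : ℝ → ℝ := fun θ => fderiv ℝ g (r * cos θ, r * sin θ) (r * (-sin θ), r * cos θ) with hf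
    have hfc : Continuous f := fd_cont hg (P := fun θ => (r * cos θ, r * sin θ)) (V := fun θ => (r * (-sin θ), r * cos θ)) (by fun_prop) (by fun_prop)
    have e1 : ∫ θ in a..b, f θ = Gp g r b - Gp g r a :=
      intervalIntegral.integral_eq_sub_of_hasDerivAt (fun θ _ => Gp_dθ hg r θ) (hfc.intervalIntegrable _ _)
    have hcs := cs_ii hab (f := fun _ => 1) (g := f) continuousOn_const hfc.continuousOn
    simp only [one_mul, one_pow, intervalIntegral.integral_const, smul_eq_mul, mul_one] at hcs
    rw [e1] at hcs
    have hcH : Continuous (fun θ => r * Hp g r θ) := continuous_const.mul ((Hp_cont hg).comp (Continuous.prodMk_right r))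
    have e2 : ∫ θ in a..b, f θ ^ 2 ≤ r * Dp g r := by
      calc ∫ θ in a..b, f θ ^ 2 ≤ ∫ θ in a..b, r * Hp g r θ :=
            intervalIntegral.integral_mono_on hab ((hfc.pow 2).intervalIntegrable _ _) (hcH.intervalIntegrable _ _)
              (fun θ _ => dθ_sq r θ)
        _ ≤ ∫ θ in (-π)..π, r * Hp g r θ := by
            apply intervalIntegral.integral_mono_interval ha.1 hab hb.2
            · exact Eventually.of_forall (fun θ => mul_nonneg hr (Hp_nonneg hr θ))
            · exact hcH.intervalIntegrable _ _
        _ = r * Dp g r := by rw [intervalIntegral.integral_const_mul]; rfl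
    have e3 : 0 ≤ ∫ θ in a..b, f θ ^ 2 := intervalIntegral.integral_nonneg hab (fun θ _ => sq_nonneg _)
    apply Real.abs_le_sqrt
    have : b - a ≤ 2 * π := by linarith [ha.1, hb.2]
    calc _ ≤ (b - a) * ∫ θ in a..b, f θ ^ 2 := hcs
      _ ≤ 2 * π * (r * Dp g r) := mul_le_mul this e2 e3 (by linarith [Real.pi_pos])
  rcases le_total θ1 θ2 with h | h
  · rw [abs_sub_comm]; exact key _ h1 _ h2 h
  · exact key _ h2 _ h1 h

lemma Wp_ge (hg : ContDiff ℝ 1 g) {r M θ0 : ℝ} (hr : 0 ≤ r) (h0 : θ0 ∈ Icc (-π) π) (hM : M ≤ Gp g r θ0) :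
    2 * π * (M - √(2 * π * (r * Dp g r))) ≤ Wp g r := by
  have hpi := Real.pi_pos
  have hc : Continuous (fun θ => Gp g r θ) := (Gp_cont hg).comp (Continuous.prodMk_right r)
  have := intervalIntegral.integral_mono_on (μ := volume) (a := -π) (b := π) (f := fun _ => M - √(2 * π * (r * Dp g r))) (by linarith)
    (continuous_const.intervalIntegrable _ _) (hc.intervalIntegrable _ _) (fun θ hθ => by
      have := osc hg hr hθ h0
      rw [abs_le] at this
      linarith [this.1])
  rw [intervalIntegral.integral_const, smul_eq_mul] at this
  unfold Wp
  linarith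

lemma Wp_le (hg : ContDiff ℝ 1 g) {r M θ0 : ℝ} (hr : 0 ≤ r) (h0 : θ0 ∈ Icc (-π) π) (hM : Gp g r θ0 ≤ M) :
    Wp g r ≤ 2 * π * (M + √(2 * π * (r * Dp g r))) := by
  have hpi := Real.pi_pos
  have hc : Continuous (fun θ => Gp g r θ) := (Gp_cont hg).comp (Continuous.prodMk_right r)
  have := intervalIntegral.integral_mono_on (μ := volume) (a := -π) (b := π) (g := fun _ => M + √(2 * π * (r * Dp g r))) (by linarith)
    (hc.intervalIntegrable _ _) (continuous_const.intervalIntegrable _ _) (fun θ hθ => by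
      have := osc hg hr hθ h0
      rw [abs_le] at this
      linarith [this.2])
  rw [intervalIntegral.integral_const, smul_eq_mul] at this
  unfold Wp
  linarith

lemma Wp_diff (hg : ContDiff ℝ 1 g) {s t : ℝ} (hs : 0 < s) (hst : s ≤ t) :
    (Wp g t - Wp g s) ^ 2 ≤ 2 * π * (log (t / s) * ∫ r in s..t, Dp g r) := by
  have hpi := Real.pi_pos
  have hcG : ∀ r, Continuous (fun θ => Gp g r θ) := fun r => (Gp_cont hg).comp (Continuous.prodMk_right r)
  have hcH : ∀ θ, Continuous (fun r => Hp g r θ) := fun θ => (Hp_cont hg).comp (Continuous.prodMk_left θ)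
  have hpt : ∀ θ, (Gp g t θ - Gp g s θ) ^ 2 ≤ log (t / s) * ∫ r in s..t, Hp g r θ := by
    intro θ
    set f : ℝ → ℝ := fun r => fderiv ℝ g (r * cos θ, r * sin θ) (cos θ, sin θ) with hf
    have hfc : Continuous f := fd_cont hg (P := fun r => (r * cos θ, r * sin θ)) (V := fun _ => (cos θ, sin θ)) (by fun_prop) (by fun_prop)
    have e1 : ∫ r in s..t, f r = Gp g t θ - Gp g s θ :=
      intervalIntegral.integral_eq_sub_of_hasDerivAt (fun r _ => Gp_dr hg r θ) (hfc.intervalIntegrable _ _)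
    have hc1 : ContinuousOn (fun r : ℝ => (√r)⁻¹) (Icc s t) :=
      Real.continuous_sqrt.continuousOn.inv₀ (fun r hr => (Real.sqrt_pos.2 (hs.trans_le hr.1)).ne')
    have hc2 : ContinuousOn (fun r : ℝ => √r * f r) (Icc s t) := (Real.continuous_sqrt.mul hfc).continuousOn
    have hcs := cs_ii hst hc1 hc2
    have e2 : ∫ r in s..t, (√r)⁻¹ * (√r * f r) = ∫ r in s..t, f r := by
      apply intervalIntegral.integral_congr
      intro r hr
      rw [uIcc_of_le hst] at hr
      have := (Real.sqrt_pos.2 (hs.trans_le hr.1)).ne'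
      simp only
      field_simp
    have e3 : ∫ r in s..t, ((√r)⁻¹) ^ 2 = log (t / s) := by
      rw [← integral_inv_of_pos hs (hs.trans_le hst)]
      apply intervalIntegral.integral_congr
      intro r hr
      rw [uIcc_of_le hst] at hr
      simp only
      rw [inv_pow, Real.sq_sqrt (hs.trans_le hr.1).le]
    have e4 : ∫ r in s..t, (√r * f r) ^ 2 ≤ ∫ r in s..t, Hp g r θ := by
      apply intervalIntegral.integral_mono_on hst (((Real.continuous_sqrt.mul hfc).pow 2).intervalIntegrable _ _)
        ((hcH θ).intervalIntegrable _ _)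
      intro r hr
      change (√r * f r) ^ 2 ≤ _
      rw [mul_pow, Real.sq_sqrt (hs.trans_le hr.1).le]
      exact dr_sq_le (hs.trans_le hr.1).le θ
    rw [e2, e1, e3] at hcs
    exact hcs.trans (mul_le_mul_of_nonneg_left e4 (Real.log_nonneg (by rwa [le_div_iff₀ hs, one_mul])))
  have e1 : Wp g t - Wp g s = ∫ θ in (-π)..π, 1 * (Gp g t θ - Gp g s θ) := by
    unfold Wp
    simp only [one_mul]
    rw [intervalIntegral.integral_sub ((hcG t).intervalIntegrable _ _) ((hcG s).intervalIntegrable _ _)]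
  have hcs := cs_ii (a := -π) (b := π) (by linarith) (f := fun _ => 1) (g := fun θ => Gp g t θ - Gp g s θ)
    continuousOn_const ((hcG t).sub (hcG s)).continuousOn
  rw [← e1] at hcs
  simp only [one_pow, intervalIntegral.integral_const, smul_eq_mul, mul_one] at hcs
  have hcI : Continuous (fun θ => ∫ r in s..t, Hp g r θ) :=
    intervalIntegral.continuous_parametric_intervalIntegral_of_continuous' (f := fun θ r => Hp g r θ)
      ((Hp_cont hg).comp continuous_swap) _ _
  have e2 : ∫ θ in (-π)..π, (Gp g t θ - Gp g s θ) ^ 2 ≤ log (t / s) * ∫ r in s..t, Dp g r := by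
    calc ∫ θ in (-π)..π, (Gp g t θ - Gp g s θ) ^ 2 ≤ ∫ θ in (-π)..π, log (t / s) * ∫ r in s..t, Hp g r θ :=
          intervalIntegral.integral_mono_on (by linarith) ((((hcG t).sub (hcG s)).pow 2).intervalIntegrable _ _)
            ((continuous_const.mul hcI).intervalIntegrable _ _) (fun θ _ => hpt θ)
      _ = log (t / s) * ∫ θ in (-π)..π, ∫ r in s..t, Hp g r θ := intervalIntegral.integral_const_mul _ _
      _ = log (t / s) * ∫ r in s..t, Dp g r := by
          congr 1
          unfold Dp
          apply intervalIntegral_intervalIntegral_swap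
          have : IntegrableOn (fun x : ℝ × ℝ => Hp g x.2 x.1) (uIcc (-π) π ×ˢ uIcc s t) :=
            ContinuousOn.integrableOn_compact (isCompact_uIcc.prod isCompact_uIcc) ((Hp_cont hg).comp continuous_swap).continuousOn
          exact this.mono_set (prod_mono uIoc_subset_uIcc uIoc_subset_uIcc)
  calc (Wp g t - Wp g s) ^ 2 ≤ (π - -π) * ∫ θ in (-π)..π, (Gp g t θ - Gp g s θ) ^ 2 := hcs
    _ ≤ (π - -π) * (log (t / s) * ∫ r in s..t, Dp g r) := mul_le_mul_of_nonneg_left e2 (by linarith)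
    _ = _ := by ring

lemma good_radius (hg : ContDiff ℝ 1 g) {s : ℝ} (hs : 0 < s) :
    ∃ r ∈ Icc s (2 * s), r * Dp g r * log 2 ≤ ∫ r in s..(2 * s), Dp g r := by
  have hst : s ≤ 2 * s := by linarith
  obtain ⟨r, hr, hmin⟩ := isCompact_Icc.exists_isMinOn (nonempty_Icc.2 hst)
    (continuous_id.mul (Dp_cont hg)).continuousOn
  refine ⟨r, hr, ?_⟩
  have e : log 2 = ∫ x in s..(2 * s), x⁻¹ := by
    rw [integral_inv_of_pos hs (by linarith)]
    congr 1; field_simp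
  rw [e, ← intervalIntegral.integral_const_mul]
  apply intervalIntegral.integral_mono_on hst
  · apply ContinuousOn.intervalIntegrable
    rw [uIcc_of_le hst]
    exact continuousOn_const.mul (continuousOn_id.inv₀ (fun x hx => (hs.trans_le hx.1).ne'))
  · exact (Dp_cont hg).intervalIntegrable _ _
  · intro x hx
    have hx0 := hs.trans_le hx.1
    have := hmin hx
    simp only [mem_ofPred_eq, Pi.mul_apply, id] at this
    rw [← div_eq_mul_inv, div_le_iff₀ hx0]
    linarith

end
end

section

section
variable {k : ℝ} {Ω : Set (ℝ × ℝ)} {f : ℝ × ℝ → ℝ} {c : ℝ × ℝ}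

lemma energy_polar (hk : 0 < k) (ho : IsOpen Ω) (hf : TF Ω f) {κ s t : ℝ} (hκ : 0 ≤ κ) (hs : 0 < s) (hst : s ≤ t)
    (hK : ∀ x ∈ Ω, n2 (Ti k c x) ≤ t ^ 2 → ∀ a, κ * KHform k c a a ≤ KHform k x a a) :
    κ * (√(detKH k c) * ∫ r in s..t, Dp (fun y => f (TT k c y)) r) ≤ En k Ω f f := by
  set g : ℝ × ℝ → ℝ := fun y => f (TT k c y) with hg
  have hgC : ContDiff ℝ 1 g := hf.1.comp (TT_contDiff k c)
  have hTc := (Ti_contDiff k c (n := 0)).continuous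
  have hnc := (n2_contDiff (n := 0)).continuous
  set A : Set (ℝ × ℝ) := {x | s ^ 2 ≤ n2 (Ti k c x) ∧ n2 (Ti k c x) ≤ t ^ 2} with hA
  set F : ℝ × ℝ → ℝ := A.indicator (fun x => KHform k c (grad f x) (grad f x)) with hF
  have hF0 : ∀ x, 0 ≤ F x := fun x => indicator_nonneg (fun x _ => KHform_nonneg k c _) x
  have hpol : ∫ x, F x = √(detKH k c) * ∫ r in s..t, Dp g r := by
    rw [TT_integral hk c, polar_integral]
    congr 1
    have e : ∀ p ∈ Ioi (0:ℝ) ×ˢ Ioo (-π) π, p.1 * F (TT k c (p.1 * cos p.2, p.1 * sin p.2))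
        = (Icc s t ×ˢ univ).indicator (fun p : ℝ × ℝ => Hp g p.1 p.2) p := by
      rintro p ⟨hp, -⟩
      simp only [mem_Ioi] at hp
      have hd : DifferentiableAt ℝ f (TT k c (p.1 * cos p.2, p.1 * sin p.2)) :=
        hf.1.contDiffAt.differentiableAt one_ne_zero
      have e1 := TT_grad hk c (p.1 * cos p.2, p.1 * sin p.2) hd
      simp only [hF, indicator_apply, hA, mem_ofPred_eq, Ti_TT hk, n2_polar, mem_prod, mem_univ, and_true, mem_Icc]
      by_cases h : s ≤ p.1 ∧ p.1 ≤ t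
      · rw [if_pos h, if_pos ⟨by nlinarith [h.1], by nlinarith [h.2]⟩, ← e1]
        rfl
      · rw [if_neg h, if_neg, mul_zero]
        rintro ⟨h1, h2⟩
        exact h ⟨le_of_sq_le_sq h1 hp.le, le_of_sq_le_sq h2 (by linarith)⟩
    rw [setIntegral_congr_fun (measurableSet_Ioi.prod measurableSet_Ioo) e,
      setIntegral_indicator (measurableSet_Icc.prod MeasurableSet.univ), prod_inter_prod, inter_univ]
    have e2 : Ioi (0:ℝ) ∩ Icc s t = Icc s t := by
      apply inter_eq_self_of_subset_right
      exact fun r hr => hs.trans_le hr.1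
    rw [e2, Measure.volume_eq_prod, setIntegral_prod]
    · rw [integral_Icc_eq_integral_Ioc, ← intervalIntegral.integral_of_le hst]
      apply intervalIntegral.integral_congr
      intro r _
      simp only [Dp]
      rw [intervalIntegral.integral_of_le (by linarith [Real.pi_pos]), integral_Ioc_eq_integral_Ioo]
    · have : IntegrableOn (fun p : ℝ × ℝ => Hp g p.1 p.2) (Icc s t ×ˢ Icc (-π) π) (volume.prod volume) := by
        rw [← Measure.volume_eq_prod]
        exact (Hp_cont hgC).continuousOn.integrableOn_compact (isCompact_Icc.prod isCompact_Icc)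
      exact this.mono_set (prod_mono subset_rfl Ioo_subset_Icc_self)
  have hΩ : ∫ x, F x = ∫ x in Ω, F x := by
    rw [setIntegral_eq_integral_of_forall_compl_eq_zero]
    intro x hx
    have : grad f x = (0, 0) := by unfold grad; rw [fderiv_zero_of_TF hf hx]; simp
    simp only [hF, indicator_apply, this]
    unfold KHform; simp
  rw [← hpol, hΩ, ← integral_const_mul]
  apply integral_mono_of_nonneg
  · exact Eventually.of_forall (fun x => mul_nonneg hκ (hF0 x))
  · exact (hf.memH hk ho).2.2.2
  · refine (ae_restrict_iff' ho.measurableSet).2 (Eventually.of_forall ?_)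
    intro x hx
    by_cases h : x ∈ A
    · simp only [hF]
      rw [indicator_of_mem h]
      exact hK x hx h.2 _
    · simp only [hF]
      rw [indicator_of_notMem h, mul_zero]
      exact KHform_nonneg k x _

/-- error constant -/
def Kc (lam C3 : ℝ) : ℝ := 4 * π * √(2 * π / (lam * √lam * log 2)) + √(2 * π * log C3 / (lam * √lam))

lemma Kc_nonneg (lam C3 : ℝ) : 0 ≤ Kc lam C3 := by
  unfold Kc; have := Real.pi_pos; positivity

lemma cap (hk : 0 < k) (ho : IsOpen Ω) (hf : TF Ω f) {lam κ δ d2 ρ E0 C3 M : ℝ} (hl : 0 < lam)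
    (hlam : ∀ x ∈ Ω, lam ≤ detKH k x) (hlc : lam ≤ detKH k c) (hE : En k Ω f f ≤ E0) (hE0 : 0 < E0)
    (hκ : 0 < κ) (hδ : 0 < δ) (hd2 : 0 < d2) (hρ : 0 < ρ) (hC3 : 2 * d2 ≤ C3 * min δ d2)
    (hK : ∀ x ∈ Ω, n2 (Ti k c x) ≤ δ ^ 2 → ∀ a, κ * KHform k c a a ≤ KHform k x a a)
    (hM : ∀ r, 0 < r → r ≤ ρ → ∃ θ ∈ Icc (-π) π, M ≤ f (PT k c r θ))
    (hz : ∀ r, d2 ≤ r → ∃ θ ∈ Icc (-π) π, f (PT k c r θ) = 0)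
    (hpos : 0 ≤ 2 * π * M - Kc lam C3 * √E0) :
    (2 * π * M - Kc lam C3 * √E0) ^ 2 * (κ * √(detKH k c)) ≤ 2 * π * E0 * log (2 * max (d2 / ρ) 1) := by
  have hpi := Real.pi_pos
  have hl2 : 0 < log 2 := Real.log_pos (by norm_num)
  set g : ℝ × ℝ → ℝ := fun y => f (TT k c y) with hg
  have hgC : ContDiff ℝ 1 g := hf.1.comp (TT_contDiff k c)
  have hsl : 0 < √lam := Real.sqrt_pos.2 hl
  have hsd : √lam ≤ √(detKH k c) := Real.sqrt_le_sqrt hlc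
  set sd := √(detKH k c) with hsdd
  set e1 := E0 / (lam * √lam) with he1
  have he1pos : 0 < e1 := by positivity
  -- crude energy bound
  have hcrude : ∀ s t, 0 < s → s ≤ t → ∫ r in s..t, Dp g r ≤ e1 := by
    intro s t hs hst
    have h1 := energy_polar (c := c) hk ho hf hl.le hs hst (fun x hx _ a => by
      have a1 := KHform_le hk c a
      have a2 := le_KHform hk x a
      have a3 : lam * (a.1 ^ 2 + a.2 ^ 2) ≤ detKH k x * (a.1 ^ 2 + a.2 ^ 2) :=
        mul_le_mul_of_nonneg_right (hlam x hx) (by positivity)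
      have a4 := mul_le_mul_of_nonneg_left a1 hl.le
      linarith)
    have h2 : 0 ≤ ∫ r in s..t, Dp g r :=
      intervalIntegral.integral_nonneg hst (fun r hr => Dp_nonneg (hs.le.trans hr.1))
    rw [he1, le_div_iff₀ (by positivity)]
    calc (∫ r in s..t, Dp g r) * (lam * √lam) = lam * (√lam * ∫ r in s..t, Dp g r) := by ring
      _ ≤ lam * (sd * ∫ r in s..t, Dp g r) := by gcongr
      _ ≤ E0 := h1.trans hE
  set t := min δ d2 with ht
  have htpos : 0 < t := lt_min hδ hd2
  set s0 := min ρ t / 2 with hs0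
  have hs0pos : 0 < s0 := by have : 0 < min ρ t := lt_min hρ htpos; positivity
  have h2s : 2 * s0 = min ρ t := by rw [hs0]; ring
  obtain ⟨r1, hr1, hD1⟩ := good_radius hgC hs0pos
  obtain ⟨r2, hr2, hD2⟩ := good_radius hgC hd2
  have hr1pos : 0 < r1 := hs0pos.trans_le hr1.1
  have hr2pos : 0 < r2 := hd2.trans_le hr2.1
  have hr1ρ : r1 ≤ ρ := hr1.2.trans (by rw [h2s]; exact min_le_left _ _)
  have hr1t : r1 ≤ t := hr1.2.trans (by rw [h2s]; exact min_le_right _ _)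
  have htr2 : t ≤ r2 := (min_le_right _ _).trans hr2.1
  set σ := √(2 * π * (e1 / log 2)) with hσ
  have hσ1 : √(2 * π * (r1 * Dp g r1)) ≤ σ := by
    apply Real.sqrt_le_sqrt
    apply mul_le_mul_of_nonneg_left _ (by positivity)
    rw [le_div_iff₀ hl2]
    exact hD1.trans (hcrude _ _ hs0pos (by linarith))
  have hσ2 : √(2 * π * (r2 * Dp g r2)) ≤ σ := by
    apply Real.sqrt_le_sqrt
    apply mul_le_mul_of_nonneg_left _ (by positivity)
    rw [le_div_iff₀ hl2]
    exact hD2.trans (hcrude _ _ hd2 (by linarith))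
  obtain ⟨θ1, hθ1, hv1⟩ := hM r1 hr1pos hr1ρ
  obtain ⟨θ2, hθ2, hv2⟩ := hz r2 hr2.1
  have hW1 : 2 * π * (M - σ) ≤ Wp g r1 := by
    refine le_trans ?_ (Wp_ge hgC hr1pos.le hθ1 (M := M) hv1)
    apply mul_le_mul_of_nonneg_left _ (by positivity)
    linarith
  have hW2 : Wp g r2 ≤ 2 * π * σ := by
    refine (Wp_le hgC hr2pos.le hθ2 (M := 0) hv2.le).trans ?_
    apply mul_le_mul_of_nonneg_left _ (by positivity)
    linarith
  have hW3 : |Wp g r2 - Wp g t| ≤ √(2 * π * (log C3 * e1)) := by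
    apply Real.abs_le_sqrt
    refine (Wp_diff hgC htpos htr2).trans ?_
    apply mul_le_mul_of_nonneg_left _ (by positivity)
    have h1 : r2 / t ≤ C3 := by rw [div_le_iff₀ htpos]; exact hr2.2.trans hC3
    have h2 : 1 ≤ r2 / t := by rw [le_div_iff₀ htpos, one_mul]; exact htr2
    have h3 : log (r2 / t) ≤ log C3 := Real.log_le_log (by linarith) h1
    have h4 : 0 ≤ log (r2 / t) := Real.log_nonneg h2
    calc log (r2 / t) * ∫ r in t..r2, Dp g r ≤ log (r2 / t) * e1 :=
          mul_le_mul_of_nonneg_left (hcrude _ _ htpos htr2) h4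
      _ ≤ log C3 * e1 := mul_le_mul_of_nonneg_right h3 he1pos.le
  have hKc : Kc lam C3 * √E0 = 4 * π * σ + √(2 * π * (log C3 * e1)) := by
    unfold Kc
    rw [add_mul, mul_assoc (4 * π), ← Real.sqrt_mul' _ hE0.le, ← Real.sqrt_mul' _ hE0.le, hσ, he1]
    have a1 : 2 * π / (lam * √lam * log 2) * E0 = 2 * π * (E0 / (lam * √lam) / log 2) := by field_simp
    have a2 : 2 * π * log C3 / (lam * √lam) * E0 = 2 * π * (log C3 * (E0 / (lam * √lam))) := by field_simp
    rw [a1, a2]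
  rw [abs_le] at hW3
  have hmain : 2 * π * M - Kc lam C3 * √E0 ≤ Wp g r1 - Wp g t := by
    rw [hKc]; linarith [hW3.1, hW3.2]
  have hsq : (2 * π * M - Kc lam C3 * √E0) ^ 2 ≤ (Wp g t - Wp g r1) ^ 2 := by nlinarith
  have hdiff := hsq.trans (Wp_diff hgC hr1pos hr1t)
  have hsharp := energy_polar (c := c) hk ho hf hκ.le hr1pos hr1t (fun x hx hx' => hK x hx (hx'.trans (by
    have : t ≤ δ := min_le_left _ _
    nlinarith)))
  have hlog : log (t / r1) ≤ log (2 * max (d2 / ρ) 1) := by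
    apply Real.log_le_log (by positivity)
    rw [div_le_iff₀ hr1pos]
    have h1 : min ρ t ≤ 2 * r1 := by rw [← h2s]; linarith [hr1.1]
    have h2 : t ≤ d2 := min_le_right _ _
    rcases le_total ρ t with h | h
    · rw [min_eq_left h] at h1
      calc t ≤ d2 := h2
        _ = d2 / ρ * ρ := by field_simp
        _ ≤ max (d2 / ρ) 1 * (2 * r1) := by
            apply mul_le_mul (le_max_left _ _) h1 hρ.le (by positivity)
        _ = _ := by ring
    · rw [min_eq_right h] at h1
      calc t ≤ 1 * (2 * r1) := by linarith
        _ ≤ max (d2 / ρ) 1 * (2 * r1) := by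
            apply mul_le_mul_of_nonneg_right (le_max_right _ _) (by positivity)
        _ = _ := by ring
  have hlog0 : 0 ≤ log (t / r1) := Real.log_nonneg (by rw [le_div_iff₀ hr1pos, one_mul]; exact hr1t)
  have hsdpos : 0 < sd := hsl.trans_le hsd
  calc (2 * π * M - Kc lam C3 * √E0) ^ 2 * (κ * sd)
      ≤ 2 * π * (log (t / r1) * ∫ r in r1..t, Dp g r) * (κ * sd) :=
        mul_le_mul_of_nonneg_right hdiff (by positivity)
    _ = 2 * π * log (t / r1) * (κ * (sd * ∫ r in r1..t, Dp g r)) := by ring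
    _ ≤ 2 * π * log (t / r1) * E0 := mul_le_mul_of_nonneg_left (hsharp.trans hE) (by positivity)
    _ ≤ 2 * π * log (2 * max (d2 / ρ) 1) * E0 := by gcongr
    _ = _ := by ring

end
end

section

section
variable {k p ε : ℝ} {Ω : Set (ℝ × ℝ)} {q u : ℝ × ℝ → ℝ}

lemma dE_comm (a b : ℝ × ℝ) : dE a b = dE b a := by
  unfold dE; congr 1; ring

lemma exists_polar {y : ℝ × ℝ} {r : ℝ} (hr : 0 < r) (hy : n2 y = r ^ 2) :
    ∃ θ ∈ Icc (-π) π, y = (r * cos θ, r * sin θ) := by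
  set z : ℂ := ⟨y.1, y.2⟩ with hz
  have hn : ‖z‖ = r := by
    have h1 : ‖z‖ ^ 2 = r ^ 2 := by
      rw [← hy, ← Complex.normSq_eq_norm_sq, Complex.normSq_apply]
      simp only [hz, n2]; ring
    have := norm_nonneg z
    nlinarith
  refine ⟨z.arg, ⟨(Complex.neg_pi_lt_arg z).le, Complex.arg_le_pi z⟩, ?_⟩
  have h1 := Complex.norm_mul_cos_arg z
  have h2 := Complex.norm_mul_sin_arg z
  rw [hn] at h1 h2
  ext
  · simp only; rw [h1]
  · simp only; rw [h2]

lemma hz_lem (hk : 0 < k) (ho : IsOpen Ω) (hsc : SimplyConnectedSpace ↥Ω) {c b : ℝ × ℝ} (hbΩ : b ∉ Ω)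
    {r : ℝ} (hr : 0 < r) (hb : n2 (Ti k c b) < r ^ 2) : ∃ θ ∈ Icc (-π) π, PT k c r θ ∉ Ω := by
  by_contra! hcon
  refine hbΩ (circle_topology hk ho hsc hr (fun θ => ?_) hb)
  obtain ⟨θ', hθ', he⟩ := exists_polar hr (n2_polar r θ)
  have := hcon θ' hθ'
  unfold PT at this ⊢
  rw [he]; exact this

lemma hM_lem (hk : 0 < k) {A : Set (ℝ × ℝ)} (hA : IsPreconnected A) {c x2 : ℝ × ℝ} (hc : c ∈ A) (hx2 : x2 ∈ A)
    {r : ℝ} (hr : 0 < r) (h2 : r ≤ dE x2 c) :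
    ∃ θ ∈ Icc (-π) π, PT k c r θ ∈ A ∧ dE (PT k c r θ) c ≤ r := by
  have hcont : ContinuousOn (fun x => n2 (Ti k c x)) A :=
    (((n2_contDiff (n := 0)).comp (Ti_contDiff k c (n := 0))).continuous).continuousOn
  have hiv := hA.intermediate_value hc hx2 hcont
  have h0 : n2 (Ti k c c) = 0 := by simp [n2, Ti]
  have h3 : r ^ 2 ≤ n2 (Ti k c x2) := by
    have := TT_dE hk c (Ti k c x2)
    rw [TT_Ti hk] at this
    have h4 := h2.trans this
    have h5 := Real.sq_sqrt (n2_nonneg (Ti k c x2))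
    nlinarith
  obtain ⟨x, hx, hxr⟩ := hiv (show r ^ 2 ∈ Icc _ _ from ⟨by simp only [h0]; positivity, h3⟩)
  simp only at hxr
  obtain ⟨θ, hθ, he⟩ := exists_polar hr hxr
  have hP : PT k c r θ = x := by unfold PT; rw [← he, TT_Ti hk]
  refine ⟨θ, hθ, by rw [hP]; exact hx, ?_⟩
  have := TT_dE hk c (Ti k c x)
  rw [TT_Ti hk, hxr, Real.sqrt_sq hr.le] at this
  rw [hP]; exact this

lemma exists_D (hb : Bornology.IsBounded Ω) : ∃ D > 0, ∀ x ∈ closure Ω, ∀ y ∈ closure Ω, dE x y ≤ D := by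
  refine ⟨2 * Metric.diam (closure Ω) + 1, by have := Metric.diam_nonneg (s := closure Ω); linarith, ?_⟩
  intro x hx y hy
  have h1 := Metric.dist_le_diam_of_mem hb.closure hx hy
  have h2 := dE_le_dist x y
  linarith

lemma dist_bddBelow (A B : Set (ℝ × ℝ)) : BddBelow {d | ∃ a ∈ A, ∃ b ∈ B, d = dE a b} := by
  refine ⟨0, ?_⟩
  rintro d ⟨a, _, b, _, rfl⟩
  exact dE_nonneg a b

lemma distE_le {A B : Set (ℝ × ℝ)} {a b : ℝ × ℝ} (ha : a ∈ A) (hb : b ∈ B) : distE A B ≤ dE a b :=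
  csInf_le (dist_bddBelow A B) ⟨a, ha, b, hb, rfl⟩

lemma diamE_le {A : Set (ℝ × ℝ)} {D : ℝ} (hD : 0 ≤ D) (h : ∀ x ∈ A, ∀ y ∈ A, dE x y ≤ D) : diamE A ≤ D := by
  apply Real.sSup_le _ hD
  rintro d ⟨a, ha, b, hb, rfl⟩
  exact h a ha b hb

lemma core_dist_pos (C : Ctx k p Ω q) (h0 : 0 < ε) (h1 : ε < 1) (hu : IsMPSolution k p ε q Ω u)
    (hne : (vcore q Ω ε u).Nonempty) (hF : (frontier Ω).Nonempty) :
    0 < distE (vcore q Ω ε u) (frontier Ω) := by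
  have hL := log_inv_pos h0 h1
  have hc := C.vcont (ε := ε) hu.2.1.1
  obtain ⟨hK, hKs⟩ := superlevel_compact (c := 0) C.ho C.hb hc (fun x hx => by
    have := C.hq3 x (frontier_subset_closure hx)
    have h3 := hu.2.1.2.2.1 x hx
    simp only [vv, h3]
    have := mul_pos this hL
    linarith)
  obtain ⟨δ, hδ, hth⟩ := hK.exists_thickening_subset_open C.ho hKs
  refine lt_of_lt_of_le hδ ?_
  apply le_csInf
  · obtain ⟨a, ha⟩ := hne
    obtain ⟨b, hb⟩ := hF
    exact ⟨_, a, ha, b, hb, rfl⟩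
  · rintro d ⟨a, ha, b, hb, rfl⟩
    refine le_trans ?_ (dist_le_dE a b)
    by_contra! hlt
    have : b ∈ Ω := hth (Metric.mem_thickening_iff.2 ⟨a, ⟨subset_closure ha.1, by
      have := ha.2; simp only [vv]; linarith⟩, by rw [dist_comm]; exact hlt⟩)
    rw [C.ho.frontier_eq] at hb
    exact hb.2 this

lemma exists_near {A B : Set (ℝ × ℝ)} (h : 0 < distE A B) (hA : A.Nonempty) (hB : B.Nonempty) :
    ∃ a ∈ A, ∃ b ∈ B, dE a b ≤ 2 * distE A B := by
  have hne : {d | ∃ a ∈ A, ∃ b ∈ B, d = dE a b}.Nonempty := by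
    obtain ⟨a, ha⟩ := hA
    obtain ⟨b, hb⟩ := hB
    exact ⟨_, a, ha, b, hb, rfl⟩
  obtain ⟨d, ⟨a, ha, b, hb, rfl⟩, hd⟩ := exists_lt_of_csInf_lt hne (show sInf _ < 2 * distE A B by
    change distE A B < _; linarith)
  exact ⟨a, ha, b, hb, hd.le⟩

lemma exists_far {A : Set (ℝ × ℝ)} (h : 0 < diamE A) {c : ℝ × ℝ} (hc : c ∈ A) :
    ∃ x ∈ A, diamE A / 8 ≤ dE x c := by
  have hne : {d | ∃ a ∈ A, ∃ b ∈ A, d = dE a b}.Nonempty := ⟨_, c, hc, c, hc, rfl⟩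
  obtain ⟨d, ⟨a, ha, b, hb, rfl⟩, hd⟩ := exists_lt_of_lt_csSup hne (show diamE A / 2 < sSup _ by
    change _ < diamE A; linarith)
  have h1 := dE_le_dist a b
  have h2 := dist_triangle_right a b c
  rcases le_total (diamE A / 8) (dist a c) with h3 | h3
  · exact ⟨a, ha, h3.trans (dist_le_dE _ _)⟩
  · exact ⟨b, hb, le_trans (by linarith) (dist_le_dE _ _)⟩

lemma tr_energy (C : Ctx k p Ω q) {w : ℝ × ℝ → ℝ} (hw : MemH k Ω w) :
    TF Ω (tr Ω univ 1 w) ∧ En k Ω (tr Ω univ 1 w) (tr Ω univ 1 w) ≤ En k Ω w w ∧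
      (∀ x ∈ Ω, w x - 2 ≤ tr Ω univ 1 w x) ∧ ∀ x, x ∉ Ω → tr Ω univ 1 w x = 0 := by
  have hT : TF Ω (tr Ω univ 1 w) := tr_univ_TF C one_pos hw.1 hw.2.1 (fun x hx => by rw [hw.2.2.1 x hx]; exact one_pos)
  refine ⟨hT, ?_, ?_, ?_⟩
  · apply setIntegral_mono_on (hT.memH C.hk C.ho).2.2.2 hw.2.2.2 C.ho.measurableSet
    intro x hx
    rw [tr_univ_grad C one_pos hw.2.1 hx]
    have d0 := dphi_nonneg (δ := 1) (w x)
    have d1 := dphi_le one_pos (w x)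
    have a1 : KHform k x (dphi 1 (w x) • grad w x) (dphi 1 (w x) • grad w x)
        = dphi 1 (w x) ^ 2 * KHform k x (grad w x) (grad w x) := by
      simp [KHform]; ring
    rw [a1]
    have a2 := KHform_nonneg k x (grad w x)
    have : dphi 1 (w x) ^ 2 ≤ 1 := by nlinarith
    nlinarith
  · intro x hx
    unfold tr
    rw [indicator_of_mem (by simpa using hx)]
    have := le_phi one_pos (w x)
    have h2 := le_max_left (w x) 0
    change w x - 2 ≤ phi 1 (w x)
    linarith
  · intro x hx
    unfold tr
    exact indicator_of_notMem (by simpa using hx) _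

/-- purely numerical end of the lower bound -/
lemma final_ineq {L qc sdc Qm Qx κ η Kk M E0 X m : ℝ} (hη : 0 < η) (hη4 : η < 1 / 4) (hL : 0 < L)
    (hm : 0 < m) (hqc : m ≤ qc) (hQm : 0 < Qm) (hQx : Qx ≤ (1 + η) * Qm) (hQc : Qm ≤ qc ^ 2 * sdc) (hsd : 0 < sdc)
    (hκ : κ = (1 + η)⁻¹) (hE : E0 = 2 * (π * Qx * (1 + η) ^ 6 * L)) (hM : M = (1 - η) * qc * L - 2)
    (hX : 0 ≤ X)
    (hbig : 4 * π + Kk * √E0 ≤ 2 * π * η * m * L)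
    (h : (2 * π * M - Kk * √E0) ^ 2 * (κ * sdc) ≤ 2 * π * E0 * X) :
    (1 - 2 * η) ^ 2 / (1 + η) ^ 8 * L ≤ X := by
  have hpi := Real.pi_pos
  have h1 : 2 * π * (1 - 2 * η) * qc * L ≤ 2 * π * M - Kk * √E0 := by
    have : 2 * π * η * m * L ≤ 2 * π * η * qc * L := by gcongr
    rw [hM]; nlinarith
  have hqc0 : 0 < qc := hm.trans_le hqc
  have h12 : 0 < 1 - 2 * η := by linarith
  have h2 : (2 * π * (1 - 2 * η) * qc * L) ^ 2 ≤ (2 * π * M - Kk * √E0) ^ 2 := by gcongr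
  have hκ0 : 0 < κ := by rw [hκ]; positivity
  have h3 := (mul_le_mul_of_nonneg_right h2 (by positivity : 0 ≤ κ * sdc)).trans h
  have h4 : 4 * π ^ 2 * L * ((1 - 2 * η) ^ 2 * L * κ * Qm) ≤ (2 * π * (1 - 2 * η) * qc * L) ^ 2 * (κ * sdc) := by
    calc _ ≤ 4 * π ^ 2 * L * ((1 - 2 * η) ^ 2 * L * κ * (qc ^ 2 * sdc)) := by gcongr
      _ = _ := by ring
  have h5 : 2 * π * E0 * X ≤ 4 * π ^ 2 * L * ((1 + η) ^ 7 * Qm * X) := by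
    rw [hE]
    calc _ = 4 * π ^ 2 * L * ((1 + η) ^ 6 * X * Qx) := by ring
      _ ≤ 4 * π ^ 2 * L * ((1 + η) ^ 6 * X * ((1 + η) * Qm)) := by gcongr
      _ = _ := by ring
  have h6 := le_of_mul_le_mul_left (h4.trans (h3.trans h5)) (by positivity : 0 < 4 * π ^ 2 * L)
  rw [div_mul_eq_mul_div, div_le_iff₀ (by positivity)]
  have h7 : (1 - 2 * η) ^ 2 * L * κ ≤ (1 + η) ^ 7 * X := by
    apply le_of_mul_le_mul_right _ hQm
    linarith
  have h8 := mul_le_mul_of_nonneg_right h7 (by positivity : 0 ≤ 1 + η)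
  rw [hκ, mul_assoc, inv_mul_cancel₀ (by positivity)] at h8
  linarith

end
end

section

section
variable {k p ε : ℝ} {Ω : Set (ℝ × ℝ)} {q u : ℝ × ℝ → ℝ}

lemma exists_xs (C : Ctx k p Ω q) {x0 : ℝ × ℝ} (hx0 : x0 ∈ closure Ω) {η : ℝ} (hη : 0 < η) :
    ∃ xs ∈ Ω, Qfun k q xs ≤ (1 + η) * Qfun k q x0 := by
  have hQ : 0 < Qfun k q x0 := by
    unfold Qfun
    have h1 := C.hq3 x0 hx0
    have h2 := Real.sqrt_pos.2 (detKH_pos C.hk x0)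
    positivity
  have hc : ContinuousOn (Qfun k q) (closure Ω) := by
    unfold Qfun
    refine (C.hqc.pow 2).mul (Continuous.continuousOn ?_)
    unfold detKH
    refine Real.continuous_sqrt.comp (Continuous.div (by fun_prop) (by fun_prop) fun x => (den_pos C.hk x).ne')
  have hcw : ContinuousWithinAt (Qfun k q) Ω x0 := (hc x0 hx0).mono subset_closure
  have hev := hcw.eventually (Iio_mem_nhds (show Qfun k q x0 < (1 + η) * Qfun k q x0 by nlinarith))
  haveI := mem_closure_iff_nhdsWithin_neBot.1 hx0
  obtain ⟨x, hx, hxΩ⟩ := (hev.and self_mem_nhdsWithin).exists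
  exact ⟨x, hxΩ, le_of_lt hx⟩

lemma big_L {a b B L : ℝ} (ha : 0 ≤ a) (hb : 0 < b)
    (h : ((a * √B + 4 * π) / b) ^ 2 + 1 < L) : 4 * π + a * √(B * L) ≤ b * L := by
  have hpi := Real.pi_pos
  set s := a * √B + 4 * π with hs
  have hs0 : 0 < s := by positivity
  have hL1 : 1 ≤ L := by nlinarith [sq_nonneg (s / b)]
  have hsL : 1 ≤ √L := by rw [Real.one_le_sqrt]; exact hL1
  have h2 : s / b ≤ √L := Real.le_sqrt_of_sq_le (by linarith)
  rw [div_le_iff₀ hb] at h2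
  have h3 : √L * √L = L := Real.mul_self_sqrt (by linarith)
  rw [Real.sqrt_mul' _ (by linarith)]
  have h4 : s * √L ≤ b * L := by nlinarith
  have h5 : s * √L = a * (√B * √L) + 4 * π * √L := by rw [hs]; ring
  nlinarith

set_option maxHeartbeats 2000000 in
lemma lower_log (C : Ctx k p Ω q) (hsc : SimplyConnectedSpace ↥Ω) (hF : (frontier Ω).Nonempty)
    {x0 : ℝ × ℝ} (hx0 : x0 ∈ closure Ω) (hmin : ∀ y ∈ closure Ω, Qfun k q x0 ≤ Qfun k q y)
    {η : ℝ} (hη : 0 < η) (hη4 : η < 1 / 4) :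
    ∃ X > 0, ∀ᶠ ε in 𝓝[>] 0, ∀ u, IsMPSolution k p ε q Ω u → (vcore q Ω ε u).Nonempty →
      0 < diamE (vcore q Ω ε u) →
      (1 - 2 * η) ^ 2 / (1 + η) ^ 8 * log (1 / ε) ≤
        log (2 * max (X * (distE (vcore q Ω ε u) (frontier Ω) / diamE (vcore q Ω ε u))) 1) := by
  have hk := C.hk
  have hpi := Real.pi_pos
  obtain ⟨xs, hxs, hQxs⟩ := exists_xs C hx0 hη
  obtain ⟨lam, hl, hlam⟩ := exists_lam hk C.hb
  obtain ⟨m, hm0, hmq⟩ := exists_qmin C.hb C.hqc C.hq3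
  obtain ⟨D, hD, hDD⟩ := exists_D C.hb
  obtain ⟨δ1, hδ1, hq⟩ := exists_qunif C.hb C.hqc (mul_pos hη hm0)
  obtain ⟨δ2, hδ2, hKu⟩ := exists_Kunif hk C.hb hη
  set δ := min δ1 δ2 / 2 with hδdef
  have hδ : 0 < δ := by have := lt_min hδ1 hδ2; positivity
  have hδl1 : δ < δ1 := by have := lt_min hδ1 hδ2; have := min_le_left δ1 δ2; rw [hδdef]; linarith
  have hδl2 : δ < δ2 := by have := lt_min hδ1 hδ2; have := min_le_right δ1 δ2; rw [hδdef]; linarith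
  set c4 := min (1 / 8) (δ / D) with hc4
  have hc4p : 0 < c4 := lt_min (by norm_num) (by positivity)
  have hsl : 0 < √lam := Real.sqrt_pos.2 hl
  set d3 := 4 / √lam with hd3
  have hd3p : 0 < d3 := by positivity
  set C3 := 2 * max (d3 * D / δ) 1 with hC3
  set B := 2 * (π * Qfun k q xs * (1 + η) ^ 6) with hB
  have hQpos : ∀ x ∈ closure Ω, 0 < Qfun k q x := by
    intro x hx
    unfold Qfun
    have h1 := C.hq3 x hx
    have h2 := Real.sqrt_pos.2 (detKH_pos C.hk x)
    positivity
  have hQxs0 := hQpos xs (subset_closure hxs)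
  refine ⟨d3 / c4, by positivity, ?_⟩
  filter_upwards [ceps_upper C hxs hη, ev_01 one_pos,
    ev_L (((Kc lam C3 * √B + 4 * π) / (2 * π * η * m)) ^ 2 + 1)] with ε hce hε hLbig u hu hne hdiam
  have hL := log_inv_pos hε.1 hε.2
  set L := log (1 / ε) with hLdef
  set A := vcore q Ω ε u with hA
  have hdist := core_dist_pos C hε.1 hε.2 hu hne hF
  change 0 < distE A (frontier Ω) at hdist
  obtain ⟨w, hw, hwE, hwA⟩ := exists_w C hε.1 hε.2 hu hne
  obtain ⟨hT, hTE, hTl, hT0⟩ := tr_energy C hw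
  have hAc : IsPreconnected A := core_preconn C hε.1 hε.2 hu
  have hAΩ : A ⊆ Ω := fun x hx => hx.1
  obtain ⟨c, hcA, b, hbF, hcb⟩ := exists_near hdist hne hF
  obtain ⟨x2, hx2A, hx2⟩ := exists_far hdiam hcA
  have hcΩ := hAΩ hcA
  have hcC := subset_closure hcΩ
  have hbΩ : b ∉ Ω := by rw [C.ho.frontier_eq] at hbF; exact hbF.2
  set dd := distE A (frontier Ω) with hdd
  have hddD : dd ≤ D := (distE_le hcA hbF).trans (hDD _ hcC _ (frontier_subset_closure hbF))
  have hdiamD : diamE A ≤ D := diamE_le hD.le fun x hx y hy => hDD _ (subset_closure (hAΩ hx)) _ (subset_closure (hAΩ hy))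
  set ρ := c4 * diamE A with hρ
  have hρp : 0 < ρ := by positivity
  have hρ8 : ρ ≤ diamE A / 8 := by
    have : c4 ≤ 1 / 8 := min_le_left _ _
    rw [hρ]; nlinarith
  have hρδ : ρ ≤ δ := by
    have : c4 ≤ δ / D := min_le_right _ _
    calc ρ ≤ δ / D * D := by rw [hρ]; gcongr
      _ = δ := by field_simp
  have hqcm := hmq c hcC
  have hEpos : 0 < B * L := by positivity
  have hcap := cap (c := c) (lam := lam) (κ := (1 + η)⁻¹) (δ := δ) (d2 := d3 * dd) (ρ := ρ) (E0 := B * L) (C3 := C3)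
    (M := (1 - η) * q c * L - 2) hk C.ho hT hl (fun x hx => hlam x (subset_closure hx)) (hlam c hcC)
    (by
      refine hTE.trans (hwE.trans ?_)
      have := hce.2
      rw [hB]; linarith)
    hEpos (by positivity) hδ (by positivity) hρp
    (by
      have h1 : d3 * dd ≤ d3 * D := by gcongr
      rw [hC3]
      rcases le_total δ (d3 * dd) with h | h
      · rw [min_eq_left h]
        have : d3 * D / δ * δ ≤ max (d3 * D / δ) 1 * δ := by gcongr; exact le_max_left _ _
        rw [div_mul_cancel₀ _ hδ.ne'] at this
        linarith
      · rw [min_eq_right h]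
        have h2 : 1 * (d3 * dd) ≤ max (d3 * D / δ) 1 * (d3 * dd) := by gcongr; exact le_max_right _ _
        linarith)
    (by
      intro x hx hxn a
      have h1 := TT_dE hk c (Ti k c x)
      rw [TT_Ti hk] at h1
      have h2 : √(n2 (Ti k c x)) ≤ δ := by
        rw [← Real.sqrt_sq hδ.le]; exact Real.sqrt_le_sqrt hxn
      have h3 : dist c x < δ2 := by rw [dist_comm]; exact (dist_le_dE x c).trans_lt (by linarith)
      have h4 := hKu c hcC x (subset_closure hx) h3 a
      rw [inv_mul_le_iff₀ (by positivity)]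
      exact h4)
    (by
      intro r hr hrρ
      obtain ⟨θ, hθ, hPA, hPd⟩ := hM_lem hk hAc hcA hx2A hr (by linarith)
      refine ⟨θ, hθ, ?_⟩
      have h1 := hTl _ (hAΩ hPA)
      have h2 := hwA _ hPA
      have h3 : dist (PT k c r θ) c < δ1 := (dist_le_dE _ _).trans_lt (by linarith)
      have h4 := (abs_lt.1 (hq _ (subset_closure (hAΩ hPA)) c hcC h3)).1
      have h5 : (1 - η) * q c ≤ q (PT k c r θ) := by nlinarith
      have h6 := mul_le_mul_of_nonneg_right h5 hL.le
      linarith)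
    (by
      intro r hr
      have hr0 : 0 < r := lt_of_lt_of_le (by positivity) hr
      have h1 := n2_le hk c (Ti k c b)
      rw [TT_Ti hk, dE_comm] at h1
      have h2 : lam * n2 (Ti k c b) ≤ (2 * dd) ^ 2 := by
        have e1 := mul_le_mul_of_nonneg_right (hlam c hcC) (n2_nonneg (Ti k c b))
        have e2 := dE_nonneg c b
        have e3 : dE c b ^ 2 ≤ (2 * dd) ^ 2 := by gcongr
        linarith
      have h3 : n2 (Ti k c b) < r ^ 2 := by
        have e1 : (d3 * dd) ^ 2 ≤ r ^ 2 := by gcongr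
        have e2 : (d3 * dd) ^ 2 * lam = 16 * dd ^ 2 := by
          have := Real.sq_sqrt hl.le
          rw [hd3]; field_simp; rw [this]; ring
        have e3 : 0 < dd ^ 2 := by positivity
        by_contra! hcon
        have e4 : (d3 * dd) ^ 2 * lam ≤ n2 (Ti k c b) * lam := by gcongr; linarith
        have e5 : (2 * dd) ^ 2 = 4 * dd ^ 2 := by ring
        have e6 := mul_comm lam (n2 (Ti k c b))
        linarith
      obtain ⟨θ, hθ, hn⟩ := hz_lem hk C.ho hsc hbΩ hr0 h3
      exact ⟨θ, hθ, hT0 _ hn⟩)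
    (by
      have hbig := big_L (B := B) (Kc_nonneg lam C3) (by positivity) hLbig
      have e1 : 2 * π * η * m * L ≤ 2 * π * η * q c * L := by gcongr
      have e2 : 0 ≤ 2 * π * (1 - 2 * η) * q c * L := by
        have : 0 < 1 - 2 * η := by linarith
        have : 0 < q c := by linarith
        positivity
      nlinarith)
  have hbig := big_L (B := B) (Kc_nonneg lam C3) (by positivity) hLbig
  have hfin := final_ineq hη hη4 hL hm0 hqcm (hQpos x0 hx0) hQxs (hmin c hcC)
    (Real.sqrt_pos.2 (detKH_pos hk c)) rfl (by rw [hB]; ring) rfl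
    (Real.log_nonneg (by have := le_max_right (d3 * dd / ρ) 1; linarith)) hbig hcap
  have he : d3 / c4 * (dd / diamE A) = d3 * dd / ρ := by rw [hρ]; field_simp
  rw [he]
  exact hfin

end
end

section

section
variable {k p ε : ℝ} {Ω : Set (ℝ × ℝ)} {q : ℝ × ℝ → ℝ} {u : ℝ → ℝ × ℝ → ℝ}

lemma exists_eta {s : ℝ} (hs : s < 1) : ∃ η, 0 < η ∧ η < 1 / 4 ∧ s < (1 - 2 * η) ^ 2 / (1 + η) ^ 8 := by
  have hc : ContinuousAt (fun η : ℝ => (1 - 2 * η) ^ 2 / (1 + η) ^ 8) 0 := by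
    apply ContinuousAt.div (by fun_prop) (by fun_prop) (by norm_num)
  have h1 := hc.eventually (Ioi_mem_nhds (show s < (1 - 2 * (0:ℝ)) ^ 2 / (1 + 0) ^ 8 by norm_num; exact hs))
  have h2 : ∀ᶠ η : ℝ in 𝓝[>] 0, s < (1 - 2 * η) ^ 2 / (1 + η) ^ 8 := nhdsWithin_le_nhds h1
  obtain ⟨η, h3, h4⟩ := (h2.and (ev_01 (show (0:ℝ) < 1 / 4 by norm_num))).exists
  exact ⟨η, h4.1, h4.2, h3⟩

lemma main_thm (C : Ctx k p Ω q) (hsc : SimplyConnectedSpace ↥Ω)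
    {x0 : ℝ × ℝ} (hx0 : x0 ∈ closure Ω) (hmin : ∀ y ∈ closure Ω, Qfun k q x0 ≤ Qfun k q y)
    (hu : ∀ ε ∈ Ioo (0:ℝ) 1, IsMPSolution k p ε q Ω (u ε)) :
    Tendsto (fun ε => log (distE (vcore q Ω ε (u ε)) (frontier Ω) / diamE (vcore q Ω ε (u ε))) / log (1 / ε))
      (𝓝[>] 0) (𝓝 1) ∧
    ∀ α ∈ Ioo (0:ℝ) 1, ∃ C₁ > 0, ∃ C₂ > 0, ∀ᶠ ε in 𝓝[>] 0,
      C₁ * ε ≤ diamE (vcore q Ω ε (u ε)) ∧ diamE (vcore q Ω ε (u ε)) ≤ C₂ * ε ^ α := by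
  have hpi := Real.pi_pos
  have hF : (frontier Ω).Nonempty := by
    rw [nonempty_iff_ne_empty]
    intro he
    have hcl := isClopen_iff_frontier_eq_empty.2 he
    rcases isClopen_iff.1 hcl with h | h
    · exact C.hcn.nonempty.ne_empty h
    · have := C.hb
      rw [h] at this
      exact NormedSpace.unbounded_univ ℝ (ℝ × ℝ) this
  obtain ⟨D, hD, hDD⟩ := exists_D C.hb
  obtain ⟨xs, hxs⟩ := C.hcn.nonempty
  have hQxs : 0 < Qfun k q xs := by
    unfold Qfun
    have h1 := C.hq3 xs (subset_closure hxs)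
    have h2 := Real.sqrt_pos.2 (detKH_pos C.hk xs)
    positivity
  obtain ⟨C1, hC1, hlow⟩ := diam_lower C (C0 := π * Qfun k q xs * (1 + 1) ^ 6) (by positivity)
  -- basic facts, eventually
  have hbasic : ∀ᶠ ε in 𝓝[>] 0, 0 < ε ∧ ε < 1 ∧ (vcore q Ω ε (u ε)).Nonempty ∧
      C1 * ε ≤ diamE (vcore q Ω ε (u ε)) ∧ 0 < distE (vcore q Ω ε (u ε)) (frontier Ω) ∧
      distE (vcore q Ω ε (u ε)) (frontier Ω) ≤ D := by
    filter_upwards [ceps_upper C hxs one_pos, ev_01 one_pos] with ε hce hε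
    have hm := hu ε hε
    have hne := core_nonempty C hε.1 hε.2 hm hce.1
    refine ⟨hε.1, hε.2, hne, hlow ε _ hε.1 hε.2 hm hne hce.2, core_dist_pos C hε.1 hε.2 hm hne hF, ?_⟩
    obtain ⟨a, ha⟩ := hne
    obtain ⟨b, hb⟩ := hF
    exact (distE_le ha hb).trans (hDD _ (subset_closure ha.1) _ (frontier_subset_closure hb))
  have hlower : ∀ s < 1, 0 < s → ∀ᶠ ε in 𝓝[>] 0, s * log (1 / ε) ≤
      log (distE (vcore q Ω ε (u ε)) (frontier Ω) / diamE (vcore q Ω ε (u ε))) := by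
    intro s hs hs0
    set s' := (1 + s) / 2 with hs'
    have hss : s < s' := by rw [hs']; linarith
    obtain ⟨η, hη, hη4, hηs⟩ := exists_eta (show s' < 1 by rw [hs']; linarith)
    obtain ⟨X, hX, hev⟩ := lower_log C hsc hF hx0 hmin hη hη4
    filter_upwards [hbasic, hev, ev_L (log 2 / s'), ev_L (log (2 * X) / (s' - s))] with ε hb hl hL1 hL2
    obtain ⟨hε0, hε1, hne, hdl, hdp, hdD⟩ := hb
    have hL := log_inv_pos hε0 hε1
    have hdiam : 0 < diamE (vcore q Ω ε (u ε)) := lt_of_lt_of_le (by positivity) hdl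
    have h1 := hl (u ε) (hu ε ⟨hε0, hε1⟩) hne hdiam
    set R := distE (vcore q Ω ε (u ε)) (frontier Ω) / diamE (vcore q Ω ε (u ε)) with hR
    have hRp : 0 < R := by positivity
    have h2 : s' * log (1 / ε) ≤ log (2 * max (X * R) 1) :=
      le_trans (mul_le_mul_of_nonneg_right hηs.le hL.le) h1
    rw [div_lt_iff₀ (by linarith)] at hL1 hL2
    rcases le_total (X * R) 1 with h | h
    · rw [max_eq_right h, mul_one] at h2
      linarith
    · rw [max_eq_left h, ← mul_assoc, Real.log_mul (by positivity) hRp.ne'] at h2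
      linarith
  refine ⟨?_, ?_⟩
  · rw [Metric.tendsto_nhds]
    intro e he
    set e' := min (e / 2) (1 / 2) with he'
    have he'0 : 0 < e' := lt_min (by linarith) (by norm_num)
    have he'1 : e' ≤ e / 2 := min_le_left _ _
    have he'2 : e' ≤ 1 / 2 := min_le_right _ _
    filter_upwards [hbasic, hlower (1 - e') (by linarith) (by linarith), ev_L (log (D / C1) / e')]
      with ε hb hl hL1
    obtain ⟨hε0, hε1, hne, hdl, hdp, hdD⟩ := hb
    have hL := log_inv_pos hε0 hε1
    have hdiam : 0 < diamE (vcore q Ω ε (u ε)) := lt_of_lt_of_le (by positivity) hdl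
    rw [div_lt_iff₀ he'0] at hL1
    have hup : log (distE (vcore q Ω ε (u ε)) (frontier Ω) / diamE (vcore q Ω ε (u ε)))
        ≤ log (D / C1) + log (1 / ε) := by
      rw [← Real.log_mul (by positivity) (by positivity)]
      apply Real.log_le_log (by positivity)
      calc _ ≤ D / (C1 * ε) := by gcongr
        _ = _ := by field_simp
    rw [Real.dist_eq, abs_lt]
    constructor
    · have : 1 - e' ≤ log (distE (vcore q Ω ε (u ε)) (frontier Ω) / diamE (vcore q Ω ε (u ε))) / log (1 / ε) := by
        rw [le_div_iff₀ hL]; exact hl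
      linarith
    · have : log (distE (vcore q Ω ε (u ε)) (frontier Ω) / diamE (vcore q Ω ε (u ε))) / log (1 / ε) ≤ 1 + e' := by
        rw [div_le_iff₀ hL]; linarith
      linarith
  · intro α hα
    refine ⟨C1, hC1, D, hD, ?_⟩
    filter_upwards [hbasic, hlower α hα.2 hα.1] with ε hb hl
    obtain ⟨hε0, hε1, hne, hdl, hdp, hdD⟩ := hb
    have hdiam : 0 < diamE (vcore q Ω ε (u ε)) := lt_of_lt_of_le (by positivity) hdl
    refine ⟨hdl, ?_⟩
    rw [Real.log_div hdp.ne' hdiam.ne', one_div, Real.log_inv] at hl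
    have h1 := Real.log_le_log hdp hdD
    rw [← Real.log_le_log_iff hdiam (by positivity), Real.log_mul hD.ne' (by positivity), Real.log_rpow hε0]
    linarith

end
end

/-- Lemma 3.6 and its remark:
`ln(dist(A_ε,∂Ω)/diam(A_ε))/ln(1/ε) → 1`; in particular, for any `α ∈ (0,1)` there
are `C₁, C₂ > 0` with `C₁ ε ≤ diam(A_ε) ≤ C₂ ε^α` for `ε` small. -/
theorem statement14 (k p : ℝ) (hk : 0 < k) (hp : 1 < p)
    (Ω : Set (ℝ × ℝ)) (hΩo : IsOpen Ω) (hΩc : IsConnected Ω)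
    (hΩb : Bornology.IsBounded Ω) (hΩsc : SimplyConnectedSpace ↥Ω)
    (q : ℝ × ℝ → ℝ) (hq1 : ContDiffOn ℝ 2 q Ω) (hq2 : ContDiffOn ℝ 1 q (closure Ω))
    (hq3 : ∀ x ∈ closure Ω, 0 < q x) (hq4 : ∀ x ∈ Ω, LH k q x = 0)
    (hmin : ∃ x0 ∈ closure Ω, x0.2 = 0 ∧ ∀ y ∈ closure Ω, Qfun k q x0 ≤ Qfun k q y)
    (u : ℝ → ℝ × ℝ → ℝ)
    (hu : ∀ ε ∈ Set.Ioo (0:ℝ) 1, IsMPSolution k p ε q Ω (u ε))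
    :
    Tendsto (fun ε =>
        Real.log (distE (vcore q Ω ε (u ε)) (frontier Ω) / diamE (vcore q Ω ε (u ε)))
          / Real.log (1 / ε)) (𝓝[>] (0:ℝ)) (𝓝 1) ∧
    ∀ α ∈ Set.Ioo (0:ℝ) 1, ∃ C₁ > (0:ℝ), ∃ C₂ > (0:ℝ), ∀ᶠ ε in 𝓝[>] (0:ℝ),
      C₁ * ε ≤ diamE (vcore q Ω ε (u ε)) ∧ diamE (vcore q Ω ε (u ε)) ≤ C₂ * ε ^ α := by
  obtain ⟨x0, hx0, _, hmin'⟩ := hmin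
  exact main_thm ⟨hk, hp, hΩo, hΩc, hΩb, hq1, hq2.continuousOn, hq3, hq4⟩ hΩsc hx0 hmin' hu
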